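/- Suppose k ∈ ℕ, s ∈ ℝ with s ∉ {-k, ..., -1}, and N > 1 if s < -1. Let u ∈ D'(ℝ^N) satisfy ∇^k u ∈ (L^p_s)^{ν(k,N)} with 1 ≤ p < ∞. Then there is a polynomial π_u ∈ P_{k-1}, independent of p and independent of s within each connected component of ℝ \ {-k, ..., -1}, and unique if s < -k, such that ∇^{k-j}(u - π_u) ∈ (L^q_{s+j})^{ν(k-j,N)} for every 1 ≤ j ≤ k and every q ∈ I_{j,p}, and for each such j, q there is a constant C = C(s,j,p,q) > 0 independent of u such that ||\,|∇^{k-j}(u - π_u)|\,||_{L^q_{s+j}} ≤ C ||\,|∇^k u|\,||_{L^p_s}. Furthermore, lim_{|x|→∞} |x|^{-(s+j)} (∇^{k-j}u(x) - ∇^{k-j}π_u(x)) = 0 if p = N = j = 1 or if 1 ≤ j ≤ k and p > N/j. -/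

import Mathlib

open MeasureTheory Metric Filter Topology ENNReal

noncomputable section

/-- Euclidean space `ℝ^N`. -/
abbrev Euc (N : ℕ) := EuclideanSpace ℝ (Fin N)

/-- Iterated classical partial derivative along a list of coordinate directions. -/
def pderivList {N : ℕ} : List (Fin N) → (Euc N → ℝ) → Euc N → ℝ
  | [], φ => φ
  | i :: l, φ => pderivList l fun x => fderiv ℝ φ x (EuclideanSpace.single i 1)

/-- `g` is the weak (distributional) partial derivative of `u` of order given by the
list `l` of coordinate directions, i.e. `g = ∂_{l₁} ⋯ ∂_{l_r} u` in `D'(ℝ^N)`. -/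
def IsWeakDerivList {N : ℕ} (l : List (Fin N)) (u g : Euc N → ℝ) : Prop :=
  LocallyIntegrable u volume ∧ LocallyIntegrable g volume ∧
    ∀ φ : Euc N → ℝ, ContDiff ℝ (⊤ : ℕ∞) φ → HasCompactSupport φ →
      ∫ x, u x * pderivList l φ x = (-1 : ℝ) ^ l.length * ∫ x, g x * φ x

/-- `g` is the weak partial derivative `∂ᵢ u`. -/
def IsWeakPartialDeriv {N : ℕ} (i : Fin N) (u g : Euc N → ℝ) : Prop :=
  IsWeakDerivList [i] u g

/-- The weight `(1+|x|)^{-s-N/q}` of the space `L^q_s` (with `N/∞ := 0`). -/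
def wt (N : ℕ) (s : ℝ) (q : ℝ≥0∞) (x : Euc N) : ℝ :=
  (1 + ‖x‖) ^ (-s - (N : ℝ) / q.toReal)

/-- Membership in the weighted space `L^q_s`. -/
def MemLs (N : ℕ) (s : ℝ) (q : ℝ≥0∞) (u : Euc N → ℝ) : Prop :=
  MemLp (fun x => wt N s q x * u x) q volume

/-- The norm of the weighted space `L^q_s`. -/
def LsNorm (N : ℕ) (s : ℝ) (q : ℝ≥0∞) (u : Euc N → ℝ) : ℝ :=
  (eLpNorm (fun x => wt N s q x * u x) q volume).toReal

/-- Membership in the exponentially weighted space `L^q_{exp,s}`. -/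
def MemLexp (N : ℕ) (s : ℝ) (q : ℝ≥0∞) (u : Euc N → ℝ) : Prop :=
  MemLp (fun x => Real.exp (-(s * ‖x‖)) * u x) q volume

/-- The norm of the exponentially weighted space `L^q_{exp,s}`. -/
def LexpNorm (N : ℕ) (s : ℝ) (q : ℝ≥0∞) (u : Euc N → ℝ) : ℝ :=
  (eLpNorm (fun x => Real.exp (-(s * ‖x‖)) * u x) q volume).toReal

/-- The pointwise Euclidean (Frobenius) norm `|∇^k u|` of the `k`-th gradient, whose
components `g m` are indexed by the `k`-tuples `m` of coordinate directions. -/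
def gradNormK {N k : ℕ} (g : (Fin k → Fin N) → Euc N → ℝ) (x : Euc N) : ℝ :=
  Real.sqrt (∑ m : Fin k → Fin N, g m x ^ 2)

/-- The pointwise Euclidean norm `|∇u|` of a first-order gradient. -/
def gradNorm1 {N : ℕ} (g : Fin N → Euc N → ℝ) (x : Euc N) : ℝ :=
  Real.sqrt (∑ i, g i x ^ 2)

/-- The interval `I_{j,p}` of admissible exponents `q`. -/
def Ijp (N j : ℕ) (p : ℝ) : Set ℝ≥0∞ :=
  if p = (N : ℝ) / (j : ℝ) ∧ 1 < N then Set.Ico (ENNReal.ofReal p) ⊤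
  else if p < (N : ℝ) / (j : ℝ) then
    Set.Icc (ENNReal.ofReal p) (ENNReal.ofReal ((N : ℝ) * p / ((N : ℝ) - (j : ℝ) * p)))
  else Set.Icc (ENNReal.ofReal p) ⊤

/-- The average of `u` on the ball `B_ρ`. -/
def ballAvg {N : ℕ} (ρ : ℝ) (u : Euc N → ℝ) : ℝ :=
  (volume (ball (0 : Euc N) ρ)).toReal⁻¹ * ∫ y in ball (0 : Euc N) ρ, u y

/-- The radial symmetrization `u_S(x) = (Nω_N)⁻¹ ∫_{S^{N-1}} u(|x|σ) dσ`. -/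
def radialSymmetrization {N : ℕ} (u : Euc N → ℝ) (x : Euc N) : ℝ :=
  ((N : ℝ) * (volume (ball (0 : Euc N) 1)).toReal)⁻¹ *
    ∫ σ : sphere (0 : Euc N) 1, u (‖x‖ • (σ : Euc N)) ∂((volume : Measure (Euc N)).toSphere)

/-- `u` is radially symmetric: `u x` only depends on `|x|`. -/
def RadSymm {N : ℕ} (u : Euc N → ℝ) : Prop :=
  ∀ x y : Euc N, ‖x‖ = ‖y‖ → u x = u y

/-- Evaluation of a polynomial on `ℝ^N` at a point. -/
def polyEval {N : ℕ} (π : MvPolynomial (Fin N) ℝ) (x : Euc N) : ℝ :=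
  MvPolynomial.eval (fun i => x i) π



theorem lintegral_comp_smul_aux {N : ℕ} (f : Euc N → ℝ≥0∞) {t : ℝ} (ht : 0 < t) :
    ∫⁻ x, f (t • x) = ENNReal.ofReal (t ^ (-(N : ℝ))) * ∫⁻ x, f x := by
  have h := Measure.map_addHaar_smul (volume : Measure (Euc N)) ht.ne'
  have he : MeasurableEmbedding (fun x : Euc N => t • x) :=
    (Homeomorph.smulOfNeZero t ht.ne').measurableEmbedding
  rw [← he.lintegral_map, h, lintegral_smul_measure]
  congr 2
  rw [finrank_euclideanSpace, Fintype.card_fin, abs_of_nonneg (by positivity),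
    Real.rpow_neg ht.le, Real.rpow_natCast]

theorem lintegral_comp_affine_aux {N : ℕ} (f : Euc N → ℝ≥0∞) (a : Euc N) {t : ℝ} (ht : 0 < t) :
    ∫⁻ x, f (a + t • x) = ENNReal.ofReal (t ^ (-(N : ℝ))) * ∫⁻ x, f x := by
  rw [lintegral_comp_smul_aux (fun x => f (a + x)) ht, lintegral_add_left_eq_self]

theorem lintegral_rpow_le_aux {α : Type*} [MeasurableSpace α] (μ : Measure α) {p : ℝ} (hp : 1 ≤ p)
    {f : α → ℝ≥0∞} (hf : AEMeasurable f μ) :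
    (∫⁻ a, f a ∂μ) ^ p ≤ μ Set.univ ^ (p - 1) * ∫⁻ a, f a ^ p ∂μ := by
  rcases hp.eq_or_lt with rfl | hp
  · simp
  have hpq := Real.HolderConjugate.conjExponent hp
  have h := ENNReal.lintegral_mul_le_Lp_mul_Lq μ hpq hf (aemeasurable_const (b := (1 : ℝ≥0∞)))
  simp only [Pi.mul_apply, mul_one, ENNReal.one_rpow, lintegral_one] at h
  calc (∫⁻ a, f a ∂μ) ^ p ≤ ((∫⁻ a, f a ^ p ∂μ) ^ (1 / p) * μ Set.univ ^ (1 / p.conjExponent)) ^ p :=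
        ENNReal.rpow_le_rpow h (by linarith)
    _ = _ := by
      rw [ENNReal.mul_rpow_of_nonneg _ _ (by linarith), ← ENNReal.rpow_mul, ← ENNReal.rpow_mul,
        one_div_mul_cancel (by linarith), ENNReal.rpow_one, mul_comm]
      congr 2
      unfold Real.conjExponent
      field_simp

/-- Weighted Jensen inequality. -/
theorem lintegral_rpow_weight_aux {α : Type*} [MeasurableSpace α] (μ : Measure α) {p : ℝ}
    (hp : 1 ≤ p) {f w : α → ℝ≥0∞} (hf : AEMeasurable f μ) (hw : AEMeasurable w μ)
    (hw0 : ∀ᵐ a ∂μ, w a ≠ 0) (hwt : ∀ᵐ a ∂μ, w a ≠ ⊤) :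
    (∫⁻ a, f a ∂μ) ^ p ≤ (∫⁻ a, w a ∂μ) ^ (p - 1) * ∫⁻ a, w a ^ (1 - p) * f a ^ p ∂μ := by
  have h1 : ∫⁻ a, f a ∂μ = ∫⁻ a, (w a)⁻¹ * f a ∂(μ.withDensity w) := by
    have hm : AEMeasurable (fun a => (w a)⁻¹ * f a) μ := hw.inv.mul hf
    rw [lintegral_withDensity_eq_lintegral_mul₀ hw hm]
    apply lintegral_congr_ae
    filter_upwards [hw0, hwt] with a h0 ht
    simp only [Pi.mul_apply]
    rw [← mul_assoc, ENNReal.mul_inv_cancel h0 ht, one_mul]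
  have hfm : AEMeasurable (fun a => (w a)⁻¹ * f a) (μ.withDensity w) :=
    (hw.inv.mul hf).mono_ac (withDensity_absolutelyContinuous _ _)
  rw [h1]
  refine (lintegral_rpow_le_aux _ hp hfm).trans ?_
  rw [withDensity_apply _ MeasurableSet.univ, setLIntegral_univ]
  refine mul_le_mul_right ?_ _
  have hm : AEMeasurable (fun a => ((w a)⁻¹ * f a) ^ p) μ := (hw.inv.mul hf).pow_const p
  rw [lintegral_withDensity_eq_lintegral_mul₀ hw hm]
  apply le_of_eq
  apply lintegral_congr_ae
  filter_upwards [hw0, hwt] with a h0 ht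
  simp only [Pi.mul_apply]
  rw [ENNReal.mul_rpow_of_nonneg _ _ (by linarith), ← mul_assoc, ENNReal.inv_rpow,
    sub_eq_add_neg, ENNReal.rpow_add _ _ h0 ht, ENNReal.rpow_one, ENNReal.rpow_neg]

theorem enorm_sub_le_lintegral_aux {N : ℕ} {u : Euc N → ℝ} (hu : ContDiff ℝ 1 u) (x v : Euc N)
    {a b : ℝ} (hab : a ≤ b) :
    ‖u (x + b • v) - u (x + a • v)‖ₑ ≤
      ‖v‖ₑ * ∫⁻ t in Set.Ioc a b, ‖fderiv ℝ u (x + t • v)‖ₑ := by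
  have hd : ∀ t : ℝ, HasDerivAt (fun t : ℝ => u (x + t • v)) (fderiv ℝ u (x + t • v) v) t := by
    intro t
    have h1 : HasFDerivAt u (fderiv ℝ u (x + t • v)) (x + t • v) :=
      (hu.differentiable (by simp)).differentiableAt.hasFDerivAt
    have h2 : HasDerivAt (fun t : ℝ => x + t • v) v t := by
      simpa using ((hasDerivAt_id t).smul_const v).const_add x
    exact h1.comp_hasDerivAt t h2
  have hc : Continuous fun t : ℝ => fderiv ℝ u (x + t • v) v := by
    have := hu.continuous_fderiv (by simp)
    fun_prop
  rw [← intervalIntegral.integral_eq_sub_of_hasDerivAt (fun t _ => hd t) (hc.intervalIntegrable _ _),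
    intervalIntegral.integral_of_le hab, ← lintegral_const_mul']
  · refine (enorm_integral_le_lintegral_enorm _).trans ?_
    apply lintegral_mono
    intro t
    beta_reduce
    rw [mul_comm]
    exact ContinuousLinearMap.le_opENorm _ _
  · finiteness

theorem measurable_enorm_fderiv_aux {N : ℕ} {u : Euc N → ℝ} (hu : ContDiff ℝ 1 u) :
    Measurable fun x => ‖fderiv ℝ u x‖ₑ :=
  (hu.continuous_fderiv (by simp)).enorm.measurable

theorem continuous_enorm_fderiv_aux {N : ℕ} {u : Euc N → ℝ} (hu : ContDiff ℝ 1 u) :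
    Continuous fun x => ‖fderiv ℝ u x‖ₑ :=
  (hu.continuous_fderiv (by simp)).enorm



def PoincareSet {N : ℕ} (p : ℝ) (U : Set (Euc N)) : Prop :=
  ∃ C : ℝ≥0∞, C ≠ ⊤ ∧ ∀ u : Euc N → ℝ, ContDiff ℝ 1 u → ∃ c : ℝ,
    ∫⁻ x in U, ‖u x - c‖ₑ ^ p ≤ C * ∫⁻ x in U, ‖fderiv ℝ u x‖ₑ ^ p

theorem poincare_half_aux {N : ℕ} {p : ℝ} (hp : 1 ≤ p) {K : Set (Euc N)} (hK : Convex ℝ K)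
    (hKm : MeasurableSet K) {D : ℝ≥0∞}
    (hD : ∀ x ∈ K, ∀ y ∈ K, ‖y - x‖ₑ ≤ D) {u : Euc N → ℝ} (hu : ContDiff ℝ 1 u) :
    ∫⁻ y in K, ∫⁻ x in K, ‖u (x + (1 / 2 : ℝ) • (y - x)) - u x‖ₑ ^ p ≤
      volume K * (D ^ p * ENNReal.ofReal (2 ^ (N : ℝ))) * ∫⁻ x in K, ‖fderiv ℝ u x‖ₑ ^ p := by
  set H : Euc N → ℝ≥0∞ := K.indicator fun x => ‖fderiv ℝ u x‖ₑ ^ p with hH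
  have hHm : Measurable H := ((measurable_enorm_fderiv_aux hu).pow_const p).indicator hKm
  have key : ∀ y ∈ K, ∫⁻ x in K, ‖u (x + (1 / 2 : ℝ) • (y - x)) - u x‖ₑ ^ p ≤
      (D ^ p * ENNReal.ofReal (2 ^ (N : ℝ))) * ∫⁻ x, H x := by
    intro y hy
    calc ∫⁻ x in K, ‖u (x + (1 / 2 : ℝ) • (y - x)) - u x‖ₑ ^ p
        ≤ ∫⁻ x in K, D ^ p * ∫⁻ t in Set.Ioc (0 : ℝ) (1 / 2), H (x + t • (y - x)) := by
          apply setLIntegral_mono' hKm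
          intro x hx
          have h1 := enorm_sub_le_lintegral_aux hu x (y - x) (a := 0) (b := 1 / 2) (by norm_num)
          rw [zero_smul, add_zero] at h1
          have h2 : (∫⁻ t in Set.Ioc (0 : ℝ) (1 / 2), ‖fderiv ℝ u (x + t • (y - x))‖ₑ) ^ p ≤
              ∫⁻ t in Set.Ioc (0 : ℝ) (1 / 2), H (x + t • (y - x)) := by
            refine (lintegral_rpow_le_aux _ hp ?_).trans ?_
            · have := (measurable_enorm_fderiv_aux hu).comp
                (g := fun z => ‖fderiv ℝ u z‖ₑ) (f := fun t : ℝ => x + t • (y - x)) (by fun_prop)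
              exact this.aemeasurable
            · rw [Measure.restrict_apply_univ, Real.volume_Ioc]
              have h3 : ENNReal.ofReal (1 / 2 - 0) ^ (p - 1) ≤ 1 := by
                apply ENNReal.rpow_le_one _ (by linarith)
                rw [ENNReal.ofReal_le_one]; norm_num
              calc _ ≤ 1 * _ := mul_le_mul_left h3 _
                _ = _ := by
                  rw [one_mul]
                  apply setLIntegral_congr_fun measurableSet_Ioc
                  intro t ht
                  simp only [hH]
                  rw [Set.indicator_of_mem]
                  exact hK.add_smul_sub_mem hx hy ⟨ht.1.le, by linarith [ht.2]⟩
          calc _ ≤ (D * ∫⁻ t in Set.Ioc (0 : ℝ) (1 / 2), ‖fderiv ℝ u (x + t • (y - x))‖ₑ) ^ p := by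
                apply ENNReal.rpow_le_rpow _ (by linarith)
                exact h1.trans (mul_le_mul_left (hD x hx y hy) _)
            _ ≤ _ := by
                rw [ENNReal.mul_rpow_of_nonneg _ _ (by linarith)]
                exact mul_le_mul_right h2 _
      _ ≤ ∫⁻ x, D ^ p * ∫⁻ t in Set.Ioc (0 : ℝ) (1 / 2), H (x + t • (y - x)) :=
          setLIntegral_le_lintegral _ _
      _ = D ^ p * ∫⁻ x, ∫⁻ t in Set.Ioc (0 : ℝ) (1 / 2), H (x + t • (y - x)) := by
          rw [lintegral_const_mul]
          have : Measurable fun z : Euc N × ℝ => H (z.1 + z.2 • (y - z.1)) := hHm.comp (by fun_prop)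
          exact this.lintegral_prod_right'
      _ = D ^ p * ∫⁻ t in Set.Ioc (0 : ℝ) (1 / 2), ∫⁻ x, H (x + t • (y - x)) := by
          rw [lintegral_lintegral_swap]
          exact (hHm.comp (f := fun z : Euc N × ℝ => z.1 + z.2 • (y - z.1)) (by fun_prop)).aemeasurable
      _ ≤ D ^ p * ∫⁻ t in Set.Ioc (0 : ℝ) (1 / 2), ENNReal.ofReal (2 ^ (N : ℝ)) * ∫⁻ x, H x := by
          refine mul_le_mul_right ?_ _
          apply setLIntegral_mono' measurableSet_Ioc
          intro t ht
          have : ∀ x, x + t • (y - x) = t • y + (1 - t) • x := by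
            intro x; module
          simp_rw [this]
          rw [lintegral_comp_affine_aux H (t • y) (by linarith [ht.2] : (0:ℝ) < 1 - t)]
          gcongr
          rw [Real.rpow_neg (by linarith [ht.2]), ← Real.inv_rpow (by linarith [ht.2])]
          apply Real.rpow_le_rpow (inv_nonneg.2 (by linarith [ht.2])) _ (by positivity)
          rw [inv_le_comm₀ (by linarith [ht.2]) (by norm_num)]
          linarith [ht.2]
      _ ≤ D ^ p * (1 * (ENNReal.ofReal (2 ^ (N : ℝ)) * ∫⁻ x, H x)) := by
          gcongr
          rw [setLIntegral_const, mul_comm, Real.volume_Ioc]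
          gcongr
          rw [ENNReal.ofReal_le_one]; norm_num
      _ = _ := by rw [one_mul, mul_assoc]
  calc _ ≤ ∫⁻ y in K, (D ^ p * ENNReal.ofReal (2 ^ (N : ℝ))) * ∫⁻ x, H x :=
        setLIntegral_mono' hKm key
    _ = _ := by
        rw [setLIntegral_const, hH, lintegral_indicator hKm]
        ring

set_option maxHeartbeats 1000000 in
theorem poincare_convex {N : ℕ} {p : ℝ} (hp : 1 ≤ p) {K : Set (Euc N)} (hK : Convex ℝ K)
    (hKm : MeasurableSet K) (hKb : Bornology.IsBounded K) (hK0 : volume K ≠ 0) :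
    PoincareSet p K := by
  have hKt : volume K ≠ ⊤ := hKb.measure_lt_top.ne
  obtain ⟨d, hd⟩ := Metric.isBounded_iff.1 hKb
  have hD : ∀ x ∈ K, ∀ y ∈ K, ‖y - x‖ₑ ≤ ENNReal.ofReal d := by
    intro x hx y hy
    rw [← ofReal_norm, ← dist_eq_norm]
    exact ENNReal.ofReal_le_ofReal (hd hy hx)
  set A := volume K * (ENNReal.ofReal d ^ p * ENNReal.ofReal (2 ^ (N : ℝ))) with hA
  have hAt : A ≠ ⊤ := by rw [hA]; finiteness
  refine ⟨(volume K)⁻¹ * (2 ^ (p - 1) * (2 * A)), ?_, ?_⟩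
  · have : (volume K)⁻¹ ≠ ⊤ := ENNReal.inv_ne_top.2 hK0
    finiteness
  intro u hu
  have h1 := poincare_half_aux hp hK hKm hD hu
  rw [← hA] at h1
  have hcu : Continuous u := hu.continuous
  have hm2 : Measurable fun z : Euc N × Euc N => ‖u z.2 - u z.1‖ₑ ^ p :=
    (Continuous.measurable (by fun_prop)).pow_const p
  have hm3 : Measurable fun z : Euc N × Euc N =>
      ‖u (z.2 + (1 / 2 : ℝ) • (z.1 - z.2)) - u z.2‖ₑ ^ p :=
    (Continuous.measurable (by fun_prop)).pow_const p
  have hm4 : Measurable fun z : Euc N × Euc N =>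
      ‖u (z.1 + (1 / 2 : ℝ) • (z.2 - z.1)) - u z.1‖ₑ ^ p :=
    (Continuous.measurable (by fun_prop)).pow_const p
  have h2 : ∫⁻ y in K, ∫⁻ x in K, ‖u x - u y‖ₑ ^ p ≤
      2 ^ (p - 1) * (2 * A) * ∫⁻ x in K, ‖fderiv ℝ u x‖ₑ ^ p := by
    calc ∫⁻ y in K, ∫⁻ x in K, ‖u x - u y‖ₑ ^ p
        ≤ ∫⁻ y in K, ∫⁻ x in K, 2 ^ (p - 1) * (‖u (x + (1 / 2 : ℝ) • (y - x)) - u x‖ₑ ^ p +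
            ‖u (y + (1 / 2 : ℝ) • (x - y)) - u y‖ₑ ^ p) := by
          gcongr with y x
          refine le_trans ?_ (ENNReal.rpow_add_le_mul_rpow_add_rpow _ _ hp)
          gcongr
          have e1 : x + (1 / 2 : ℝ) • (y - x) = y + (1 / 2 : ℝ) • (x - y) := by module
          rw [e1]
          have e2 : u x - u y = (u (y + (1 / 2 : ℝ) • (x - y)) - u y) -
            (u (y + (1 / 2 : ℝ) • (x - y)) - u x) := by ring
          rw [add_comm]
          calc ‖u x - u y‖ₑ = _ := congrArg _ e2
            _ ≤ _ := enorm_sub_le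
      _ = 2 ^ (p - 1) * ((∫⁻ y in K, ∫⁻ x in K, ‖u (x + (1 / 2 : ℝ) • (y - x)) - u x‖ₑ ^ p) +
            ∫⁻ y in K, ∫⁻ x in K, ‖u (y + (1 / 2 : ℝ) • (x - y)) - u y‖ₑ ^ p) := by
          rw [← lintegral_add_left hm3.lintegral_prod_right', ← lintegral_const_mul]
          · congr 1; ext y
            have hm3' : Measurable fun x => ‖u (x + (1 / 2 : ℝ) • (y - x)) - u x‖ₑ ^ p :=
              (Continuous.measurable (by fun_prop)).pow_const p
            rw [lintegral_const_mul' _ _ (by finiteness), lintegral_add_left hm3']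
          · exact hm3.lintegral_prod_right'.add hm4.lintegral_prod_right'
      _ ≤ _ := by
          rw [lintegral_lintegral_swap (f := fun y x => ‖u (y + (1 / 2 : ℝ) • (x - y)) - u y‖ₑ ^ p)
            hm4.aemeasurable, mul_assoc]
          gcongr
          rw [two_mul, add_mul]
          exact add_le_add h1 h1
  obtain ⟨y, -, hy⟩ := exists_le_setLAverage (μ := volume) (s := K) hK0 hKt
    (f := fun y => ∫⁻ x in K, ‖u x - u y‖ₑ ^ p) hm2.lintegral_prod_right'.aemeasurable
  refine ⟨u y, hy.trans ?_⟩
  rw [setLAverage_eq, ENNReal.div_eq_inv_mul, mul_assoc]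
  gcongr

theorem enorm_const_sub_aux {N : ℕ} {p : ℝ} (hp : 1 ≤ p) (V : Set (Euc N))
    {u : Euc N → ℝ} (hu : Continuous u) (hV0 : volume V ≠ 0)
    (hVt : volume V ≠ ⊤) (a b : ℝ) :
    ‖a - b‖ₑ ^ p ≤ (volume V)⁻¹ * (2 ^ (p - 1) *
      ((∫⁻ x in V, ‖u x - a‖ₑ ^ p) + ∫⁻ x in V, ‖u x - b‖ₑ ^ p)) := by
  have h : ‖a - b‖ₑ ^ p * volume V ≤ 2 ^ (p - 1) *
      ((∫⁻ x in V, ‖u x - a‖ₑ ^ p) + ∫⁻ x in V, ‖u x - b‖ₑ ^ p) := by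
    have hm : Measurable fun x => ‖u x - a‖ₑ ^ p :=
      (Continuous.measurable (by fun_prop)).pow_const p
    have hm' : Measurable fun x => ‖u x - b‖ₑ ^ p :=
      (Continuous.measurable (by fun_prop)).pow_const p
    rw [← setLIntegral_const, ← lintegral_add_left hm, ← lintegral_const_mul' _ _ (by finiteness)]
    gcongr with x
    refine le_trans ?_ (ENNReal.rpow_add_le_mul_rpow_add_rpow _ _ hp)
    gcongr
    have e2 : a - b = (u x - b) - (u x - a) := by ring
    rw [add_comm]
    calc ‖a - b‖ₑ = _ := congrArg _ e2
      _ ≤ _ := enorm_sub_le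
  rw [← ENNReal.div_eq_inv_mul]
  exact (ENNReal.le_div_iff_mul_le (Or.inl hV0) (Or.inl hVt)).2 h



/-- weighted energy -/
def En {N : ℕ} (s p : ℝ) (F : Euc N → ℝ≥0∞) : ℝ≥0∞ :=
  ∫⁻ x, ENNReal.ofReal ((1 + ‖x‖) ^ (-s * p - N)) * F x ^ p

theorem rpow_comparable {a b K : ℝ} (ha : 0 < a) (hb : 0 < b) (hK : 1 ≤ K) (hab : a ≤ K * b)
    (hba : b ≤ K * a) (r : ℝ) : a ^ r ≤ K ^ |r| * b ^ r := by
  have hK0 : 0 < K := by linarith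
  rcases le_total 0 r with hr | hr
  · rw [abs_of_nonneg hr, ← Real.mul_rpow hK0.le hb.le]
    exact Real.rpow_le_rpow ha.le hab hr
  · rw [abs_of_nonpos hr]
    have h1 : b / K ≤ a := by rw [div_le_iff₀ hK0]; linarith
    have h2 := Real.rpow_le_rpow_of_nonpos (by positivity) h1 hr
    rw [Real.div_rpow hb.le hK0.le] at h2
    rw [Real.rpow_neg hK0.le, mul_comm, ← div_eq_mul_inv]
    exact h2

theorem measurable_wt_aux {N : ℕ} (r : ℝ) :
    Measurable fun x : Euc N => ENNReal.ofReal ((1 + ‖x‖) ^ r) := by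
  fun_prop

theorem measurable_wt_hom {N : ℕ} (r : ℝ) :
    Measurable fun x : Euc N => ENNReal.ofReal (‖x‖ ^ r) := by
  fun_prop

theorem hardy_hom {N : ℕ} {p s : ℝ} (hp : 1 ≤ p) {T : Set ℝ} (hT : MeasurableSet T)
    (hT0 : ∀ t ∈ T, 0 < t) {h : Euc N → ℝ≥0∞} (hh : Measurable h) :
    ∫⁻ x, ENNReal.ofReal (‖x‖ ^ (-(s + 1) * p - N)) * (‖x‖ₑ * ∫⁻ t in T, h (t • x)) ^ p ≤
      (∫⁻ t in T, ENNReal.ofReal (t ^ s)) ^ p *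
        ∫⁻ x, ENNReal.ofReal (‖x‖ ^ (-s * p - N)) * h x ^ p := by
  set M := ∫⁻ t in T, ENNReal.ofReal (t ^ s) with hM
  set G : Euc N → ℝ≥0∞ := fun x => ENNReal.ofReal (‖x‖ ^ (-s * p - N)) * h x ^ p with hG
  have hGm : Measurable G := (measurable_wt_hom _).mul (hh.pow_const p)
  have hjm : Measurable fun z : Euc N × ℝ => h (z.2 • z.1) := hh.comp (by fun_prop)
  have hjm2 : Measurable fun z : Euc N × ℝ =>
      ENNReal.ofReal (z.2 ^ s) ^ (1 - p) * h (z.2 • z.1) ^ p :=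
    ((by fun_prop : Measurable fun z : Euc N × ℝ => ENNReal.ofReal (z.2 ^ s)).pow_const _).mul
      (hjm.pow_const p)
  have hjm3 : Measurable fun z : Euc N × ℝ =>
      ENNReal.ofReal (‖z.1‖ ^ (-s * p - N)) *
        (ENNReal.ofReal (z.2 ^ s) ^ (1 - p) * h (z.2 • z.1) ^ p) :=
    ((measurable_wt_hom _).comp measurable_fst).mul hjm2
  have h1 : ∀ x : Euc N, ENNReal.ofReal (‖x‖ ^ (-(s + 1) * p - N)) *
      (‖x‖ₑ * ∫⁻ t in T, h (t • x)) ^ p ≤ M ^ (p - 1) * ∫⁻ t in T,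
        ENNReal.ofReal (‖x‖ ^ (-s * p - N)) *
        (ENNReal.ofReal (t ^ s) ^ (1 - p) * h (t • x) ^ p) := by
    intro x
    by_cases hx : x = 0
    · subst hx
      simp [show 0 < p by linarith]
    have hx0 : 0 < ‖x‖ := norm_pos_iff.2 hx
    rw [ENNReal.mul_rpow_of_nonneg _ _ (by linarith), lintegral_const_mul'
      _ _ (by finiteness), ← mul_assoc (M ^ (p - 1)), mul_comm (M ^ (p - 1)), mul_assoc, ← mul_assoc]
    have e : ENNReal.ofReal (‖x‖ ^ (-(s + 1) * p - N)) * ‖x‖ₑ ^ p =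
        ENNReal.ofReal (‖x‖ ^ (-s * p - N)) := by
      rw [← ofReal_norm, ENNReal.ofReal_rpow_of_pos hx0, ← ENNReal.ofReal_mul (by positivity),
        ← Real.rpow_add hx0]
      congr 2; ring
    rw [e]
    refine mul_le_mul_right ?_ _
    apply lintegral_rpow_weight_aux _ hp
    · exact (hjm.comp (measurable_prodMk_left (x := x))).aemeasurable
    · exact (by fun_prop : Measurable fun t : ℝ => ENNReal.ofReal (t ^ s)).aemeasurable
    · filter_upwards [ae_restrict_mem hT] with t ht
      simp [Real.rpow_pos_of_pos (hT0 t ht)]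
    · simp
  calc _ ≤ ∫⁻ x, M ^ (p - 1) * ∫⁻ t in T,
        ENNReal.ofReal (‖x‖ ^ (-s * p - N)) *
        (ENNReal.ofReal (t ^ s) ^ (1 - p) * h (t • x) ^ p) := lintegral_mono h1
    _ = M ^ (p - 1) * ∫⁻ x, ∫⁻ t in T, ENNReal.ofReal (‖x‖ ^ (-s * p - N)) *
        (ENNReal.ofReal (t ^ s) ^ (1 - p) * h (t • x) ^ p) := by
        rw [lintegral_const_mul]
        exact hjm3.lintegral_prod_right'
    _ = M ^ (p - 1) * ∫⁻ t in T, ∫⁻ x, ENNReal.ofReal (‖x‖ ^ (-s * p - N)) *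
        (ENNReal.ofReal (t ^ s) ^ (1 - p) * h (t • x) ^ p) := by
        rw [lintegral_lintegral_swap]
        exact hjm3.aemeasurable
    _ = M ^ (p - 1) * ∫⁻ t in T, ENNReal.ofReal (t ^ s) * ∫⁻ x, G x := by
        congr 1
        apply setLIntegral_congr_fun hT
        intro t ht
        have ht0 := hT0 t ht
        have e2 : ∀ x : Euc N, ENNReal.ofReal (‖x‖ ^ (-s * p - N)) *
            (ENNReal.ofReal (t ^ s) ^ (1 - p) * h (t • x) ^ p) =
            ENNReal.ofReal (t ^ (s + N)) * G (t • x) := by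
          intro x
          simp only [hG]
          rw [norm_smul, Real.norm_of_nonneg ht0.le, Real.mul_rpow ht0.le (norm_nonneg _),
            ENNReal.ofReal_mul (by positivity), ENNReal.ofReal_rpow_of_pos (by positivity),
            ← Real.rpow_mul ht0.le]
          have : ENNReal.ofReal (t ^ (s * (1 - p))) = ENNReal.ofReal (t ^ (s + N)) *
              ENNReal.ofReal (t ^ (-s * p - N)) := by
            rw [← ENNReal.ofReal_mul (by positivity), ← Real.rpow_add ht0]
            congr 2; ring
          rw [this]; ring
        simp_rw [e2]
        rw [lintegral_const_mul' _ _ (by finiteness), lintegral_comp_smul_aux _ ht0, ← mul_assoc,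
          ← ENNReal.ofReal_mul (by positivity), ← Real.rpow_add ht0]
        congr 3; ring
    _ = _ := by
        rw [lintegral_mul_const, ← mul_assoc]
        · congr 1
          have := ENNReal.rpow_add_of_nonneg (x := M) (p - 1) 1 (by linarith) (by norm_num)
          rw [ENNReal.rpow_one, sub_add_cancel] at this
          exact this.symm
        · fun_prop

theorem hardy_M_Ioc {s : ℝ} (hs : -1 < s) : ∫⁻ t in Set.Ioc (0:ℝ) 1, ENNReal.ofReal (t ^ s) ≠ ⊤ := by
  have h : IntegrableOn (fun t : ℝ => t ^ s) (Set.Ioc 0 1) :=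
    (intervalIntegrable_iff_integrableOn_Ioc_of_le zero_le_one).1
      (intervalIntegral.intervalIntegrable_rpow' hs)
  have := h.lintegral_lt_top
  exact this.ne

theorem hardy_M_Ioi {s : ℝ} (hs : s < -1) : ∫⁻ t in Set.Ioi (1:ℝ), ENNReal.ofReal (t ^ s) ≠ ⊤ := by
  have h : IntegrableOn (fun t : ℝ => t ^ s) (Set.Ioi 1) := integrableOn_Ioi_rpow_of_lt hs one_pos
  have := h.lintegral_lt_top
  exact this.ne

/-- embedding between weighted spaces on the real line of exponents -/
theorem En_embed {N : ℕ} {p s s' : ℝ} (hp : 1 ≤ p) (hs : s < s') :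
    ∃ C : ℝ≥0∞, C ≠ ⊤ ∧ ∀ F : Euc N → ℝ≥0∞, AEMeasurable F →
      (En s' 1 F) ^ p ≤ C * En s p F := by
  set w : Euc N → ℝ≥0∞ := fun x => ENNReal.ofReal ((1 + ‖x‖) ^ (-(N + (s' - s)))) with hw
  have hfin : ∫⁻ x, w x ≠ ⊤ := by
    have := finite_integral_one_add_norm (μ := (volume : Measure (Euc N))) (r := N + (s' - s))
      (by simp [finrank_euclideanSpace]; linarith)
    exact this.ne
  refine ⟨(∫⁻ x, w x) ^ (p - 1), by finiteness, ?_⟩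
  intro F hF
  unfold En
  refine (lintegral_rpow_weight_aux volume hp (w := w) ?_ ?_ ?_ ?_).trans ?_
  · exact (measurable_wt_aux _).aemeasurable.mul (hF.pow_const 1)
  · exact (measurable_wt_aux _).aemeasurable
  · refine Eventually.of_forall fun x => ?_
    simp only [hw, ne_eq, ENNReal.ofReal_eq_zero, not_le]; positivity
  · simp [hw]
  refine mul_le_mul_right (lintegral_mono fun x => ?_) _
  have hx : 0 < 1 + ‖x‖ := by positivity
  rw [ENNReal.rpow_one, ENNReal.mul_rpow_of_nonneg _ _ (by linarith), ← mul_assoc]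
  refine mul_le_mul_left ?_ _
  simp only [hw]
  rw [ENNReal.ofReal_rpow_of_pos (by positivity), ENNReal.ofReal_rpow_of_pos (by positivity),
    ← ENNReal.ofReal_mul (by positivity)]
  apply ENNReal.ofReal_le_ofReal
  rw [← Real.rpow_mul hx.le, ← Real.rpow_mul hx.le, ← Real.rpow_add hx]
  apply Real.rpow_le_rpow_of_exponent_le (by linarith [norm_nonneg x])
  nlinarith

theorem En_mono {N : ℕ} {s p : ℝ} (hp : 0 ≤ p) {F G : Euc N → ℝ≥0∞} (h : ∀ᵐ x, F x ≤ G x) :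
    En s p F ≤ En s p G := by
  apply lintegral_mono_ae
  filter_upwards [h] with x hx
  gcongr

theorem En_add_le {N : ℕ} {s p : ℝ} (hp : 1 ≤ p) {F G : Euc N → ℝ≥0∞} (hF : AEMeasurable F) :
    En s p (fun x => F x + G x) ≤ 2 ^ (p - 1) * (En s p F + En s p G) := by
  unfold En
  have hm : AEMeasurable fun x : Euc N => ENNReal.ofReal ((1 + ‖x‖) ^ (-s * p - N)) * F x ^ p :=
    (measurable_wt_aux _).aemeasurable.mul (hF.pow_const p)
  rw [← lintegral_add_left' hm,
    ← lintegral_const_mul' _ _ (by finiteness)]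
  apply lintegral_mono
  intro x
  have := ENNReal.rpow_add_le_mul_rpow_add_rpow (F x) (G x) hp
  calc _ ≤ ENNReal.ofReal ((1 + ‖x‖) ^ (-s * p - N)) * (2 ^ (p - 1) * (F x ^ p + G x ^ p)) :=
        mul_le_mul_right this _
    _ = _ := by ring

theorem En_const_mul {N : ℕ} {s p : ℝ} (hp : 0 ≤ p) {F : Euc N → ℝ≥0∞} {c : ℝ≥0∞} (hc : c ≠ ⊤) :
    En s p (fun x => c * F x) = c ^ p * En s p F := by
  unfold En
  rw [← lintegral_const_mul' _ _ (by finiteness)]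
  congr 1; ext x
  rw [ENNReal.mul_rpow_of_nonneg _ _ hp]; ring

/-- local energy against weighted energy on balls -/
theorem setLIntegral_ball_le_En {N : ℕ} {s p R : ℝ} (hR : 0 ≤ R) (F : Euc N → ℝ≥0∞) :
    ∫⁻ x in closedBall (0 : Euc N) R, F x ^ p ≤
      ENNReal.ofReal ((1 + R) ^ |(-s * p - N)|) * En s p F := by
  unfold En
  rw [← lintegral_const_mul' _ _ (by finiteness)]
  refine le_trans ?_ (setLIntegral_le_lintegral (closedBall (0 : Euc N) R) _)
  apply setLIntegral_mono' measurableSet_closedBall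
  intro x hx
  have hx' : ‖x‖ ≤ R := by simpa using hx
  have := rpow_comparable (a := 1) (b := 1 + ‖x‖) (K := 1 + R) one_pos (by positivity) (by linarith)
    (by nlinarith [norm_nonneg x]) (by linarith) (-s * p - N)
  rw [Real.one_rpow] at this
  rw [← mul_assoc, ← ENNReal.ofReal_mul (by positivity)]
  calc F x ^ p = 1 * F x ^ p := (one_mul _).symm
    _ ≤ _ := by
      refine mul_le_mul_left ?_ _
      rw [← ENNReal.ofReal_one]
      exact ENNReal.ofReal_le_ofReal this

theorem En_indicator_ball_le {N : ℕ} {s p R : ℝ} (hp : 0 < p) (hR : 0 ≤ R) (F : Euc N → ℝ≥0∞) :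
    En s p ((closedBall (0 : Euc N) R).indicator F) ≤
      ENNReal.ofReal ((1 + R) ^ |(-s * p - N)|) * ∫⁻ x in closedBall (0 : Euc N) R, F x ^ p := by
  unfold En
  rw [← lintegral_const_mul' _ _ (by finiteness), ← lintegral_indicator measurableSet_closedBall]
  apply lintegral_mono
  intro x
  by_cases hx : x ∈ closedBall (0 : Euc N) R
  · simp only [Set.indicator_of_mem hx]
    have hx' : ‖x‖ ≤ R := by simpa using hx
    have := rpow_comparable (a := 1 + ‖x‖) (b := 1) (K := 1 + R) (by positivity) one_pos (by linarith)
      (by linarith) (by nlinarith [norm_nonneg x]) (-s * p - N)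
    rw [Real.one_rpow, mul_one] at this
    gcongr
  · simp only [Set.indicator_of_notMem hx]
    simp [hp]



theorem enorm_clm_zero {N : ℕ} : ‖(0 : Euc N →L[ℝ] ℝ)‖ₑ = 0 := by
  rw [← ofReal_norm, norm_zero, ENNReal.ofReal_zero]

theorem enorm_clm_add_le {N : ℕ} (a b : Euc N →L[ℝ] ℝ) : ‖a + b‖ₑ ≤ ‖a‖ₑ + ‖b‖ₑ := by
  rw [← ofReal_norm, ← ofReal_norm, ← ofReal_norm, ← ENNReal.ofReal_add (by positivity)
    (by positivity)]
  exact ENNReal.ofReal_le_ofReal (norm_add_le _ _)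

theorem enorm_clm_smul {N : ℕ} (c : ℝ) (a : Euc N →L[ℝ] ℝ) : ‖c • a‖ₑ = ‖c‖ₑ * ‖a‖ₑ := by
  rw [← ofReal_norm, ← ofReal_norm, ← ofReal_norm, ← ENNReal.ofReal_mul (by positivity), norm_smul]

theorem enorm_clm_neg {N : ℕ} (a : Euc N →L[ℝ] ℝ) : ‖-a‖ₑ = ‖a‖ₑ := by
  rw [← ofReal_norm, ← ofReal_norm, norm_neg]

theorem volume_closedBall_ne_zero {N : ℕ} {R : ℝ} (hR : 0 < R) (a : Euc N) :
    volume (closedBall a R) ≠ 0 :=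
  (Metric.measure_closedBall_pos volume a hR).ne'

theorem poincare_ball {N : ℕ} {p : ℝ} (hp : 1 ≤ p) :
    PoincareSet p (closedBall (0 : Euc N) 2) :=
  poincare_convex hp (convex_closedBall 0 2) measurableSet_closedBall isBounded_closedBall
    (volume_closedBall_ne_zero (by norm_num) _)

set_option maxHeartbeats 1000000 in
theorem hardy_gt {N : ℕ} {p s : ℝ} (hp : 1 ≤ p) (hs : -1 < s) :
    ∃ C : ℝ≥0∞, C ≠ ⊤ ∧ ∀ u : Euc N → ℝ, ContDiff ℝ 1 u → ∃ c : ℝ,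
      En (s + 1) p (fun x => ‖u x - c‖ₑ) ≤ C * En s p (fun x => ‖fderiv ℝ u x‖ₑ) := by
  obtain ⟨Cp, hCp, hP⟩ := poincare_ball (N := N) hp
  have hp0 : 0 < p := by linarith
  let χ : ContDiffBump (0 : Euc N) := ⟨1, 2, one_pos, by norm_num⟩
  have hχc : ContDiff ℝ 1 (χ : Euc N → ℝ) := χ.contDiff
  obtain ⟨K, hK⟩ : ∃ K : ℝ, ∀ x, ‖fderiv ℝ (χ : Euc N → ℝ) x‖ ≤ K :=
    (χ.hasCompactSupport.fderiv (𝕜 := ℝ)).exists_bound_of_continuous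
      (hχc.continuous_fderiv (by simp))
  set M := ∫⁻ t in Set.Ioc (0:ℝ) 1, ENNReal.ofReal (t ^ s) with hM
  have hMt : M ≠ ⊤ := hardy_M_Ioc hs
  set A1 := ENNReal.ofReal ((1 + 2) ^ |(-(s + 1) * p - N)|) with hA1
  set A2 := ENNReal.ofReal ((1 + 2) ^ |(-s * p - N)|) with hA2
  set B1 := ENNReal.ofReal (2 ^ |(-(s + 1) * p - N)|) with hB1
  set B2 := ENNReal.ofReal (2 ^ |(-s * p - N)|) with hB2
  refine ⟨A1 * (Cp * A2) + B1 * (M ^ p * (B2 * (2 ^ (p - 1) * (1 + ENNReal.ofReal K ^ p *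
    (A2 * (Cp * A2)))))), ?_, ?_⟩
  · simp only [hA1, hA2, hB1, hB2]; finiteness
  intro u hu
  obtain ⟨c, hc⟩ := hP u hu
  refine ⟨c, ?_⟩
  have hcu := hu.continuous
  set E := En s p (fun x => ‖fderiv ℝ u x‖ₑ) with hE
  have hloc : ∫⁻ x in closedBall (0 : Euc N) 2, ‖u x - c‖ₑ ^ p ≤ Cp * (A2 * E) :=
    hc.trans (mul_le_mul_right (setLIntegral_ball_le_En (by norm_num) _) _)
  set w : Euc N → ℝ := fun x => (1 - χ x) * (u x - c) with hw
  have hwc : ContDiff ℝ 1 w := (contDiff_const.sub hχc).mul (hu.sub contDiff_const)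
  have hw1 : ∀ x, ‖x‖ < 1 → w =ᶠ[𝓝 x] 0 := by
    intro x hx
    have : ball (0 : Euc N) 1 ∈ 𝓝 x := isOpen_ball.mem_nhds (by simpa using hx)
    filter_upwards [this] with y hy
    have : χ y = 1 := χ.one_of_mem_closedBall (ball_subset_closedBall hy)
    simp [hw, this]
  have hw0 : w 0 = 0 := (hw1 0 (by simp)).self_of_nhds
  have hdw1 : ∀ x, ‖x‖ < 1 → fderiv ℝ w x = 0 := by
    intro x hx
    rw [(hw1 x hx).fderiv_eq]; simp
  have hdw : ∀ x, ‖fderiv ℝ w x‖ₑ ≤ ‖fderiv ℝ u x‖ₑ +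
      ENNReal.ofReal K * (closedBall (0 : Euc N) 2).indicator (fun x => ‖u x - c‖ₑ) x := by
    intro x
    have h1 : HasFDerivAt w ((1 - χ x) • (fderiv ℝ u x) +
        (u x - c) • (-(fderiv ℝ (χ : Euc N → ℝ) x))) x := by
      have a1 : HasFDerivAt (fun x => 1 - χ x) (-(fderiv ℝ (χ : Euc N → ℝ) x)) x :=
        ((hχc.differentiable (by simp)) x).hasFDerivAt.const_sub 1
      have a2 : HasFDerivAt (fun x => u x - c) (fderiv ℝ u x) x :=
        ((hu.differentiable (by simp)) x).hasFDerivAt.sub_const c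
      exact a1.mul a2
    rw [h1.fderiv]
    refine (enorm_clm_add_le _ _).trans ?_
    gcongr
    · rw [enorm_clm_smul]
      calc _ ≤ 1 * ‖fderiv ℝ u x‖ₑ := by
            refine mul_le_mul_left ?_ _
            rw [← ofReal_norm, Real.norm_of_nonneg (by linarith [χ.le_one (x := x)]),
              ENNReal.ofReal_le_one]
            linarith [χ.nonneg (x := x)]
        _ = _ := one_mul _
    · by_cases hx : x ∈ closedBall (0 : Euc N) 2
      · rw [Set.indicator_of_mem hx, enorm_clm_smul, enorm_clm_neg, mul_comm]
        refine mul_le_mul_left ?_ _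
        rw [← ofReal_norm]
        exact ENNReal.ofReal_le_ofReal (hK x)
      · have : fderiv ℝ (χ : Euc N → ℝ) x = 0 := by
          have h2 : x ∉ tsupport (χ : Euc N → ℝ) := by rw [χ.tsupport_eq]; exact hx
          have := notMem_tsupport_iff_eventuallyEq.1 h2
          rw [this.fderiv_eq]; simp
        rw [this, neg_zero, smul_zero, enorm_clm_zero]; exact zero_le
  have hwx : ∀ x, ‖w x‖ₑ ≤ ‖x‖ₑ * ∫⁻ t in Set.Ioc (0:ℝ) 1, ‖fderiv ℝ w (t • x)‖ₑ := by
    intro x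
    have := enorm_sub_le_lintegral_aux hwc 0 x (zero_le_one)
    simpa [hw0] using this
  have hmain := hardy_hom (s := s) hp (T := Set.Ioc 0 1) measurableSet_Ioc (fun t ht => ht.1)
    (measurable_enorm_fderiv_aux hwc)
  have hR : ∫⁻ x, ENNReal.ofReal (‖x‖ ^ (-s * p - N)) * ‖fderiv ℝ w x‖ₑ ^ p ≤
      B2 * (2 ^ (p - 1) * (E + ENNReal.ofReal K ^ p * (A2 * (Cp * (A2 * E))))) := by
    calc _ ≤ ∫⁻ x, B2 * (ENNReal.ofReal ((1 + ‖x‖) ^ (-s * p - N)) * (‖fderiv ℝ u x‖ₑ +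
      ENNReal.ofReal K * (closedBall (0 : Euc N) 2).indicator (fun x => ‖u x - c‖ₑ) x) ^ p) := by
          apply lintegral_mono
          intro x
          beta_reduce
          by_cases hx : ‖x‖ < 1
          · rw [hdw1 x hx, enorm_clm_zero, ENNReal.zero_rpow_of_pos hp0, mul_zero]; exact zero_le
          · push Not at hx
            rw [← mul_assoc, hB2, ← ENNReal.ofReal_mul (by positivity)]
            gcongr
            · apply rpow_comparable <;> linarith
            · exact hdw x
      _ ≤ B2 * (2 ^ (p - 1) * (E + ENNReal.ofReal K ^ p *
          En s p ((closedBall (0 : Euc N) 2).indicator (fun x => ‖u x - c‖ₑ)))) := by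
          rw [lintegral_const_mul' _ _ (by finiteness)]
          refine mul_le_mul_right ?_ _
          rw [← En_const_mul hp0.le (by finiteness)]
          exact En_add_le hp (measurable_enorm_fderiv_aux hu).aemeasurable
      _ ≤ _ := by
          gcongr
          refine (En_indicator_ball_le hp0 (by norm_num) _).trans ?_
          gcongr
  calc En (s + 1) p (fun x => ‖u x - c‖ₑ)
      ≤ ∫⁻ x, (ENNReal.ofReal ((1 + ‖x‖) ^ (-(s + 1) * p - N)) *
          ((closedBall (0 : Euc N) 2).indicator (fun x => ‖u x - c‖ₑ) x) ^ p +
          B1 * (ENNReal.ofReal (‖x‖ ^ (-(s + 1) * p - N)) *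
            (‖x‖ₑ * ∫⁻ t in Set.Ioc (0:ℝ) 1, ‖fderiv ℝ w (t • x)‖ₑ) ^ p)) := by
        apply lintegral_mono
        intro x
        beta_reduce
        by_cases hx : x ∈ closedBall (0 : Euc N) 2
        · rw [Set.indicator_of_mem hx]; exact le_self_add
        · refine le_trans ?_ le_add_self
          have hx' : 2 < ‖x‖ := by simpa using hx
          have h0 : χ x = 0 := χ.zero_of_le_dist (by simpa [χ] using hx'.le)
          have h1 : w x = u x - c := by simp [hw, h0]
          rw [← mul_assoc, hB1, ← ENNReal.ofReal_mul (by positivity), ← h1]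
          gcongr
          · apply rpow_comparable <;> linarith
          · exact hwx x
    _ = En (s + 1) p ((closedBall (0 : Euc N) 2).indicator (fun x => ‖u x - c‖ₑ)) + B1 *
          ∫⁻ x, (ENNReal.ofReal (‖x‖ ^ (-(s + 1) * p - N)) *
            (‖x‖ₑ * ∫⁻ t in Set.Ioc (0:ℝ) 1, ‖fderiv ℝ w (t • x)‖ₑ) ^ p) := by
        rw [lintegral_add_left, lintegral_const_mul' _ _ (by finiteness)]
        · rfl
        · refine (measurable_wt_aux _).mul (Measurable.pow_const ?_ p)
          exact (Continuous.measurable (by fun_prop)).indicator measurableSet_closedBall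
    _ ≤ A1 * (Cp * (A2 * E)) + B1 * (M ^ p * (B2 * (2 ^ (p - 1) *
          (E + ENNReal.ofReal K ^ p * (A2 * (Cp * (A2 * E))))))) := by
        refine add_le_add ?_ (mul_le_mul_right (hmain.trans (mul_le_mul_right hR _)) _)
        refine (En_indicator_ball_le hp0 (by norm_num) _).trans ?_
        exact mul_le_mul_right hloc _
    _ = _ := by ring



theorem fderiv_comp_smul_aux {N : ℕ} {u : Euc N → ℝ} (hu : ContDiff ℝ 1 u) (R : ℝ) (x : Euc N) :
    fderiv ℝ (fun x => u (R • x)) x = R • fderiv ℝ u (R • x) := by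
  have h1 : HasFDerivAt u (fderiv ℝ u (R • x)) (R • x) :=
    ((hu.differentiable (by simp)) _).hasFDerivAt
  have h2 : HasFDerivAt (fun x : Euc N => R • x) (R • ContinuousLinearMap.id ℝ (Euc N)) x :=
    (hasFDerivAt_id x).const_smul R
  have h3 := (h1.comp x h2).fderiv
  have e : (u ∘ fun x => R • x) = fun x => u (R • x) := rfl
  rw [e] at h3
  rw [h3]
  ext v; simp

/-- The Poincaré constants at scale `R`. -/
theorem poincare_scaled {N : ℕ} (hN : 1 ≤ N) {s : ℝ} (hs : -(N : ℝ) < s) :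
    ∃ C : ℝ≥0∞, C ≠ ⊤ ∧ ∀ u : Euc N → ℝ, ContDiff ℝ 1 u → ∀ R : ℝ, 1 ≤ R → ∃ c : ℝ,
      ∫⁻ x in closedBall (0 : Euc N) 2, ‖u (R • x) - c‖ₑ ≤
        C * ENNReal.ofReal (R ^ (1 + s)) * En s 1 (fun x => ‖fderiv ℝ u x‖ₑ) := by
  obtain ⟨C, hC, h⟩ := poincare_ball (N := N) le_rfl
  refine ⟨C * ENNReal.ofReal (3 ^ (s + N)), by finiteness, ?_⟩
  intro u hu R hR
  have hR0 : 0 < R := by linarith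
  obtain ⟨c, hc⟩ := h (fun x => u (R • x)) (hu.comp (contDiff_const_smul R))
  simp only [ENNReal.rpow_one] at hc
  refine ⟨c, hc.trans ?_⟩
  rw [mul_assoc C, mul_assoc C]
  refine mul_le_mul_right ?_ _
  set H : Euc N → ℝ≥0∞ := (closedBall (0 : Euc N) (2 * R)).indicator fun x => ‖fderiv ℝ u x‖ₑ with hH
  calc ∫⁻ x in closedBall (0 : Euc N) 2, ‖fderiv ℝ (fun x => u (R • x)) x‖ₑ
      = ∫⁻ x, ENNReal.ofReal R * H (R • x) := by
        rw [← lintegral_indicator measurableSet_closedBall]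
        congr 1; ext x
        have hmem : R • x ∈ closedBall (0 : Euc N) (2 * R) ↔ x ∈ closedBall (0 : Euc N) 2 := by
          simp only [mem_closedBall, dist_zero_right, norm_smul, Real.norm_of_nonneg hR0.le]
          rw [mul_comm]
          exact mul_le_mul_iff_left₀ hR0
        by_cases hx : x ∈ closedBall (0 : Euc N) 2
        · rw [Set.indicator_of_mem hx, hH, Set.indicator_of_mem (hmem.2 hx),
            fderiv_comp_smul_aux hu, enorm_clm_smul, ← ofReal_norm, Real.norm_of_nonneg hR0.le]
        · rw [Set.indicator_of_notMem hx, hH, Set.indicator_of_notMem (fun h => hx (hmem.1 h)),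
            mul_zero]
    _ = ENNReal.ofReal (R ^ (1 - (N : ℝ))) * ∫⁻ x, H x := by
        rw [lintegral_const_mul' _ _ (by finiteness), lintegral_comp_smul_aux _ hR0, ← mul_assoc,
          ← ENNReal.ofReal_mul hR0.le]
        congr 2
        rw [sub_eq_add_neg, Real.rpow_add hR0, Real.rpow_one]
    _ ≤ ENNReal.ofReal (R ^ (1 - (N : ℝ))) * (ENNReal.ofReal ((3 * R) ^ (s + N)) *
          En s 1 (fun x => ‖fderiv ℝ u x‖ₑ)) := by
        refine mul_le_mul_right ?_ _
        unfold En
        rw [← lintegral_const_mul' _ _ (by finiteness)]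
        apply lintegral_mono
        intro x
        simp only [hH]
        by_cases hx : x ∈ closedBall (0 : Euc N) (2 * R)
        · rw [Set.indicator_of_mem hx, ENNReal.rpow_one, ← mul_assoc,
            ← ENNReal.ofReal_mul (by positivity)]
          have hx' : ‖x‖ ≤ 2 * R := by simpa using hx
          calc ‖fderiv ℝ u x‖ₑ = 1 * ‖fderiv ℝ u x‖ₑ := (one_mul _).symm
            _ ≤ _ := by
              refine mul_le_mul_left ?_ _
              rw [← ENNReal.ofReal_one]
              apply ENNReal.ofReal_le_ofReal
              have h1 : (1 + ‖x‖) ^ (s + N) ≤ (3 * R) ^ (s + N) :=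
                Real.rpow_le_rpow (by positivity) (by linarith) (by linarith)
              have e : (-s * 1 - (N : ℝ)) = -(s + N) := by ring
              rw [e, Real.rpow_neg (by positivity), ← div_eq_mul_inv, le_div_iff₀ (by positivity),
                one_mul]
              exact h1
        · rw [Set.indicator_of_notMem hx]; exact zero_le
    _ = _ := by
        rw [← mul_assoc, ← ENNReal.ofReal_mul (by positivity),
          ← ENNReal.ofReal_mul (by positivity)]
        congr 2
        rw [Real.mul_rpow (by norm_num) hR0.le, mul_left_comm, ← Real.rpow_add hR0]
        congr 2; ring

theorem enorm_tendsto_aux {N : ℕ} {u : Euc N → ℝ} (hu : ContDiff ℝ 1 u) {x : Euc N}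
    (hx : ∫⁻ t in Set.Ioi (1 : ℝ), ‖fderiv ℝ u (t • x)‖ₑ ≠ ⊤) :
    ∃ c, Tendsto (fun t : ℝ => u (t • x)) atTop (𝓝 c) := by
  have hd : ∀ t : ℝ, HasDerivAt (fun t : ℝ => u (t • x)) (fderiv ℝ u (t • x) x) t := by
    intro t
    have h1 : HasFDerivAt u (fderiv ℝ u (t • x)) (t • x) :=
      (hu.differentiable (by simp)).differentiableAt.hasFDerivAt
    have h2 : HasDerivAt (fun t : ℝ => t • x) x t := by
      simpa using ((hasDerivAt_id t).smul_const x)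
    exact h1.comp_hasDerivAt t h2
  have hc : Continuous fun t : ℝ => fderiv ℝ u (t • x) x := by
    have := hu.continuous_fderiv (by simp)
    fun_prop
  refine ⟨_, tendsto_limUnder_of_hasDerivAt_of_integrableOn_Ioi (a := 1) (fun t _ => hd t) ?_⟩
  refine ⟨hc.aestronglyMeasurable, ?_⟩
  refine lt_of_le_of_lt (lintegral_mono (g := fun t => ‖x‖ₑ * ‖fderiv ℝ u (t • x)‖ₑ) ?_) ?_
  · intro t
    beta_reduce
    rw [mul_comm]
    exact ContinuousLinearMap.le_opENorm _ _
  · rw [lintegral_const_mul' _ _ (by finiteness)]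
    have := hx
    finiteness

theorem radial_limit {N : ℕ} (hN : 1 < N) {s : ℝ} (hs : -(N : ℝ) < s) (hs1 : s < -1)
    {u : Euc N → ℝ} (hu : ContDiff ℝ 1 u) (hE : En s 1 (fun x => ‖fderiv ℝ u x‖ₑ) ≠ ⊤) :
    ∃ c : ℝ, ∀ᵐ x : Euc N, 1 ≤ ‖x‖ →
      ‖u x - c‖ₑ ≤ ‖x‖ₑ * ∫⁻ t in Set.Ioi (1 : ℝ), ‖fderiv ℝ u (t • x)‖ₑ := by
  have hcu := hu.continuous
  set G : Euc N → ℝ≥0∞ := fun x => ‖x‖ₑ * ∫⁻ t in Set.Ioi (1 : ℝ), ‖fderiv ℝ u (t • x)‖ₑ with hG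
  set S := {x : Euc N | 1 ≤ ‖x‖} with hS
  have hSm : MeasurableSet S := measurableSet_le measurable_const measurable_norm
  -- finiteness of G
  have hGfin : ∀ᵐ x : Euc N, 1 ≤ ‖x‖ → ∫⁻ t in Set.Ioi (1 : ℝ), ‖fderiv ℝ u (t • x)‖ₑ ≠ ⊤ := by
    have hm := (measurable_enorm_fderiv_aux hu).indicator hSm
    have h1 := hardy_hom (s := s) le_rfl (T := Set.Ioi 1) measurableSet_Ioi
      (fun t (ht : 1 < t) => by linarith) hm
    simp only [ENNReal.rpow_one] at h1
    have h2 : ∫⁻ x, ENNReal.ofReal (‖x‖ ^ (-s * 1 - N)) * S.indicator (fun x => ‖fderiv ℝ u x‖ₑ) x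
        ≤ ENNReal.ofReal (2 ^ |(-s * 1 - N)|) * En s 1 (fun x => ‖fderiv ℝ u x‖ₑ) := by
      unfold En
      rw [← lintegral_const_mul' _ _ (by finiteness)]
      apply lintegral_mono
      intro x
      by_cases hx : x ∈ S
      · simp only [Set.indicator_of_mem hx, ENNReal.rpow_one]
        have hx' : 1 ≤ ‖x‖ := hx
        rw [← mul_assoc, ← ENNReal.ofReal_mul (by positivity)]
        gcongr
        apply rpow_comparable <;> linarith
      · simp only [Set.indicator_of_notMem hx, mul_zero]; exact zero_le
    have h3 := (h1.trans (mul_le_mul_right h2 _)).trans_lt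
      (by have := hardy_M_Ioi hs1; finiteness)
    have hjm : Measurable fun z : Euc N × ℝ => S.indicator (fun x => ‖fderiv ℝ u x‖ₑ) (z.2 • z.1) :=
      hm.comp (by fun_prop)
    have h4 := ae_lt_top ((measurable_wt_hom _).mul
      (measurable_enorm.mul hjm.lintegral_prod_right')) h3.ne
    filter_upwards [h4] with x hx hx1
    simp only [Pi.mul_apply] at hx
    have e : ∫⁻ t in Set.Ioi (1 : ℝ), S.indicator (fun x => ‖fderiv ℝ u x‖ₑ) (t • x) =
        ∫⁻ t in Set.Ioi (1 : ℝ), ‖fderiv ℝ u (t • x)‖ₑ := by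
      apply setLIntegral_congr_fun measurableSet_Ioi
      intro t ht
      have ht' : 1 < t := ht
      beta_reduce
      rw [Set.indicator_of_mem]
      change 1 ≤ ‖t • x‖
      rw [norm_smul, Real.norm_of_nonneg (by linarith)]
      nlinarith
    rw [e] at hx
    intro htop
    rw [htop, ENNReal.mul_top, ENNReal.mul_top] at hx
    · exact lt_irrefl _ hx
    · simp only [ne_eq, ENNReal.ofReal_eq_zero, not_le]; positivity
    · rw [← ofReal_norm, ne_eq, ENNReal.ofReal_eq_zero, not_le]; linarith
  -- constants
  obtain ⟨C, hC, hP⟩ := poincare_scaled hN.le hs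
  have hR : ∀ n : ℕ, (1 : ℝ) ≤ 2 ^ n := fun n => one_le_pow₀ (by norm_num)
  choose cn hcn using fun n : ℕ => hP u hu (2 ^ n) (hR n)
  have hsum : ∑' n, ∫⁻ x in closedBall (0 : Euc N) 2, ‖u ((2 ^ n : ℝ) • x) - cn n‖ₑ ≠ ⊤ := by
    refine ne_top_of_le_ne_top ?_ (ENNReal.tsum_le_tsum hcn)
    rw [ENNReal.tsum_mul_right, ENNReal.tsum_mul_left]
    have : ∑' n : ℕ, ENNReal.ofReal ((2 ^ n : ℝ) ^ (1 + s)) ≠ ⊤ := by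
      have e : ∀ n : ℕ, ENNReal.ofReal ((2 ^ n : ℝ) ^ (1 + s)) =
          ENNReal.ofReal ((2 : ℝ) ^ (1 + s)) ^ n := by
        intro n
        rw [← ENNReal.ofReal_pow (by positivity), ← Real.rpow_natCast, ← Real.rpow_natCast,
          ← Real.rpow_mul (by norm_num), ← Real.rpow_mul (by norm_num), mul_comm]
      simp_rw [e]
      rw [ENNReal.tsum_geometric]
      apply ENNReal.inv_ne_top.2
      have : ENNReal.ofReal ((2 : ℝ) ^ (1 + s)) < 1 := by
        rw [ENNReal.ofReal_lt_one]
        exact Real.rpow_lt_one_of_one_lt_of_neg (by norm_num) (by linarith)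
      exact (tsub_pos_of_lt this).ne'
    finiteness
  have hae : ∀ᵐ x : Euc N, x ∈ closedBall (0 : Euc N) 2 →
      Tendsto (fun n : ℕ => u ((2 ^ n : ℝ) • x) - cn n) atTop (𝓝 0) := by
    rw [← lintegral_tsum] at hsum
    · have h1 := ae_lt_top (Measurable.tsum ?_) hsum
      · rw [ae_restrict_iff' measurableSet_closedBall] at h1
        filter_upwards [h1] with x hx hxb
        have := ENNReal.tendsto_atTop_zero_of_tsum_ne_top (hx hxb).ne
        rw [tendsto_iff_enorm_sub_tendsto_zero]
        simpa using this
      · intro n; exact Continuous.measurable (by fun_prop)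
    · intro n; exact (Continuous.measurable (by fun_prop)).aemeasurable
  -- pick a good point
  obtain ⟨x0, hx0, hx0b, hx01, hx02⟩ : ∃ x0 : Euc N, True ∧ x0 ∈ closedBall (0 : Euc N) 2 ∧
      (∫⁻ t in Set.Ioi (1 : ℝ), ‖fderiv ℝ u (t • x0)‖ₑ ≠ ⊤) ∧
      Tendsto (fun n : ℕ => u ((2 ^ n : ℝ) • x0) - cn n) atTop (𝓝 0) := by
    set e0 : Euc N := EuclideanSpace.single ⟨0, by omega⟩ (3 / 2 : ℝ) with he0
    have hn0 : ‖e0‖ = 3 / 2 := by rw [he0, PiLp.norm_single]; norm_num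
    have hpos : volume (closedBall e0 (1 / 2)) ≠ 0 := volume_closedBall_ne_zero (by norm_num) _
    have h1 := hGfin.and hae
    obtain ⟨x, hx, hx2⟩ := ((frequently_ae_mem_iff.2 hpos).and_eventually h1).exists
    have hd : ‖x - e0‖ ≤ 1 / 2 := by simpa [dist_eq_norm] using hx
    have h3 : 1 ≤ ‖x‖ := by
      have := norm_sub_norm_le e0 x
      rw [norm_sub_rev] at this
      linarith
    have h4 : x ∈ closedBall (0 : Euc N) 2 := by
      have := norm_sub_norm_le x e0
      simp only [mem_closedBall, dist_zero_right]
      linarith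
    exact ⟨x, trivial, h4, hx2.1 h3, hx2.2 h4⟩
  obtain ⟨c, hc⟩ := enorm_tendsto_aux hu hx01
  have h2n : Tendsto (fun n : ℕ => (2 ^ n : ℝ)) atTop atTop :=
    tendsto_pow_atTop_atTop_of_one_lt (by norm_num)
  have hcnc : Tendsto cn atTop (𝓝 c) := by
    have := (hc.comp h2n).sub hx02
    simpa using this
  refine ⟨c, ?_⟩
  have hlim0 : ∀ᵐ x : Euc N, x ∈ closedBall (0 : Euc N) 2 →
      Tendsto (fun n : ℕ => u ((2 ^ n : ℝ) • x)) atTop (𝓝 c) := by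
    filter_upwards [hae] with x hx hxb
    simpa using (hx hxb).add hcnc
  have hlim : ∀ᵐ x : Euc N, Tendsto (fun n : ℕ => u ((2 ^ n : ℝ) • x)) atTop (𝓝 c) := by
    set Z := {x : Euc N | ¬ (x ∈ closedBall (0 : Euc N) 2 →
      Tendsto (fun n : ℕ => u ((2 ^ n : ℝ) • x)) atTop (𝓝 c))} with hZ
    have hZ0 : volume Z = 0 := hlim0
    have hZm : ∀ m : ℕ, volume ((fun x : Euc N => ((2 ^ m : ℝ)⁻¹) • x) ⁻¹' Z) = 0 := by
      intro m
      rw [Measure.addHaar_preimage_smul _ (by positivity), hZ0, mul_zero]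
    have h5 : ∀ᵐ x : Euc N, ∀ m : ℕ, ((2 ^ m : ℝ)⁻¹) • x ∉ Z := by
      rw [ae_all_iff]
      intro m
      rw [ae_iff]
      simp only [not_not]
      exact hZm m
    filter_upwards [h5] with x hx
    obtain ⟨m, hm⟩ := pow_unbounded_of_one_lt ‖x‖ (by norm_num : (1 : ℝ) < 2)
    have := hx m
    simp only [hZ, Set.mem_ofPred_eq, not_not] at this
    have h6 := this (by
      simp only [mem_closedBall, dist_zero_right, norm_smul, norm_inv, norm_pow, Real.norm_ofNat]
      rw [inv_mul_le_iff₀ (by positivity)]; nlinarith [norm_nonneg x])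
    have h7 := h6.comp (tendsto_add_atTop_nat m)
    refine h7.congr fun n => ?_
    simp only [Function.comp]
    rw [smul_smul, pow_add, mul_assoc, mul_inv_cancel₀ (by positivity), mul_one]
  filter_upwards [hlim] with x hx _
  have h8 : Tendsto (fun n : ℕ => ‖u x - u ((2 ^ n : ℝ) • x)‖ₑ) atTop (𝓝 ‖u x - c‖ₑ) :=
    (tendsto_const_nhds.sub hx).enorm
  refine le_of_tendsto' h8 fun n => ?_
  have h9 := enorm_sub_le_lintegral_aux hu 0 x (hR n)
  simp only [zero_add, one_smul] at h9
  rw [enorm_sub_rev] at h9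
  refine h9.trans (mul_le_mul_right (lintegral_mono_set ?_) _)
  exact fun t ht => ht.1


set_option maxHeartbeats 1000000 in
theorem hardy_lt {N : ℕ} (hN : 1 < N) {p s : ℝ} (hp : 1 ≤ p) (hs : s < -1) :
    ∃ C : ℝ≥0∞, C ≠ ⊤ ∧ ∀ u : Euc N → ℝ, ContDiff ℝ 1 u → ∃ c : ℝ,
      En (s + 1) p (fun x => ‖u x - c‖ₑ) ≤ C * En s p (fun x => ‖fderiv ℝ u x‖ₑ) := by
  obtain ⟨Cp, hCp, hP⟩ := poincare_ball (N := N) hp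
  have hp0 : 0 < p := by linarith
  have hN' : (1 : ℝ) < N := by exact_mod_cast hN
  set M := ∫⁻ t in Set.Ioi (1:ℝ), ENNReal.ofReal (t ^ s) with hM
  have hMt : M ≠ ⊤ := hardy_M_Ioi hs
  set A1 := ENNReal.ofReal ((1 + 2) ^ |(-(s + 1) * p - N)|) with hA1
  set A2 := ENNReal.ofReal ((1 + 2) ^ |(-s * p - N)|) with hA2
  set B1 := ENNReal.ofReal (2 ^ |(-(s + 1) * p - N)|) with hB1
  set B2 := ENNReal.ofReal (2 ^ |(-s * p - N)|) with hB2
  set e0 : Euc N := EuclideanSpace.single ⟨0, by omega⟩ (3 / 2 : ℝ) with he0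
  have hn0 : ‖e0‖ = 3 / 2 := by rw [he0, PiLp.norm_single]; norm_num
  set V := closedBall e0 (1 / 2) with hV
  have hV0 : volume V ≠ 0 := volume_closedBall_ne_zero (by norm_num) _
  have hVt : volume V ≠ ⊤ := measure_closedBall_lt_top.ne
  have hV1 : ∀ x ∈ V, 1 ≤ ‖x‖ ∧ ‖x‖ ≤ 2 := by
    intro x hx
    have hd : ‖x - e0‖ ≤ 1 / 2 := by simpa [hV, dist_eq_norm] using hx
    constructor
    · have := norm_sub_norm_le e0 x
      rw [norm_sub_rev] at this
      linarith
    · have := norm_sub_norm_le x e0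
      linarith
  have hVi : (volume V)⁻¹ ≠ ⊤ := ENNReal.inv_ne_top.2 hV0
  have hbt : volume (closedBall (0 : Euc N) 2) ≠ ⊤ := measure_closedBall_lt_top.ne
  set D := 2 ^ (p - 1) * (Cp * A2 + volume (closedBall (0 : Euc N) 2) * ((volume V)⁻¹ *
    (2 ^ (p - 1) * (A1 * (B1 * (M ^ p * B2)) + Cp * A2)))) with hD
  have hDt : D ≠ ⊤ := by simp only [hD, hA1, hA2, hB1, hB2]; finiteness
  refine ⟨1 + (A1 * D + B1 * (M ^ p * B2)), ?_, ?_⟩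
  · simp only [hA1, hB1, hB2]; finiteness
  intro u hu
  have hcu := hu.continuous
  set E := En s p (fun x => ‖fderiv ℝ u x‖ₑ) with hE
  by_cases hEt : E = ⊤
  · refine ⟨0, ?_⟩
    rw [hEt, ENNReal.mul_top (by simp)]
    exact le_top
  obtain ⟨s', hs1, hs2⟩ := exists_between (max_lt hs (neg_lt_neg hN') : max s (-(N:ℝ)) < -1)
  obtain ⟨C', hC', hemb⟩ := En_embed (N := N) hp ((le_max_left _ _).trans_lt hs1)
  have hE1 : En s' 1 (fun x => ‖fderiv ℝ u x‖ₑ) ≠ ⊤ := by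
    have h1 := hemb (fun x => ‖fderiv ℝ u x‖ₑ) (measurable_enorm_fderiv_aux hu).aemeasurable
    intro htop
    rw [htop, ENNReal.top_rpow_of_pos hp0] at h1
    exact absurd (top_le_iff.1 h1) (by finiteness)
  obtain ⟨c, hc⟩ := radial_limit hN ((le_max_right _ _).trans_lt hs1) hs2 hu hE1
  refine ⟨c, ?_⟩
  set S := {x : Euc N | 1 ≤ ‖x‖} with hS
  have hSm : MeasurableSet S := measurableSet_le measurable_const measurable_norm
  have hm := (measurable_enorm_fderiv_aux hu).indicator hSm
  have h1 := hardy_hom (s := s) hp (T := Set.Ioi 1) measurableSet_Ioi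
    (fun t (ht : 1 < t) => by linarith) hm
  have h2 : ∫⁻ x, ENNReal.ofReal (‖x‖ ^ (-s * p - N)) *
      S.indicator (fun x => ‖fderiv ℝ u x‖ₑ) x ^ p ≤ B2 * E := by
    rw [hE]; unfold En
    rw [← lintegral_const_mul' _ _ (by finiteness)]
    apply lintegral_mono
    intro x
    by_cases hx : x ∈ S
    · simp only [Set.indicator_of_mem hx]
      have hx' : 1 ≤ ‖x‖ := hx
      rw [← mul_assoc, hB2, ← ENNReal.ofReal_mul (by positivity)]
      gcongr
      apply rpow_comparable <;> linarith
    · simp only [Set.indicator_of_notMem hx, ENNReal.zero_rpow_of_pos hp0, mul_zero]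
      exact zero_le
  have hSout : En (s + 1) p (S.indicator fun x => ‖u x - c‖ₑ) ≤ B1 * (M ^ p * (B2 * E)) := by
    refine le_trans ?_ (mul_le_mul_right (h1.trans (mul_le_mul_right h2 _)) _)
    rw [← lintegral_const_mul' _ _ (by finiteness)]
    apply lintegral_mono_ae
    filter_upwards [hc] with x hx
    by_cases hxS : x ∈ S
    · simp only [Set.indicator_of_mem hxS]
      have hx' : 1 ≤ ‖x‖ := hxS
      rw [← mul_assoc, hB1, ← ENNReal.ofReal_mul (by positivity)]
      gcongr
      · apply rpow_comparable <;> linarith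
      · refine (hx hx').trans ?_
        refine mul_le_mul_right (le_of_eq ?_) _
        apply setLIntegral_congr_fun measurableSet_Ioi
        intro t ht
        have ht' : 1 < t := ht
        beta_reduce
        rw [Set.indicator_of_mem]
        change 1 ≤ ‖t • x‖
        rw [norm_smul, Real.norm_of_nonneg (by linarith)]
        nlinarith
    · simp only [Set.indicator_of_notMem hxS, ENNReal.zero_rpow_of_pos hp0, mul_zero]
      exact zero_le
  obtain ⟨c', hc'⟩ := hP u hu
  have hloc : ∫⁻ x in closedBall (0 : Euc N) 2, ‖u x - c'‖ₑ ^ p ≤ Cp * (A2 * E) :=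
    hc'.trans (mul_le_mul_right (setLIntegral_ball_le_En (by norm_num) _) _)
  have hV2 : ∫⁻ x in V, ‖u x - c‖ₑ ^ p ≤ A1 * (B1 * (M ^ p * (B2 * E))) := by
    calc ∫⁻ x in V, ‖u x - c‖ₑ ^ p = ∫⁻ x in V, (S.indicator (fun x => ‖u x - c‖ₑ) x) ^ p := by
          apply setLIntegral_congr_fun measurableSet_closedBall
          intro x hx
          have : x ∈ S := (hV1 x hx).1
          simp only [Set.indicator_of_mem this]
      _ ≤ ∫⁻ x in closedBall (0 : Euc N) 2, (S.indicator (fun x => ‖u x - c‖ₑ) x) ^ p := by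
          apply lintegral_mono_set
          intro x hx
          simpa using (hV1 x hx).2
      _ ≤ _ := (setLIntegral_ball_le_En (by norm_num) _).trans (mul_le_mul_right hSout _)
  have hcc := enorm_const_sub_aux hp V hcu hV0 hVt c c'
  have hV3 : ∫⁻ x in V, ‖u x - c'‖ₑ ^ p ≤ Cp * (A2 * E) := by
    refine (lintegral_mono_set ?_).trans hloc
    intro x hx
    simpa using (hV1 x hx).2
  have hcc' : ‖c - c'‖ₑ ^ p ≤ (volume V)⁻¹ * (2 ^ (p - 1) *
      (A1 * (B1 * (M ^ p * (B2 * E))) + Cp * (A2 * E))) := by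
    refine hcc.trans ?_
    gcongr
  have hloc2 : ∫⁻ x in closedBall (0 : Euc N) 2, ‖u x - c‖ₑ ^ p ≤ D * E := by
    calc ∫⁻ x in closedBall (0 : Euc N) 2, ‖u x - c‖ₑ ^ p
        ≤ ∫⁻ x in closedBall (0 : Euc N) 2, 2 ^ (p - 1) * (‖u x - c'‖ₑ ^ p + ‖c - c'‖ₑ ^ p) := by
          gcongr with x
          refine le_trans ?_ (ENNReal.rpow_add_le_mul_rpow_add_rpow _ _ hp)
          gcongr
          have e2 : u x - c = (u x - c') - (c - c') := by ring
          calc ‖u x - c‖ₑ = _ := congrArg _ e2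
            _ ≤ _ := enorm_sub_le
      _ = 2 ^ (p - 1) * ((∫⁻ x in closedBall (0 : Euc N) 2, ‖u x - c'‖ₑ ^ p) +
          volume (closedBall (0 : Euc N) 2) * ‖c - c'‖ₑ ^ p) := by
          rw [lintegral_const_mul' _ _ (by finiteness), lintegral_add_right _ measurable_const,
            setLIntegral_const, mul_comm (volume (closedBall (0 : Euc N) 2))]
      _ ≤ 2 ^ (p - 1) * (Cp * (A2 * E) + volume (closedBall (0 : Euc N) 2) * ((volume V)⁻¹ *
          (2 ^ (p - 1) * (A1 * (B1 * (M ^ p * (B2 * E))) + Cp * (A2 * E))))) := by gcongr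
      _ = _ := by rw [hD]; ring
  calc En (s + 1) p (fun x => ‖u x - c‖ₑ)
      ≤ ∫⁻ x, (ENNReal.ofReal ((1 + ‖x‖) ^ (-(s + 1) * p - N)) *
          ((closedBall (0 : Euc N) 2).indicator (fun x => ‖u x - c‖ₑ) x) ^ p +
          ENNReal.ofReal ((1 + ‖x‖) ^ (-(s + 1) * p - N)) *
            (S.indicator (fun x => ‖u x - c‖ₑ) x) ^ p) := by
        apply lintegral_mono
        intro x
        beta_reduce
        by_cases hx : x ∈ closedBall (0 : Euc N) 2
        · rw [Set.indicator_of_mem hx]; exact le_self_add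
        · refine le_trans ?_ le_add_self
          have hx' : 2 < ‖x‖ := by simpa using hx
          have : x ∈ S := by change 1 ≤ ‖x‖; linarith
          rw [Set.indicator_of_mem this]
    _ = En (s + 1) p ((closedBall (0 : Euc N) 2).indicator (fun x => ‖u x - c‖ₑ)) +
          En (s + 1) p (S.indicator fun x => ‖u x - c‖ₑ) := by
        rw [lintegral_add_left]
        · rfl
        · refine (measurable_wt_aux _).mul (Measurable.pow_const ?_ p)
          exact (Continuous.measurable (by fun_prop)).indicator measurableSet_closedBall
    _ ≤ A1 * (D * E) + B1 * (M ^ p * (B2 * E)) := by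
        refine add_le_add ?_ hSout
        exact (En_indicator_ball_le hp0 (by norm_num) _).trans (mul_le_mul_right hloc2 _)
    _ ≤ E + (A1 * (D * E) + B1 * (M ^ p * (B2 * E))) := le_add_self
    _ = _ := by ring

theorem hardy_smooth {N : ℕ} {p s : ℝ} (hp : 1 ≤ p) (hs : s ≠ -1) (hN : s < -1 → 1 < N) :
    ∃ C : ℝ≥0∞, C ≠ ⊤ ∧ ∀ u : Euc N → ℝ, ContDiff ℝ 1 u → ∃ c : ℝ,
      En (s + 1) p (fun x => ‖u x - c‖ₑ) ≤ C * En s p (fun x => ‖fderiv ℝ u x‖ₑ) := by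
  rcases lt_or_gt_of_ne hs with h | h
  · exact hardy_lt (hN h) hp h
  · exact hardy_gt hp h



theorem morrey_A {N : ℕ} {p : ℝ} (hp : 1 ≤ p) (hNp : (N : ℝ) < p) :
    ∃ C : ℝ≥0∞, C ≠ ⊤ ∧ ∀ H : Euc N → ℝ≥0∞, Measurable H →
      (∫⁻ y in closedBall (0 : Euc N) 1, ‖y‖ₑ * ∫⁻ t in Set.Ioc (0:ℝ) 1, H (t • y)) ^ p ≤
        C * ∫⁻ y, H y ^ p := by
  have hp0 : 0 < p := by linarith
  set M := ∫⁻ t in Set.Ioc (0:ℝ) 1, ENNReal.ofReal (t ^ (-(N : ℝ) / p)) with hM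
  have hMt : M ≠ ⊤ := hardy_M_Ioc (by rw [neg_div, neg_lt_neg_iff, div_lt_one hp0]; exact hNp)
  set B := closedBall (0 : Euc N) 1 with hB
  have hBt : volume B ≠ ⊤ := measure_closedBall_lt_top.ne
  refine ⟨M ^ p * volume B ^ (p - 1), by finiteness, ?_⟩
  intro H hH
  have hjm : Measurable fun z : Euc N × ℝ => H (z.2 • z.1) := hH.comp (by fun_prop)
  have hg : ∀ t ∈ Set.Ioc (0 : ℝ) 1, ∫⁻ y in B, H (t • y) ≤
      (volume B ^ (p - 1) * ∫⁻ y, H y ^ p) ^ (1 / p) * ENNReal.ofReal (t ^ (-(N : ℝ) / p)) := by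
    intro t ht
    have h1 := lintegral_rpow_le_aux (volume.restrict B) hp (f := fun y => H (t • y))
      (hH.comp (by fun_prop)).aemeasurable
    rw [Measure.restrict_apply_univ] at h1
    have h2 : ∫⁻ y in B, H (t • y) ^ p ≤ ENNReal.ofReal (t ^ (-(N : ℝ))) * ∫⁻ y, H y ^ p := by
      refine (setLIntegral_le_lintegral _ _).trans ?_
      rw [lintegral_comp_smul_aux (fun y => H y ^ p) ht.1]
    have h3 := h1.trans (mul_le_mul_right h2 _)
    have h4 := ENNReal.rpow_le_rpow h3 (by positivity : 0 ≤ 1 / p)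
    rw [← ENNReal.rpow_mul, mul_one_div_cancel hp0.ne', ENNReal.rpow_one] at h4
    refine h4.trans (le_of_eq ?_)
    rw [mul_left_comm, mul_comm, ENNReal.mul_rpow_of_nonneg _ _ (by positivity)]
    congr 1
    rw [ENNReal.ofReal_rpow_of_pos (Real.rpow_pos_of_pos ht.1 _), ← Real.rpow_mul ht.1.le]
    congr 2; ring
  calc (∫⁻ y in B, ‖y‖ₑ * ∫⁻ t in Set.Ioc (0:ℝ) 1, H (t • y)) ^ p
      ≤ (∫⁻ y in B, ∫⁻ t in Set.Ioc (0:ℝ) 1, H (t • y)) ^ p := by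
        refine ENNReal.rpow_le_rpow ?_ hp0.le
        apply setLIntegral_mono' measurableSet_closedBall
        intro y hy
        have : ‖y‖ₑ ≤ 1 := by
          rw [← ofReal_norm, ENNReal.ofReal_le_one]; simpa using hy
        calc _ ≤ 1 * _ := mul_le_mul_left this _
          _ = _ := one_mul _
    _ = (∫⁻ t in Set.Ioc (0:ℝ) 1, ∫⁻ y in B, H (t • y)) ^ p := by
        rw [lintegral_lintegral_swap]
        exact hjm.aemeasurable
    _ ≤ (∫⁻ t in Set.Ioc (0:ℝ) 1, (volume B ^ (p - 1) * ∫⁻ y, H y ^ p) ^ (1 / p) *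
          ENNReal.ofReal (t ^ (-(N : ℝ) / p))) ^ p := by
        refine ENNReal.rpow_le_rpow ?_ hp0.le
        exact setLIntegral_mono' measurableSet_Ioc hg
    _ = _ := by
        rw [lintegral_const_mul _ (by fun_prop), ENNReal.mul_rpow_of_nonneg _ _ hp0.le,
          ← ENNReal.rpow_mul, one_div_mul_cancel hp0.ne', ENNReal.rpow_one]
        ring

theorem lintegral_swap_aux {α β : Type*} [MeasurableSpace α] [MeasurableSpace β]
    (μ : Measure α) (ν : Measure β) [SFinite μ] [SFinite ν] (f : α → β → ℝ≥0∞)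
    (hf : Measurable fun z : α × β => f z.1 z.2) :
    ∫⁻ x, ∫⁻ y, f x y ∂ν ∂μ = ∫⁻ y, ∫⁻ x, f x y ∂μ ∂ν :=
  lintegral_lintegral_swap hf.aemeasurable

set_option maxHeartbeats 1000000 in
theorem morrey_B (H : Euc 1 → ℝ≥0∞) (hH : Measurable H) :
      (∫⁻ y in closedBall (0 : Euc 1) 1, ‖y‖ₑ * ∫⁻ t in Set.Ioc (0:ℝ) 1, H (t • y)) ≤
        ∫⁻ y, H y := by
  set B := closedBall (0 : Euc 1) 1 with hB
  set G : Euc 1 → ℝ → ℝ≥0∞ := fun z t =>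
    (Set.Ici ‖z‖).indicator (fun t : ℝ => ENNReal.ofReal (t ^ (-1 : ℝ)) * (‖z‖ₑ * H z)) t with hG
  have hGm : Measurable fun z : Euc 1 × ℝ => G z.1 z.2 := by
    have : (fun z : Euc 1 × ℝ => G z.1 z.2) = {z : Euc 1 × ℝ | ‖z.1‖ ≤ z.2}.indicator
        (fun z : Euc 1 × ℝ => ENNReal.ofReal (z.2 ^ (-1 : ℝ)) * (‖z.1‖ₑ * H z.1)) := by
      ext z
      simp only [hG, Set.indicator, Set.mem_Ici]
      rfl
    rw [this]
    apply Measurable.indicator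
    · exact (by fun_prop : Measurable fun z : Euc 1 × ℝ => ENNReal.ofReal (z.2 ^ (-1 : ℝ))).mul
        ((by fun_prop : Measurable fun z : Euc 1 × ℝ => ‖z.1‖ₑ).mul (hH.comp measurable_fst))
    · exact measurableSet_le (by fun_prop) (by fun_prop)
  have hjm : Measurable fun z : Euc 1 × ℝ => B.indicator (fun y => ‖y‖ₑ * H (z.2 • y)) z.1 := by
    have : (fun z : Euc 1 × ℝ => B.indicator (fun y => ‖y‖ₑ * H (z.2 • y)) z.1) =
        (Prod.fst ⁻¹' B).indicator (fun z : Euc 1 × ℝ => ‖z.1‖ₑ * H (z.2 • z.1)) := by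
      ext z
      simp only [Set.indicator, Set.mem_preimage]
      rfl
    rw [this]
    apply Measurable.indicator
    · exact (by fun_prop : Measurable fun z : Euc 1 × ℝ => ‖z.1‖ₑ).mul (hH.comp (by fun_prop))
    · exact measurable_fst measurableSet_closedBall
  calc (∫⁻ y in B, ‖y‖ₑ * ∫⁻ t in Set.Ioc (0:ℝ) 1, H (t • y))
      = ∫⁻ y, ∫⁻ t in Set.Ioc (0:ℝ) 1, B.indicator (fun y => ‖y‖ₑ * H (t • y)) y := by
        rw [← lintegral_indicator measurableSet_closedBall]
        congr 1; ext y
        by_cases hy : y ∈ B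
        · have hy' : y ∈ closedBall (0 : Euc 1) 1 := hy
          simp only [Set.indicator_of_mem hy, Set.indicator_of_mem hy']
          rw [lintegral_const_mul' _ _ (by finiteness)]
        · have hy' : y ∉ closedBall (0 : Euc 1) 1 := hy
          simp only [Set.indicator_of_notMem hy, Set.indicator_of_notMem hy', lintegral_zero]
    _ = ∫⁻ t in Set.Ioc (0:ℝ) 1, ∫⁻ y, B.indicator (fun y => ‖y‖ₑ * H (t • y)) y := by
        rw [lintegral_lintegral_swap]
        exact hjm.aemeasurable
    _ = ∫⁻ t in Set.Ioc (0:ℝ) 1, ∫⁻ y, ENNReal.ofReal (t ^ (-1 : ℝ)) * G y t := by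
        apply setLIntegral_congr_fun measurableSet_Ioc
        intro t ht
        beta_reduce
        have e := lintegral_comp_smul_aux (fun y => G y t) ht.1
        rw [lintegral_const_mul' _ _ (by finiteness)]
        rw [show (-((1 : ℕ) : ℝ)) = -1 by norm_num] at e
        rw [← e]
        congr 1; ext y
        have ht0 : 0 < t := ht.1
        simp only [hG]
        have hmem : t ∈ Set.Ici ‖t • y‖ ↔ y ∈ B := by
          rw [Set.mem_Ici, norm_smul, Real.norm_of_nonneg ht.1.le, hB, mem_closedBall,
            dist_zero_right]
          constructor <;> intro h <;> nlinarith
        by_cases hy : y ∈ B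
        · rw [Set.indicator_of_mem hy, Set.indicator_of_mem (hmem.2 hy), ← mul_assoc]
          congr 1
          rw [← ofReal_norm, ← ofReal_norm, ← ENNReal.ofReal_mul (by positivity), norm_smul,
            Real.norm_of_nonneg ht.1.le, Real.rpow_neg_one, inv_mul_cancel_left₀ ht.1.ne']
        · rw [Set.indicator_of_notMem hy, Set.indicator_of_notMem (fun h => hy (hmem.1 h))]
    _ = ∫⁻ y, ∫⁻ t in Set.Ioc (0:ℝ) 1, ENNReal.ofReal (t ^ (-1 : ℝ)) * G y t := by
        have hm2 : Measurable fun z : ℝ × Euc 1 => ENNReal.ofReal (z.1 ^ (-1 : ℝ)) * G z.2 z.1 :=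
          Measurable.mul (by fun_prop) (Measurable.comp (g := fun z : Euc 1 × ℝ => G z.1 z.2)
            (f := fun z : ℝ × Euc 1 => (z.2, z.1)) hGm (by fun_prop))
        exact lintegral_swap_aux (volume.restrict (Set.Ioc (0:ℝ) 1)) volume
          (fun (t : ℝ) (y : Euc 1) => ENNReal.ofReal (t ^ (-1 : ℝ)) * G y t) hm2
    _ ≤ ∫⁻ y, H y := by
        apply lintegral_mono
        intro z
        beta_reduce
        by_cases hz : z = 0
        · subst hz
          simp [hG]
        have hz0 : 0 < ‖z‖ := norm_pos_iff.2 hz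
        calc _ ≤ ∫⁻ t in Set.Ici ‖z‖, ENNReal.ofReal (t ^ (-2 : ℝ)) * (‖z‖ₑ * H z) := by
              rw [← lintegral_indicator measurableSet_Ici, ← lintegral_indicator measurableSet_Ioc]
              apply lintegral_mono
              intro t
              by_cases h1 : t ∈ Set.Ioc (0 : ℝ) 1
              · rw [Set.indicator_of_mem h1]
                simp only [hG]
                by_cases h2 : t ∈ Set.Ici ‖z‖
                · simp only [Set.indicator_of_mem h2]
                  rw [← mul_assoc, ← ENNReal.ofReal_mul (Real.rpow_nonneg h1.1.le _),
                    ← Real.rpow_add h1.1]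
                  norm_num
                · simp only [Set.indicator_of_notMem h2, mul_zero]; exact le_rfl
              · rw [Set.indicator_of_notMem h1]; exact zero_le
          _ = ENNReal.ofReal (‖z‖⁻¹) * (‖z‖ₑ * H z) := by
              rw [lintegral_mul_const _ (by fun_prop)]
              congr 1
              rw [setLIntegral_congr Ioi_ae_eq_Ici.symm, ← ofReal_integral_eq_lintegral_ofReal]
              · rw [integral_Ioi_rpow_of_lt (by norm_num) hz0]
                congr 1
                norm_num
                rw [Real.rpow_neg_one]
              · exact integrableOn_Ioi_rpow_of_lt (by norm_num) hz0
              · filter_upwards [ae_restrict_mem measurableSet_Ioi] with t ht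
                exact Real.rpow_nonneg (hz0.trans ht).le _
          _ ≤ H z := by
              rw [← ofReal_norm, ← mul_assoc, ← ENNReal.ofReal_mul (by positivity),
                inv_mul_cancel₀ hz0.ne', ENNReal.ofReal_one, one_mul]

theorem morrey_local {N : ℕ} {p : ℝ} (hp : 1 ≤ p) (h : (N : ℝ) < p ∨ (p = 1 ∧ N = 1)) :
    ∃ C : ℝ≥0∞, C ≠ ⊤ ∧ ∀ f : Euc N → ℝ, ContDiff ℝ 1 f →
      ‖f 0‖ₑ ^ p ≤ C * ((∫⁻ y in closedBall (0 : Euc N) 1, ‖f y‖ₑ ^ p) +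
        ∫⁻ y in closedBall (0 : Euc N) 1, ‖fderiv ℝ f y‖ₑ ^ p) := by
  have hp0 : 0 < p := by linarith
  obtain ⟨C, hC, hJ⟩ : ∃ C : ℝ≥0∞, C ≠ ⊤ ∧ ∀ H : Euc N → ℝ≥0∞, Measurable H →
      (∫⁻ y in closedBall (0 : Euc N) 1, ‖y‖ₑ * ∫⁻ t in Set.Ioc (0:ℝ) 1, H (t • y)) ^ p ≤
        C * ∫⁻ y, H y ^ p := by
    rcases h with h | ⟨rfl, rfl⟩
    · exact morrey_A hp h
    · refine ⟨1, by simp, fun H hH => ?_⟩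
      simp only [ENNReal.rpow_one, one_mul]
      exact morrey_B H hH
  set B := closedBall (0 : Euc N) 1 with hB
  have hBt : volume B ≠ ⊤ := measure_closedBall_lt_top.ne
  have hB0 : volume B ≠ 0 := volume_closedBall_ne_zero one_pos _
  have hBi : (volume B)⁻¹ ≠ ⊤ := ENNReal.inv_ne_top.2 hB0
  refine ⟨(volume B)⁻¹ ^ p * (2 ^ (p - 1) * (volume B ^ (p - 1) + C)), by finiteness, ?_⟩
  intro f hf
  have hcf := hf.continuous
  set H : Euc N → ℝ≥0∞ := B.indicator fun y => ‖fderiv ℝ f y‖ₑ with hH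
  have hHm : Measurable H := (measurable_enorm_fderiv_aux hf).indicator measurableSet_closedBall
  have h1 : ∀ y ∈ B, ‖f 0‖ₑ ≤ ‖f y‖ₑ + ‖y‖ₑ * ∫⁻ t in Set.Ioc (0:ℝ) 1, H (t • y) := by
    intro y hy
    have h2 := enorm_sub_le_lintegral_aux hf 0 y zero_le_one
    simp only [zero_add, one_smul, zero_smul] at h2
    have e : ∫⁻ t in Set.Ioc (0:ℝ) 1, H (t • y) = ∫⁻ t in Set.Ioc (0:ℝ) 1, ‖fderiv ℝ f (t • y)‖ₑ := by
      apply setLIntegral_congr_fun measurableSet_Ioc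
      intro t ht
      simp only [hH]
      rw [Set.indicator_of_mem]
      have hy' : ‖y‖ ≤ 1 := by simpa [hB] using hy
      simp only [hB, mem_closedBall, dist_zero_right, norm_smul, Real.norm_of_nonneg ht.1.le]
      have := ht.2
      nlinarith [norm_nonneg y, ht.1]
    rw [e]
    calc ‖f 0‖ₑ = ‖f y - (f y - f 0)‖ₑ := by congr 1; ring
      _ ≤ ‖f y‖ₑ + ‖f y - f 0‖ₑ := enorm_sub_le
      _ ≤ _ := by gcongr
  have h2 : ‖f 0‖ₑ * volume B ≤ (∫⁻ y in B, ‖f y‖ₑ) +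
      ∫⁻ y in B, ‖y‖ₑ * ∫⁻ t in Set.Ioc (0:ℝ) 1, H (t • y) := by
    rw [← setLIntegral_const, ← lintegral_add_left (by fun_prop)]
    exact setLIntegral_mono' measurableSet_closedBall h1
  have h3 : ‖f 0‖ₑ ≤ (volume B)⁻¹ * ((∫⁻ y in B, ‖f y‖ₑ) +
      ∫⁻ y in B, ‖y‖ₑ * ∫⁻ t in Set.Ioc (0:ℝ) 1, H (t • y)) := by
    rw [← ENNReal.div_eq_inv_mul]
    exact (ENNReal.le_div_iff_mul_le (Or.inl hB0) (Or.inl hBt)).2 h2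
  calc ‖f 0‖ₑ ^ p ≤ _ := ENNReal.rpow_le_rpow h3 hp0.le
    _ ≤ (volume B)⁻¹ ^ p * (2 ^ (p - 1) * ((∫⁻ y in B, ‖f y‖ₑ) ^ p +
      (∫⁻ y in B, ‖y‖ₑ * ∫⁻ t in Set.Ioc (0:ℝ) 1, H (t • y)) ^ p)) := by
        rw [ENNReal.mul_rpow_of_nonneg _ _ hp0.le]
        exact mul_le_mul_right (ENNReal.rpow_add_le_mul_rpow_add_rpow _ _ hp) _
    _ ≤ (volume B)⁻¹ ^ p * (2 ^ (p - 1) * ((volume B ^ (p - 1) + C) * (∫⁻ y in B, ‖f y‖ₑ ^ p) +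
      (volume B ^ (p - 1) + C) * ∫⁻ y in B, ‖fderiv ℝ f y‖ₑ ^ p)) := by
        gcongr
        · have := lintegral_rpow_le_aux (volume.restrict B) hp (f := fun y => ‖f y‖ₑ)
            (by fun_prop)
          rw [Measure.restrict_apply_univ] at this
          exact this.trans (mul_le_mul_left le_self_add _)
        · refine (hJ H hHm).trans ?_
          have e : ∫⁻ y, H y ^ p = ∫⁻ y in B, ‖fderiv ℝ f y‖ₑ ^ p := by
            rw [← lintegral_indicator measurableSet_closedBall]
            congr 1; ext y
            simp only [hH]
            by_cases hy : y ∈ B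
            · have hy' : y ∈ closedBall (0 : Euc N) 1 := hy
              simp only [Set.indicator_of_mem hy, Set.indicator_of_mem hy']
            · have hy' : y ∉ closedBall (0 : Euc N) 1 := hy
              simp only [Set.indicator_of_notMem hy, Set.indicator_of_notMem hy', ENNReal.zero_rpow_of_pos hp0]
          rw [e]
          exact mul_le_mul_left le_add_self _
    _ = _ := by ring



theorem gns_lint {N : ℕ} {p q : ℝ} (hp : 1 ≤ p) (hpN : p < N) (hq : 0 < q)
    (h : p⁻¹ - (N : ℝ)⁻¹ ≤ q⁻¹) : ∃ C : ℝ≥0∞, C ≠ ⊤ ∧ ∀ u : Euc N → ℝ, ContDiff ℝ 1 u →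
      Function.support u ⊆ ball 0 2 →
      (∫⁻ x, ‖u x‖ₑ ^ q) ^ (1 / q) ≤ C * (∫⁻ x, ‖fderiv ℝ u x‖ₑ ^ p) ^ (1 / p) := by
  have hp0 : 0 < p := by linarith
  lift p to NNReal using hp0.le
  lift q to NNReal using hq.le
  refine ⟨eLpNormLESNormFDerivOfLeConst ℝ (volume : Measure (Euc N)) (ball 0 2) p q,
    by finiteness, ?_⟩
  intro u hu hs
  have key := eLpNorm_le_eLpNorm_fderiv_of_le (volume : Measure (Euc N)) hu hs
    (p := p) (q := q) (by exact_mod_cast hp)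
    (by rw [finrank_euclideanSpace_fin]; exact_mod_cast hpN)
    (by rw [finrank_euclideanSpace_fin]; exact h) isBounded_ball
  have hqne : (q : ℝ≥0∞) ≠ 0 := by
    rw [ne_eq, ENNReal.coe_eq_zero]; rintro rfl; simp at hq
  have hpne : (p : ℝ≥0∞) ≠ 0 := by
    rw [ne_eq, ENNReal.coe_eq_zero]; rintro rfl; simp at hp0
  rw [eLpNorm_eq_lintegral_rpow_enorm_toReal hqne ENNReal.coe_ne_top,
    eLpNorm_eq_lintegral_rpow_enorm_toReal hpne ENNReal.coe_ne_top] at key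
  exact key

theorem sobolev_local {N : ℕ} (hN : 2 ≤ N) {p q : ℝ} (hp : 1 ≤ p) (hpN : p ≤ N) (hpq : p ≤ q)
    (h : p⁻¹ - q⁻¹ ≤ (N : ℝ)⁻¹) : ∃ C : ℝ≥0∞, C ≠ ⊤ ∧ ∀ f : Euc N → ℝ, ContDiff ℝ 1 f →
      (∫⁻ y in closedBall (0 : Euc N) 1, ‖f y‖ₑ ^ q) ^ (p / q) ≤
        C * ((∫⁻ y in closedBall (0 : Euc N) 2, ‖f y‖ₑ ^ p) +
        ∫⁻ y in closedBall (0 : Euc N) 2, ‖fderiv ℝ f y‖ₑ ^ p) := by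
  have hp0 : 0 < p := by linarith
  have hq0 : 0 < q := by linarith
  have hN2 : (2 : ℝ) ≤ N := by exact_mod_cast hN
  have hN0 : (0 : ℝ) < N := by linarith
  obtain ⟨r, hr1, hrN, hrp, hrq⟩ : ∃ r : ℝ, 1 ≤ r ∧ r < N ∧ r ≤ p ∧ r⁻¹ - (N : ℝ)⁻¹ ≤ q⁻¹ := by
    rcases hpN.lt_or_eq with hlt | heq
    · exact ⟨p, hp, hlt, le_rfl, by linarith⟩
    · have e : (N : ℝ) * q / (N + q) < N := by
        rw [div_lt_iff₀ (by positivity)]; nlinarith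
      refine ⟨max 1 (N * q / (N + q)), le_max_left _ _, max_lt (by linarith) e,
        max_le hp (by rw [heq]; exact e.le), ?_⟩
      have h1 : (max 1 ((N : ℝ) * q / (N + q)))⁻¹ ≤ ((N : ℝ) * q / (N + q))⁻¹ :=
        inv_anti₀ (by positivity) (le_max_right _ _)
      have h2 : ((N : ℝ) * q / (N + q))⁻¹ = q⁻¹ + (N : ℝ)⁻¹ := by field_simp
      linarith
  have hr0 : 0 < r := by linarith
  obtain ⟨C, hC, hG⟩ := gns_lint hr1 hrN hq0 hrq
  let χ : ContDiffBump (0 : Euc N) := ⟨1, 2, one_pos, one_lt_two⟩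
  have hχ : ContDiff ℝ 1 χ := χ.contDiff
  obtain ⟨A, hA⟩ : ∃ A, ∀ x, ‖fderiv ℝ χ x‖ ≤ A := by
    have h1 : Continuous (fderiv ℝ χ) := hχ.continuous_fderiv (by norm_num)
    exact h1.bounded_above_of_compact_support (χ.hasCompactSupport.fderiv ℝ)
  have hA' : ∀ x, ‖fderiv ℝ χ x‖ₑ ≤ ENNReal.ofReal A := by
    intro x
    rw [← ofReal_norm]
    exact ENNReal.ofReal_le_ofReal (hA x)
  set B := closedBall (0 : Euc N) 2 with hB
  have hBt : volume B ≠ ⊤ := measure_closedBall_lt_top.ne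
  refine ⟨C ^ p * (volume B ^ (p / r - 1) * (2 ^ (p - 1) * (1 + ENNReal.ofReal A ^ p))), ?_, ?_⟩
  · have : 0 ≤ p / r - 1 := by rw [sub_nonneg, one_le_div hr0]; exact hrp
    finiteness
  intro f hf
  have hcf := hf.continuous
  set w : Euc N → ℝ := fun x => χ x * f x with hw
  have hwd : ContDiff ℝ 1 w := hχ.mul hf
  have hws : Function.support w ⊆ ball 0 2 := by
    intro x hx
    have : χ x ≠ 0 := left_ne_zero_of_mul hx
    have h2 : x ∈ Function.support χ := this
    rwa [χ.support_eq] at h2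
  have key := hG w hwd hws
  set G : Euc N → ℝ≥0∞ := fun x => ‖fderiv ℝ f x‖ₑ + ENNReal.ofReal A * ‖f x‖ₑ with hGdef
  have hGm : Measurable G := (measurable_enorm_fderiv_aux hf).add (by fun_prop)
  have h1 : ∫⁻ x, ‖fderiv ℝ w x‖ₑ ^ r ≤ ∫⁻ x in B, G x ^ r := by
    rw [← lintegral_indicator measurableSet_closedBall]
    apply lintegral_mono
    intro x
    beta_reduce
    by_cases hx : x ∈ closedBall (0 : Euc N) 2
    · rw [Set.indicator_of_mem hx]
      refine ENNReal.rpow_le_rpow ?_ hr0.le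
      have e : fderiv ℝ w x = χ x • fderiv ℝ f x + f x • fderiv ℝ χ x :=
        fderiv_fun_mul (hχ.differentiable (by norm_num) x) (hf.differentiable (by norm_num) x)
      rw [e]
      refine (enorm_clm_add_le _ _).trans ?_
      rw [enorm_clm_smul, enorm_clm_smul]
      refine add_le_add ?_ ?_
      · calc _ ≤ 1 * ‖fderiv ℝ f x‖ₑ := by
              refine mul_le_mul_left ?_ _
              rw [← ofReal_norm, Real.norm_of_nonneg χ.nonneg, ENNReal.ofReal_le_one]
              exact χ.le_one
          _ = _ := one_mul _
      · rw [mul_comm]; exact mul_le_mul_left (hA' x) _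
    · rw [Set.indicator_of_notMem hx]
      have : fderiv ℝ w x = 0 := by
        have h3 : x ∉ tsupport w := by
          intro h4
          exact hx ((closure_mono hws).trans closure_ball_subset_closedBall h4)
        exact image_eq_zero_of_notMem_tsupport (fun h5 => h3 (tsupport_fderiv_subset ℝ h5))
      rw [this, enorm_clm_zero, ENNReal.zero_rpow_of_pos hr0]
  have h2 : (∫⁻ x in B, G x ^ r) ^ (p / r) ≤ volume B ^ (p / r - 1) * ∫⁻ x in B, G x ^ p := by
    have := lintegral_rpow_le_aux (volume.restrict B) (p := p / r) ((one_le_div hr0).2 hrp)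
      (f := fun x => G x ^ r) (hGm.pow_const r).aemeasurable
    rw [Measure.restrict_apply_univ] at this
    refine this.trans (le_of_eq ?_)
    congr 2; ext x
    rw [← ENNReal.rpow_mul]; congr 1; field_simp
  have h3 : ∫⁻ x in B, G x ^ p ≤ 2 ^ (p - 1) * (1 + ENNReal.ofReal A ^ p) *
      ((∫⁻ y in B, ‖f y‖ₑ ^ p) + ∫⁻ y in B, ‖fderiv ℝ f y‖ₑ ^ p) := by
    have hm : Measurable fun x => ‖f x‖ₑ ^ p := (Continuous.measurable (by fun_prop)).pow_const p
    rw [← lintegral_add_left hm, ← lintegral_const_mul' _ _ (by finiteness)]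
    apply lintegral_mono
    intro x
    beta_reduce
    refine (ENNReal.rpow_add_le_mul_rpow_add_rpow _ _ hp).trans ?_
    rw [mul_assoc, ENNReal.mul_rpow_of_nonneg _ _ hp0.le]
    refine mul_le_mul_right ?_ _
    calc ‖fderiv ℝ f x‖ₑ ^ p + ENNReal.ofReal A ^ p * ‖f x‖ₑ ^ p
        ≤ (‖fderiv ℝ f x‖ₑ ^ p + ENNReal.ofReal A ^ p * ‖f x‖ₑ ^ p) + (‖f x‖ₑ ^ p +
          ENNReal.ofReal A ^ p * ‖fderiv ℝ f x‖ₑ ^ p) := le_self_add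
      _ = _ := by ring
  have h4 : ∫⁻ y in closedBall (0 : Euc N) 1, ‖f y‖ₑ ^ q ≤ ∫⁻ x, ‖w x‖ₑ ^ q := by
    rw [← lintegral_indicator measurableSet_closedBall]
    apply lintegral_mono
    intro x
    beta_reduce
    by_cases hx : x ∈ closedBall (0 : Euc N) 1
    · rw [Set.indicator_of_mem hx]
      simp only [hw]
      rw [χ.one_of_mem_closedBall hx, one_mul]
    · rw [Set.indicator_of_notMem hx]; exact zero_le
  calc _ ≤ (∫⁻ x, ‖w x‖ₑ ^ q) ^ (p / q) := ENNReal.rpow_le_rpow h4 (by positivity)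
    _ = ((∫⁻ x, ‖w x‖ₑ ^ q) ^ (1 / q)) ^ p := by
        rw [← ENNReal.rpow_mul]; congr 1; field_simp
    _ ≤ (C * (∫⁻ x in B, G x ^ r) ^ (1 / r)) ^ p := by
        refine ENNReal.rpow_le_rpow (key.trans ?_) hp0.le
        exact mul_le_mul_right (ENNReal.rpow_le_rpow h1 (by positivity)) _
    _ = C ^ p * (∫⁻ x in B, G x ^ r) ^ (p / r) := by
        rw [ENNReal.mul_rpow_of_nonneg _ _ hp0.le, ← ENNReal.rpow_mul]; congr 2; field_simp
    _ ≤ C ^ p * (volume B ^ (p / r - 1) * (2 ^ (p - 1) * (1 + ENNReal.ofReal A ^ p) *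
      ((∫⁻ y in B, ‖f y‖ₑ ^ p) + ∫⁻ y in B, ‖fderiv ℝ f y‖ₑ ^ p))) :=
        mul_le_mul_right (h2.trans (mul_le_mul_right h3 _)) _
    _ = _ := by ring



theorem measurable_cover_ind {N : ℕ} (c a : ℝ) {F : Euc N → ℝ≥0∞} (hF : Measurable F) :
    Measurable fun z : Euc N × Euc N => (closedBall z.1 (c * (1 + ‖z.1‖))).indicator
      (fun x => ENNReal.ofReal ((1 + ‖z.1‖) ^ a) * F x) z.2 := by
  have e : (fun z : Euc N × Euc N => (closedBall z.1 (c * (1 + ‖z.1‖))).indicator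
      (fun x => ENNReal.ofReal ((1 + ‖z.1‖) ^ a) * F x) z.2) =
      {z : Euc N × Euc N | dist z.2 z.1 ≤ c * (1 + ‖z.1‖)}.indicator
        (fun z => ENNReal.ofReal ((1 + ‖z.1‖) ^ a) * F z.2) := by
    ext z
    simp only [Set.indicator, mem_closedBall, Set.mem_ofPred_eq]
  rw [e]
  apply Measurable.indicator
  · exact Measurable.mul (by fun_prop) (hF.comp measurable_snd)
  · exact measurableSet_le (by fun_prop) (by fun_prop)

theorem cover_fubini {N : ℕ} (c a : ℝ) {F : Euc N → ℝ≥0∞} (hF : Measurable F) :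
    ∫⁻ y, ENNReal.ofReal ((1 + ‖y‖) ^ a) * ∫⁻ x in closedBall y (c * (1 + ‖y‖)), F x =
    ∫⁻ x, (∫⁻ y in {y : Euc N | dist x y ≤ c * (1 + ‖y‖)}, ENNReal.ofReal ((1 + ‖y‖) ^ a)) *
      F x := by
  have hm := measurable_cover_ind c a hF
  have e1 : ∀ y : Euc N, ENNReal.ofReal ((1 + ‖y‖) ^ a) *
      ∫⁻ x in closedBall y (c * (1 + ‖y‖)), F x = ∫⁻ x, (closedBall y (c * (1 + ‖y‖))).indicator
      (fun x => ENNReal.ofReal ((1 + ‖y‖) ^ a) * F x) x := by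
    intro y
    rw [lintegral_indicator measurableSet_closedBall, lintegral_const_mul' _ _ (by finiteness)]
  simp_rw [e1]
  rw [lintegral_swap_aux volume volume (fun (y : Euc N) (x : Euc N) =>
    (closedBall y (c * (1 + ‖y‖))).indicator
      (fun x => ENNReal.ofReal ((1 + ‖y‖) ^ a) * F x) x) hm]
  congr 1; ext x
  have hS : MeasurableSet {y : Euc N | dist x y ≤ c * (1 + ‖y‖)} :=
    measurableSet_le (by fun_prop) (by fun_prop)
  rw [← lintegral_mul_const _ (by fun_prop), ← lintegral_indicator hS]
  congr 1

theorem volume_cB_scaled {N : ℕ} (x : Euc N) {r : ℝ} (hr : 0 ≤ r) :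
    volume (closedBall x r) = ENNReal.ofReal (r ^ (N : ℝ)) * volume (closedBall (0 : Euc N) 1) := by
  rw [Measure.addHaar_closedBall' volume x hr, finrank_euclideanSpace_fin, Real.rpow_natCast]

theorem cover_lower {N : ℕ} (a : ℝ) : ∃ C : ℝ≥0∞, C ≠ ⊤ ∧ ∀ F : Euc N → ℝ≥0∞, Measurable F →
    ∫⁻ x, ENNReal.ofReal ((1 + ‖x‖) ^ a) * F x ≤
    C * ∫⁻ y, ENNReal.ofReal ((1 + ‖y‖) ^ (a - N)) *
      ∫⁻ x in closedBall y (1 / 8 * (1 + ‖y‖)), F x := by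
  set v := volume (closedBall (0 : Euc N) 1) with hv
  have hv0 : v ≠ 0 := volume_closedBall_ne_zero one_pos _
  have hvt : v ≠ ⊤ := measure_closedBall_lt_top.ne
  have hvi : v⁻¹ ≠ ⊤ := ENNReal.inv_ne_top.2 hv0
  refine ⟨ENNReal.ofReal (16 ^ (N : ℝ) * 2 ^ |a - N|) * v⁻¹, by finiteness, ?_⟩
  intro F hF
  rw [cover_fubini _ _ hF, ← lintegral_const_mul' _ _ (by finiteness)]
  apply lintegral_mono
  intro x
  beta_reduce
  rw [← mul_assoc]
  refine mul_le_mul_left ?_ _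
  have hx0 : 0 < 1 + ‖x‖ := by positivity
  have hsub : closedBall x ((1 + ‖x‖) / 16) ⊆ {y : Euc N | dist x y ≤ 1 / 8 * (1 + ‖y‖)} := by
    intro y hy
    rw [mem_closedBall, dist_comm] at hy
    have h2 : ‖x‖ ≤ ‖y‖ + dist x y := by
      rw [dist_eq_norm]; calc ‖x‖ = ‖y + (x - y)‖ := by congr 1; abel
        _ ≤ _ := norm_add_le _ _
    change dist x y ≤ _
    nlinarith [norm_nonneg x]
  have h1 : ENNReal.ofReal (((1 + ‖x‖) / 16) ^ (N : ℝ)) * v *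
      ENNReal.ofReal ((2 ^ |a - N|)⁻¹ * (1 + ‖x‖) ^ (a - N)) ≤
      ∫⁻ y in {y : Euc N | dist x y ≤ 1 / 8 * (1 + ‖y‖)}, ENNReal.ofReal ((1 + ‖y‖) ^ (a - N)) := by
    refine le_trans ?_ (lintegral_mono_set hsub)
    rw [← volume_cB_scaled x (by positivity), mul_comm, ← setLIntegral_const]
    apply setLIntegral_mono' measurableSet_closedBall
    intro y hy
    apply ENNReal.ofReal_le_ofReal
    rw [inv_mul_le_iff₀ (by positivity)]
    rw [mem_closedBall, dist_comm] at hy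
    have h2 : ‖x‖ ≤ ‖y‖ + dist x y := by
      rw [dist_eq_norm]; calc ‖x‖ = ‖y + (x - y)‖ := by congr 1; abel
        _ ≤ _ := norm_add_le _ _
    have h3 : ‖y‖ ≤ ‖x‖ + dist x y := by
      rw [dist_eq_norm, ← norm_neg (x - y)]
      calc ‖y‖ = ‖x + -(x - y)‖ := by congr 1; abel
        _ ≤ _ := norm_add_le _ _
    have hy0 := norm_nonneg y
    exact rpow_comparable hx0 (by positivity) one_le_two (by linarith) (by linarith) _
  refine le_trans (le_of_eq ?_) (mul_le_mul_right h1 _)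
  have : ENNReal.ofReal (16 ^ (N : ℝ) * 2 ^ |a - N|) * v⁻¹ *
      (ENNReal.ofReal (((1 + ‖x‖) / 16) ^ (N : ℝ)) * v *
      ENNReal.ofReal ((2 ^ |a - N|)⁻¹ * (1 + ‖x‖) ^ (a - N))) = (v⁻¹ * v) *
      (ENNReal.ofReal (16 ^ (N : ℝ) * 2 ^ |a - N|) * ENNReal.ofReal (((1 + ‖x‖) / 16) ^ (N : ℝ)) *
      ENNReal.ofReal ((2 ^ |a - N|)⁻¹ * (1 + ‖x‖) ^ (a - N))) := by ring
  rw [this, ENNReal.inv_mul_cancel hv0 hvt, one_mul, ← ENNReal.ofReal_mul (by positivity),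
    ← ENNReal.ofReal_mul (by positivity)]
  congr 1
  rw [Real.div_rpow hx0.le (by norm_num)]
  have e : (1 + ‖x‖) ^ a = (1 + ‖x‖) ^ (N : ℝ) * (1 + ‖x‖) ^ (a - N) := by
    rw [← Real.rpow_add hx0]; congr 1; ring
  rw [e]
  have h2 : (2 : ℝ) ^ |a - N| ≠ 0 := by positivity
  have h3 : (16 : ℝ) ^ (N : ℝ) ≠ 0 := by positivity
  field_simp

theorem cover_upper {N : ℕ} : ∃ C : ℝ≥0∞, C ≠ ⊤ ∧ ∀ F : Euc N → ℝ≥0∞, Measurable F →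
    ∫⁻ y, ENNReal.ofReal ((1 + ‖y‖) ^ (-(N : ℝ))) *
      ∫⁻ x in closedBall y (1 / 4 * (1 + ‖y‖)), F x ≤ C * ∫⁻ x, F x := by
  set v := volume (closedBall (0 : Euc N) 1) with hv
  have hvt : v ≠ ⊤ := measure_closedBall_lt_top.ne
  refine ⟨ENNReal.ofReal (2 ^ |-(N : ℝ)|) * v, by finiteness, ?_⟩
  intro F hF
  rw [cover_fubini _ _ hF, ← lintegral_const_mul' _ _ (by finiteness)]
  apply lintegral_mono
  intro x
  beta_reduce
  refine mul_le_mul_left ?_ _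
  have hx0 : 0 < 1 + ‖x‖ := by positivity
  have hsub : {y : Euc N | dist x y ≤ 1 / 4 * (1 + ‖y‖)} ⊆ closedBall x (1 + ‖x‖) := by
    intro y hy
    have hy : dist x y ≤ 1 / 4 * (1 + ‖y‖) := hy
    have h3 : ‖y‖ ≤ ‖x‖ + dist x y := by
      rw [dist_eq_norm, ← norm_neg (x - y)]
      calc ‖y‖ = ‖x + -(x - y)‖ := by congr 1; abel
        _ ≤ _ := norm_add_le _ _
    rw [mem_closedBall, dist_comm]
    nlinarith [norm_nonneg x]
  have hS : MeasurableSet {y : Euc N | dist x y ≤ 1 / 4 * (1 + ‖y‖)} :=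
    measurableSet_le (by fun_prop) (by fun_prop)
  calc ∫⁻ y in {y : Euc N | dist x y ≤ 1 / 4 * (1 + ‖y‖)}, ENNReal.ofReal ((1 + ‖y‖) ^ (-(N : ℝ)))
      ≤ ∫⁻ y in {y : Euc N | dist x y ≤ 1 / 4 * (1 + ‖y‖)},
        ENNReal.ofReal (2 ^ |-(N : ℝ)| * (1 + ‖x‖) ^ (-(N : ℝ))) := by
        apply setLIntegral_mono' hS
        intro y hy
        have hy : dist x y ≤ 1 / 4 * (1 + ‖y‖) := hy
        have h2 : ‖x‖ ≤ ‖y‖ + dist x y := by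
          rw [dist_eq_norm]; calc ‖x‖ = ‖y + (x - y)‖ := by congr 1; abel
            _ ≤ _ := norm_add_le _ _
        have h3 : ‖y‖ ≤ ‖x‖ + dist x y := by
          rw [dist_eq_norm, ← norm_neg (x - y)]
          calc ‖y‖ = ‖x + -(x - y)‖ := by congr 1; abel
            _ ≤ _ := norm_add_le _ _
        have hy0 := norm_nonneg y
        have hx0 := norm_nonneg x
        apply ENNReal.ofReal_le_ofReal
        exact rpow_comparable (by positivity) (by positivity) one_le_two (by linarith)
          (by linarith) _
    _ ≤ ∫⁻ y in closedBall x (1 + ‖x‖),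
        ENNReal.ofReal (2 ^ |-(N : ℝ)| * (1 + ‖x‖) ^ (-(N : ℝ))) := lintegral_mono_set hsub
    _ = _ := by
        rw [setLIntegral_const, volume_cB_scaled x hx0.le, ← mul_assoc,
          ← ENNReal.ofReal_mul (by positivity), mul_assoc (2 ^ |-(N : ℝ)|), ← Real.rpow_add hx0]
        simp [hv]

/-- energy density -/
def Tden (N : ℕ) (s p : ℝ) (w : Euc N → ℝ) (x : Euc N) : ℝ≥0∞ :=
  ENNReal.ofReal ((1 + ‖x‖) ^ (-(s + 1) * p - N)) * ‖w x‖ₑ ^ p +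
    ENNReal.ofReal ((1 + ‖x‖) ^ (-s * p - N)) * ‖fderiv ℝ w x‖ₑ ^ p

theorem measurable_Tden {N : ℕ} (s p : ℝ) {w : Euc N → ℝ} (hw : ContDiff ℝ 1 w) :
    Measurable (Tden N s p w) := by
  have h1 := measurable_enorm_fderiv_aux hw
  have h2 : Measurable fun x => ‖w x‖ₑ := by have := hw.continuous; fun_prop
  exact ((measurable_wt_aux _).mul (h2.pow_const p)).add
    ((measurable_wt_aux _).mul (h1.pow_const p))

theorem lintegral_Tden {N : ℕ} (s p : ℝ) {w : Euc N → ℝ} (hw : ContDiff ℝ 1 w) :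
    ∫⁻ x, Tden N s p w x = En (s + 1) p (fun x => ‖w x‖ₑ) + En s p (fun x => ‖fderiv ℝ w x‖ₑ) := by
  have h2 : Measurable fun x => ‖w x‖ₑ := by have := hw.continuous; fun_prop
  unfold Tden
  have h3 : Measurable fun x : Euc N =>
    ENNReal.ofReal ((1 + ‖x‖) ^ (-(s + 1) * p - N)) * ‖w x‖ₑ ^ p :=
    (measurable_wt_aux _).mul (h2.pow_const p)
  rw [lintegral_add_left h3]
  rfl

theorem scaled_energy {N : ℕ} (s : ℝ) {p : ℝ} (hp : 1 ≤ p) : ∃ K : ℝ≥0∞, K ≠ ⊤ ∧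
    ∀ w : Euc N → ℝ, ContDiff ℝ 1 w → ∀ y : Euc N,
    (∫⁻ z in closedBall (0 : Euc N) 2, ‖w (y + ((1 + ‖y‖) / 8) • z)‖ₑ ^ p) +
    (∫⁻ z in closedBall (0 : Euc N) 2,
      ‖fderiv ℝ (fun z => w (y + ((1 + ‖y‖) / 8) • z)) z‖ₑ ^ p) ≤
    K * ENNReal.ofReal ((1 + ‖y‖) ^ ((s + 1) * p)) *
      ∫⁻ x in closedBall y (1 / 4 * (1 + ‖y‖)), Tden N s p w x := by
  have hp0 : 0 < p := by linarith
  set K0 : ℝ := max (2 ^ |-(s + 1) * p - N|) (2 ^ |-s * p - N|) with hK0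
  have hK0p : 0 < K0 := lt_max_of_lt_left (by positivity)
  refine ⟨ENNReal.ofReal (K0 * 8 ^ (N : ℝ)), by finiteness, ?_⟩
  intro w hw y
  set ρ := (1 + ‖y‖) / 8 with hρ
  have hy0 := norm_nonneg y
  have hy1 : 0 < 1 + ‖y‖ := by positivity
  have hρ0 : 0 < ρ := by positivity
  have hfm : Measurable fun z : Euc N => ‖w (y + ρ • z)‖ₑ ^ p := by
    have := hw.continuous
    exact (Continuous.measurable (by fun_prop)).pow_const p
  rw [← lintegral_add_left hfm]
  have hpt : ∀ z ∈ closedBall (0 : Euc N) 2, ‖w (y + ρ • z)‖ₑ ^ p +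
      ‖fderiv ℝ (fun z => w (y + ρ • z)) z‖ₑ ^ p ≤
      ENNReal.ofReal (K0 * (1 + ‖y‖) ^ ((s + 1) * p + N)) * (closedBall y (1 / 4 * (1 + ‖y‖))).indicator
        (Tden N s p w) (y + ρ • z) := by
    intro z hz
    rw [mem_closedBall, dist_zero_right] at hz
    set x := y + ρ • z with hx
    have hd : ‖ρ • z‖ ≤ 1 / 4 * (1 + ‖y‖) := by
      rw [norm_smul, Real.norm_of_nonneg hρ0.le]; nlinarith
    have hxm : x ∈ closedBall y (1 / 4 * (1 + ‖y‖)) := by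
      rw [mem_closedBall, dist_eq_norm, hx, add_sub_cancel_left]; exact hd
    rw [Set.indicator_of_mem hxm]
    have hx0 := norm_nonneg x
    have h2 : ‖x‖ ≤ ‖y‖ + ‖ρ • z‖ := norm_add_le _ _
    have h3 : ‖y‖ ≤ ‖x‖ + ‖ρ • z‖ := by
      calc ‖y‖ = ‖x - ρ • z‖ := by rw [hx, add_sub_cancel_right]
        _ ≤ _ := norm_sub_le _ _
    have hx1 : 0 < 1 + ‖x‖ := by positivity
    have c1 := rpow_comparable hy1 hx1 one_le_two (by linarith) (by linarith)
      (-(s + 1) * p - N)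
    have c2 := rpow_comparable hy1 hx1 one_le_two (by linarith) (by linarith)
      (-s * p - N)
    have hfd : ‖fderiv ℝ (fun z => w (y + ρ • z)) z‖ₑ = ENNReal.ofReal ρ * ‖fderiv ℝ w x‖ₑ := by
      have e : HasFDerivAt (fun z : Euc N => w (y + ρ • z))
          ((fderiv ℝ w x).comp (ρ • ContinuousLinearMap.id ℝ (Euc N))) z := by
        have h5 : HasFDerivAt w (fderiv ℝ w x) (y + ρ • z) :=
          (hw.differentiable (by norm_num) _).hasFDerivAt
        have h6 : HasFDerivAt (fun z : Euc N => y + ρ • z) (ρ • ContinuousLinearMap.id ℝ (Euc N)) z :=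
          ((hasFDerivAt_id z).const_smul ρ).const_add y
        exact h5.comp z h6
      rw [e.fderiv]
      have : (fderiv ℝ w x).comp (ρ • ContinuousLinearMap.id ℝ (Euc N)) = ρ • fderiv ℝ w x := by
        ext v; simp
      rw [this, enorm_clm_smul, ← ofReal_norm, Real.norm_of_nonneg hρ0.le]
    rw [hfd, ENNReal.mul_rpow_of_nonneg _ _ hp0.le, ENNReal.ofReal_rpow_of_pos hρ0, Tden, mul_add]
    rw [← mul_assoc, ← mul_assoc, ← ENNReal.ofReal_mul (by positivity),
      ← ENNReal.ofReal_mul (by positivity)]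
    refine add_le_add ?_ ?_
    · conv_lhs => rw [← one_mul (‖w x‖ₑ ^ p)]
      refine mul_le_mul_left ?_ _
      rw [ENNReal.one_le_ofReal]
      have e1 : (1:ℝ) = (1 + ‖y‖) ^ ((s + 1) * p + N) * (1 + ‖y‖) ^ (-(s + 1) * p - N) := by
        rw [← Real.rpow_add hy1, show (s + 1) * p + N + (-(s + 1) * p - N) = 0 by ring,
          Real.rpow_zero]
      calc (1:ℝ) = (1 + ‖y‖) ^ ((s + 1) * p + N) * (1 + ‖y‖) ^ (-(s + 1) * p - N) := e1
        _ ≤ (1 + ‖y‖) ^ ((s + 1) * p + N) * (K0 * (1 + ‖x‖) ^ (-(s + 1) * p - N)) := by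
            refine mul_le_mul_of_nonneg_left (c1.trans ?_) (by positivity)
            exact mul_le_mul_of_nonneg_right (le_max_left _ _) (by positivity)
        _ = _ := by ring
    · refine mul_le_mul_left ?_ _
      apply ENNReal.ofReal_le_ofReal
      have e1 : (1 + ‖y‖) ^ p = (1 + ‖y‖) ^ ((s + 1) * p + N) * (1 + ‖y‖) ^ (-s * p - N) := by
        rw [← Real.rpow_add hy1]; congr 1; ring
      calc ρ ^ p ≤ (1 + ‖y‖) ^ p := Real.rpow_le_rpow hρ0.le (by rw [hρ]; linarith) hp0.le
        _ = _ := e1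
        _ ≤ (1 + ‖y‖) ^ ((s + 1) * p + N) * (K0 * (1 + ‖x‖) ^ (-s * p - N)) := by
            refine mul_le_mul_of_nonneg_left (c2.trans ?_) (by positivity)
            exact mul_le_mul_of_nonneg_right (le_max_right _ _) (by positivity)
        _ = _ := by ring
  calc _ ≤ ∫⁻ z in closedBall (0 : Euc N) 2, ENNReal.ofReal (K0 * (1 + ‖y‖) ^ ((s + 1) * p + N)) *
        (closedBall y (1 / 4 * (1 + ‖y‖))).indicator (Tden N s p w) (y + ρ • z) :=
        setLIntegral_mono' measurableSet_closedBall hpt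
    _ ≤ ∫⁻ z, ENNReal.ofReal (K0 * (1 + ‖y‖) ^ ((s + 1) * p + N)) *
        (closedBall y (1 / 4 * (1 + ‖y‖))).indicator (Tden N s p w) (y + ρ • z) :=
        setLIntegral_le_lintegral _ _
    _ = ENNReal.ofReal (K0 * (1 + ‖y‖) ^ ((s + 1) * p + N)) * (ENNReal.ofReal (ρ ^ (-(N : ℝ))) *
        ∫⁻ x in closedBall y (1 / 4 * (1 + ‖y‖)), Tden N s p w x) := by
        rw [lintegral_const_mul' _ _ (by finiteness),
          lintegral_comp_affine_aux ((closedBall y (1 / 4 * (1 + ‖y‖))).indicator (Tden N s p w)) y hρ0,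
          lintegral_indicator measurableSet_closedBall]
    _ = _ := by
        rw [← mul_assoc, ← ENNReal.ofReal_mul (by positivity), ← ENNReal.ofReal_mul (by positivity)]
        congr 2
        rw [hρ, Real.div_rpow hy1.le (by norm_num), Real.rpow_add hy1, Real.rpow_neg hy1.le,
          Real.rpow_neg (by norm_num : (0:ℝ) ≤ 8)]
        field_simp

theorem sobolev_pointwise {N : ℕ} (s : ℝ) {p : ℝ} (hp : 1 ≤ p)
    (h : (N : ℝ) < p ∨ (p = 1 ∧ N = 1)) : ∃ K : ℝ≥0∞, K ≠ ⊤ ∧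
    ∀ w : Euc N → ℝ, ContDiff ℝ 1 w → ∀ y : Euc N,
      ENNReal.ofReal ((1 + ‖y‖) ^ (-(s + 1) * p)) * ‖w y‖ₑ ^ p ≤
        K * ∫⁻ x in closedBall y (1 / 4 * (1 + ‖y‖)), Tden N s p w x := by
  obtain ⟨C, hC, hM⟩ := morrey_local hp h
  obtain ⟨K, hK, hS⟩ := scaled_energy (N := N) s hp
  refine ⟨C * K, by finiteness, ?_⟩
  intro w hw y
  have hy1 : 0 < 1 + ‖y‖ := by positivity
  have h1 := hM (fun z => w (y + ((1 + ‖y‖) / 8) • z)) (by fun_prop)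
  rw [smul_zero, add_zero] at h1
  have h2 : ‖w y‖ₑ ^ p ≤ C * (K * ENNReal.ofReal ((1 + ‖y‖) ^ ((s + 1) * p)) *
      ∫⁻ x in closedBall y (1 / 4 * (1 + ‖y‖)), Tden N s p w x) := by
    refine h1.trans (mul_le_mul_right ((add_le_add ?_ ?_).trans (hS w hw y)) _) <;>
    exact lintegral_mono_set (closedBall_subset_closedBall one_le_two)
  refine (mul_le_mul_right h2 _).trans (le_of_eq ?_)
  rw [show ∀ a b c d e : ℝ≥0∞, a * (b * (c * d * e)) = (a * d) * (b * c * e) by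
    intros; ring, ← ENNReal.ofReal_mul (by positivity), ← Real.rpow_add hy1]
  rw [show -(s + 1) * p + (s + 1) * p = 0 by ring, Real.rpow_zero, ENNReal.ofReal_one, one_mul]

theorem sobolev_global_sub {N : ℕ} (hN : 2 ≤ N) (s : ℝ) {p q : ℝ} (hp : 1 ≤ p) (hpN : p ≤ N)
    (hpq : p ≤ q) (h : p⁻¹ - q⁻¹ ≤ (N : ℝ)⁻¹) : ∃ K : ℝ≥0∞, K ≠ ⊤ ∧
    ∀ w : Euc N → ℝ, ContDiff ℝ 1 w → ∫⁻ x, Tden N s p w x ≠ ⊤ →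
      En (s + 1) q (fun x => ‖w x‖ₑ) ≤ K * (∫⁻ x, Tden N s p w x) ^ (q / p) := by
  have hp0 : 0 < p := by linarith
  have hq0 : 0 < q := by linarith
  obtain ⟨C, hC, hM⟩ := sobolev_local hN hp hpN hpq h
  obtain ⟨K, hK, hS⟩ := scaled_energy (N := N) s hp
  obtain ⟨C1, hC1, hlow⟩ := cover_lower (N := N) (-(s + 1) * q - N)
  obtain ⟨C2, hC2, hup⟩ := cover_upper (N := N)
  refine ⟨C1 * (C2 * (ENNReal.ofReal (8 ^ (-(N : ℝ))) * (C * K) ^ (q / p))), by finiteness, ?_⟩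
  intro w hw hEf
  set E := ∫⁻ x, Tden N s p w x with hE
  set e : Euc N → ℝ≥0∞ := fun y => ∫⁻ x in closedBall y (1 / 4 * (1 + ‖y‖)), Tden N s p w x with he
  have hwm : Measurable fun x => ‖w x‖ₑ ^ q := by
    have := hw.continuous
    exact (Continuous.measurable (by fun_prop)).pow_const q
  have hqp : 1 ≤ q / p := (one_le_div hp0).2 hpq
  have hpt : ∀ y : Euc N, ENNReal.ofReal ((1 + ‖y‖) ^ (-(s + 1) * q - N - N)) *
      (∫⁻ x in closedBall y (1 / 8 * (1 + ‖y‖)), ‖w x‖ₑ ^ q) ≤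
      (ENNReal.ofReal (8 ^ (-(N : ℝ))) * (C * K) ^ (q / p) * E ^ (q / p - 1)) *
        (ENNReal.ofReal ((1 + ‖y‖) ^ (-(N : ℝ))) * e y) := by
    intro y
    have hy1 : 0 < 1 + ‖y‖ := by positivity
    have h1 := hM (fun z => w (y + ((1 + ‖y‖) / 8) • z)) (by fun_prop)
    have h2 := h1.trans (mul_le_mul_right (hS w hw y) _)
    have h3 := ENNReal.rpow_le_rpow h2 (by positivity : 0 ≤ q / p)
    rw [← ENNReal.rpow_mul, show p / q * (q / p) = 1 by field_simp, ENNReal.rpow_one] at h3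
    have h4 : ∫⁻ z in closedBall (0 : Euc N) 1, ‖w (y + ((1 + ‖y‖) / 8) • z)‖ₑ ^ q =
        ENNReal.ofReal (((1 + ‖y‖) / 8) ^ (-(N : ℝ))) *
          ∫⁻ x in closedBall y (1 / 8 * (1 + ‖y‖)), ‖w x‖ₑ ^ q := by
      rw [← lintegral_indicator (measurableSet_closedBall (x := y)),
        ← lintegral_comp_affine_aux _ y (by positivity : 0 < (1 + ‖y‖) / 8),
        ← lintegral_indicator measurableSet_closedBall]
      congr 1; ext z
      have hiff : y + ((1 + ‖y‖) / 8) • z ∈ closedBall y (1 / 8 * (1 + ‖y‖)) ↔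
          z ∈ closedBall (0 : Euc N) 1 := by
        rw [mem_closedBall, mem_closedBall, dist_eq_norm, add_sub_cancel_left, dist_zero_right,
          norm_smul, Real.norm_of_nonneg (by positivity)]
        constructor <;> intro h <;> nlinarith
      by_cases hz : z ∈ closedBall (0 : Euc N) 1
      · rw [Set.indicator_of_mem hz, Set.indicator_of_mem (hiff.2 hz)]
      · rw [Set.indicator_of_notMem hz, Set.indicator_of_notMem (fun h => hz (hiff.1 h))]
    rw [h4] at h3
    have h5 : e y ^ (q / p) ≤ E ^ (q / p - 1) * e y := by
      have hle : e y ≤ E := setLIntegral_le_lintegral _ _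
      calc e y ^ (q / p) = e y ^ ((q / p - 1) + 1) := by congr 1; ring
        _ = e y ^ (q / p - 1) * e y := by
            rw [ENNReal.rpow_add_of_nonneg _ _ (by linarith) zero_le_one, ENNReal.rpow_one]
        _ ≤ _ := mul_le_mul_left (ENNReal.rpow_le_rpow hle (by linarith)) _
    have h6 : (C * (K * ENNReal.ofReal ((1 + ‖y‖) ^ ((s + 1) * p)) * e y)) ^ (q / p) ≤
        (C * K) ^ (q / p) * ENNReal.ofReal ((1 + ‖y‖) ^ ((s + 1) * q)) * (E ^ (q / p - 1) * e y) := by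
      rw [show C * (K * ENNReal.ofReal ((1 + ‖y‖) ^ ((s + 1) * p)) * e y) =
        C * K * ENNReal.ofReal ((1 + ‖y‖) ^ ((s + 1) * p)) * e y by ring,
        ENNReal.mul_rpow_of_nonneg _ _ (by positivity), ENNReal.mul_rpow_of_nonneg _ _ (by positivity),
        ENNReal.ofReal_rpow_of_pos (by positivity), ← Real.rpow_mul hy1.le,
        show (s + 1) * p * (q / p) = (s + 1) * q by field_simp]
      exact mul_le_mul_right h5 _
    have h7 := mul_le_mul_right (h3.trans h6)
      (ENNReal.ofReal (8 ^ (-(N : ℝ)) * (1 + ‖y‖) ^ (-(s + 1) * q - N)))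
    rw [← mul_assoc, ← ENNReal.ofReal_mul (by positivity)] at h7
    have e1 : 8 ^ (-(N : ℝ)) * (1 + ‖y‖) ^ (-(s + 1) * q - N) * ((1 + ‖y‖) / 8) ^ (-(N : ℝ)) =
        (1 + ‖y‖) ^ (-(s + 1) * q - N - N) := by
      rw [sub_eq_add_neg (-(s + 1) * q - N), Real.rpow_add hy1, Real.div_rpow hy1.le (by norm_num)]
      field_simp
    rw [e1] at h7
    refine h7.trans (le_of_eq ?_)
    rw [ENNReal.ofReal_mul (by positivity), show ∀ a b c d f g: ℝ≥0∞, a * b * (c * d * (f * g)) =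
      a * c * f * ((b * d) * g) by intros; ring, ← ENNReal.ofReal_mul (by positivity),
      ← Real.rpow_add hy1]
    congr 4
    ring_nf
  calc En (s + 1) q (fun x => ‖w x‖ₑ) ≤ _ := hlow (fun x => ‖w x‖ₑ ^ q) hwm
    _ ≤ C1 * ∫⁻ y, (ENNReal.ofReal (8 ^ (-(N : ℝ))) * (C * K) ^ (q / p) * E ^ (q / p - 1)) *
        (ENNReal.ofReal ((1 + ‖y‖) ^ (-(N : ℝ))) * e y) :=
        mul_le_mul_right (lintegral_mono hpt) _
    _ ≤ C1 * ((ENNReal.ofReal (8 ^ (-(N : ℝ))) * (C * K) ^ (q / p) * E ^ (q / p - 1)) *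
        (C2 * E)) := by
        refine mul_le_mul_right ?_ _
        have hEt : E ^ (q / p - 1) ≠ ⊤ := ENNReal.rpow_ne_top_of_nonneg (by linarith) hEf
        rw [lintegral_const_mul' _ _ (by finiteness)]
        exact mul_le_mul_right (hup _ (measurable_Tden s p hw)) _
    _ = _ := by
        have : E ^ (q / p) = E ^ (q / p - 1) * E := by
          rw [← ENNReal.rpow_one E, ← ENNReal.rpow_mul, ← ENNReal.rpow_mul,
            ← ENNReal.rpow_add_of_nonneg _ _ (by linarith) zero_le_one]
          congr 1; ring
        rw [this]; ring



/-- convolution of `u` with a kernel `ψ` -/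
def cv {N : ℕ} (ψ u : Euc N → ℝ) (x : Euc N) : ℝ := ∫ t, u t * ψ (x - t)

/-- test functions -/
def TF {N : ℕ} (φ : Euc N → ℝ) : Prop := ContDiff ℝ (⊤ : ℕ∞) φ ∧ HasCompactSupport φ

/-- partial derivative -/
def pd {N : ℕ} (i : Fin N) (φ : Euc N → ℝ) (x : Euc N) : ℝ :=
  fderiv ℝ φ x (EuclideanSpace.single i 1)

theorem pderivList_cons {N : ℕ} (i : Fin N) (l : List (Fin N)) (φ : Euc N → ℝ) :
    pderivList (i :: l) φ = pderivList l (pd i φ) := rfl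

theorem pd_smooth {N : ℕ} (i : Fin N) {φ : Euc N → ℝ} (h : ContDiff ℝ (⊤ : ℕ∞) φ) :
    ContDiff ℝ (⊤ : ℕ∞) (pd i φ) := by
  have h1 : ContDiff ℝ (⊤ : ℕ∞) (fderiv ℝ φ) := h.fderiv_right (m := (⊤ : ℕ∞)) (by simp)
  exact h1.clm_apply contDiff_const

theorem TF.pd {N : ℕ} (i : Fin N) {φ : Euc N → ℝ} (h : TF φ) : TF (pd i φ) :=
  ⟨pd_smooth i h.1, h.2.fderiv_apply ℝ _⟩

theorem pderivList_smooth {N : ℕ} (l : List (Fin N)) {φ : Euc N → ℝ}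
    (h : ContDiff ℝ (⊤ : ℕ∞) φ) : ContDiff ℝ (⊤ : ℕ∞) (pderivList l φ) := by
  induction l generalizing φ with
  | nil => exact h
  | cons i l ih => exact ih (pd_smooth i h)

theorem TF.pderivList {N : ℕ} (l : List (Fin N)) {φ : Euc N → ℝ} (h : TF φ) :
    TF (pderivList l φ) := by
  induction l generalizing φ with
  | nil => exact h
  | cons i l ih => exact ih (h.pd i)

theorem cv_eq_conv {N : ℕ} (ψ u : Euc N → ℝ) :
    cv ψ u = convolution u ψ (ContinuousLinearMap.mul ℝ ℝ) volume := rfl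

theorem cv_smooth {N : ℕ} {ψ u : Euc N → ℝ} (hψ : TF ψ) (hu : LocallyIntegrable u volume) :
    ContDiff ℝ (⊤ : ℕ∞) (cv ψ u) := by
  rw [cv_eq_conv]
  exact hψ.2.contDiff_convolution_right _ hu hψ.1

theorem pd_cv {N : ℕ} (i : Fin N) {ψ u : Euc N → ℝ} (hψ : TF ψ)
    (hu : LocallyIntegrable u volume) : pd i (cv ψ u) = cv (pd i ψ) u := by
  have h1 : ContDiff ℝ 1 ψ := hψ.1.of_le (by exact_mod_cast le_top)
  ext x
  have := hψ.2.hasFDerivAt_convolution_right (ContinuousLinearMap.mul ℝ ℝ) hu h1 x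
  rw [pd, cv_eq_conv, this.fderiv, convolution_precompR_apply _ hu (hψ.2.fderiv ℝ)
    (h1.continuous_fderiv one_ne_zero)]
  rfl

theorem pderivList_cv {N : ℕ} (l : List (Fin N)) {ψ u : Euc N → ℝ} (hψ : TF ψ)
    (hu : LocallyIntegrable u volume) : pderivList l (cv ψ u) = cv (pderivList l ψ) u := by
  induction l generalizing ψ with
  | nil => rfl
  | cons i l ih => rw [pderivList_cons, pd_cv i hψ hu, ih (hψ.pd i), pderivList_cons]

theorem TF.comp_sub {N : ℕ} {ψ : Euc N → ℝ} (h : TF ψ) (x : Euc N) : TF fun t => ψ (x - t) :=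
  ⟨h.1.comp (by fun_prop), h.2.comp_homeomorph (Homeomorph.subLeft x)⟩

theorem pd_comp_sub {N : ℕ} (i : Fin N) {ψ : Euc N → ℝ} (h : ContDiff ℝ (⊤ : ℕ∞) ψ) (x : Euc N)
    (c : ℝ) : pd i (fun t => c * ψ (x - t)) = fun t => (-c) * pd i ψ (x - t) := by
  ext t
  have h1 : HasFDerivAt ψ (fderiv ℝ ψ (x - t)) (x - t) :=
    (h.differentiable (by simp) _).hasFDerivAt
  have h2 : HasFDerivAt (fun t : Euc N => x - t) (-ContinuousLinearMap.id ℝ (Euc N)) t :=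
    (hasFDerivAt_id t).const_sub x
  have h3 := (h1.comp t h2).const_mul c
  have h4 : fderiv ℝ (fun t => c * ψ (x - t)) t = _ := h3.fderiv
  simp only [pd]
  rw [h4]
  simp

theorem pderivList_comp_sub {N : ℕ} (l : List (Fin N)) {ψ : Euc N → ℝ}
    (h : ContDiff ℝ (⊤ : ℕ∞) ψ) (x : Euc N) (c : ℝ) :
    pderivList l (fun t => c * ψ (x - t)) =
      fun t => (-1) ^ l.length * c * pderivList l ψ (x - t) := by
  induction l generalizing ψ c with
  | nil => ext t; simp [pderivList]
  | cons i l ih =>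
    rw [pderivList_cons, pd_comp_sub i h, ih (pd_smooth i h)]
    ext t
    rw [pderivList_cons, List.length_cons, pow_succ]
    ring

theorem pderivList_cv_weak {N : ℕ} {l : List (Fin N)} {ψ u g : Euc N → ℝ} (hψ : TF ψ)
    (h : IsWeakDerivList l u g) : pderivList l (cv ψ u) = cv ψ g := by
  rw [pderivList_cv l hψ h.1]
  ext x
  have h1 := h.2.2 (fun t => 1 * ψ (x - t)) (by simpa using (hψ.comp_sub x).1)
    (by simpa using (hψ.comp_sub x).2)
  rw [pderivList_comp_sub l hψ.1] at h1
  have h2 : ∫ t, u t * ((-1) ^ l.length * 1 * pderivList l ψ (x - t)) =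
      (-1) ^ l.length * cv (pderivList l ψ) u x := by
    rw [cv, ← integral_const_mul]; congr 1; ext t; ring
  rw [h2] at h1
  have h3 := mul_left_cancel₀ (pow_ne_zero _ (by norm_num)) h1
  rw [h3]; simp [cv]

/-- mollifier bump -/
def bmp (N n : ℕ) : ContDiffBump (0 : Euc N) where
  rIn := 1 / (2 * ((n : ℝ) + 1))
  rOut := 1 / ((n : ℝ) + 1)
  rIn_pos := by positivity
  rIn_lt_rOut := by
    apply one_div_lt_one_div_of_lt <;> [positivity; nlinarith [(Nat.cast_nonneg n : (0:ℝ) ≤ n)]]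

/-- mollifier kernel -/
def et (N n : ℕ) : Euc N → ℝ := (bmp N n).normed volume

/-- mollification -/
def mol {N : ℕ} (n : ℕ) (u : Euc N → ℝ) : Euc N → ℝ := cv (et N n) u

theorem et_TF (N n : ℕ) : TF (et N n) := ⟨(bmp N n).contDiff_normed, (bmp N n).hasCompactSupport_normed⟩

theorem et_nonneg {N n : ℕ} (x : Euc N) : 0 ≤ et N n x := (bmp N n).nonneg_normed x

theorem et_integral (N n : ℕ) : ∫ x, et N n x = 1 := (bmp N n).integral_normed

theorem et_lintegral (N n : ℕ) : ∫⁻ x, ENNReal.ofReal (et N n x) = 1 := by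
  have hi : Integrable (et N n) volume := (bmp N n).integrable_normed
  rw [← ofReal_integral_eq_lintegral_ofReal hi
    (Eventually.of_forall et_nonneg), et_integral, ENNReal.ofReal_one]

theorem et_zero {N n : ℕ} {x : Euc N} (hx : 1 < ‖x‖) : et N n x = 0 := by
  by_contra h
  have h1 : x ∈ Function.support (et N n) := h
  rw [et, (bmp N n).support_normed_eq, mem_ball, dist_zero_right] at h1
  have h2 : (bmp N n).rOut ≤ 1 := by
    change 1 / ((n : ℝ) + 1) ≤ 1
    rw [div_le_one (by positivity)]; linarith [(Nat.cast_nonneg n : (0:ℝ) ≤ n)]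
  linarith

theorem mol_eq {N : ℕ} (n : ℕ) (u : Euc N → ℝ) (x : Euc N) :
    mol n u x = ∫ t, et N n t * u (x - t) := by
  rw [mol, cv, ← integral_sub_left_eq_self _ volume x]
  congr 1; ext t
  rw [show x - (x - t) = t by abel, mul_comm]

theorem mol_tendsto {N : ℕ} {u : Euc N → ℝ} (hu : LocallyIntegrable u volume) :
    ∀ᵐ x, Tendsto (fun n => mol n u x) atTop (𝓝 (u x)) := by
  have := ContDiffBump.ae_convolution_tendsto_right_of_locallyIntegrable (μ := volume) (g := u)
    (φ := fun n => bmp N n) (l := atTop) (K := 2) ?_ ?_ hu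
  · filter_upwards [this] with x hx
    convert hx using 2 with n
    rw [mol_eq]; rfl
  · exact tendsto_one_div_add_atTop_nhds_zero_nat
  · refine Eventually.of_forall fun n => ?_
    change 1 / ((n : ℝ) + 1) ≤ 2 * (1 / (2 * ((n : ℝ) + 1)))
    apply le_of_eq; field_simp

theorem mol_congr {N : ℕ} (n : ℕ) {u v : Euc N → ℝ} (h : u =ᵐ[volume] v) : mol n u = mol n v := by
  ext x
  apply integral_congr_ae
  filter_upwards [h] with t ht
  rw [ht]

theorem mol_smooth {N : ℕ} (n : ℕ) {u : Euc N → ℝ} (hu : LocallyIntegrable u volume) :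
    ContDiff ℝ (⊤ : ℕ∞) (mol n u) := cv_smooth (et_TF N n) hu

theorem mol_C1 {N : ℕ} (n : ℕ) {u : Euc N → ℝ} (hu : LocallyIntegrable u volume) :
    ContDiff ℝ 1 (mol n u) := (mol_smooth n hu).of_le (by exact_mod_cast le_top)

theorem mol_pderivList {N : ℕ} (n : ℕ) {l : List (Fin N)} {u g : Euc N → ℝ}
    (h : IsWeakDerivList l u g) : pderivList l (mol n u) = mol n g :=
  pderivList_cv_weak (et_TF N n) h

theorem mol_sub_const {N : ℕ} (n : ℕ) {u : Euc N → ℝ} (hu : LocallyIntegrable u volume) (c : ℝ) :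
    mol n (fun x => u x - c) = fun x => mol n u x - c := by
  ext x
  have hi : Integrable (fun t => u t * et N n (x - t)) := by
    have := (et_TF N n).2.convolutionExists_right (ContinuousLinearMap.mul ℝ ℝ) hu
      (et_TF N n).1.continuous x
    exact this
  have hi2 : Integrable (fun t : Euc N => et N n (x - t)) :=
    (bmp N n).integrable_normed.comp_sub_left x
  simp only [mol, cv, sub_mul]
  rw [integral_sub hi (hi2.const_mul c), integral_const_mul,
    integral_sub_left_eq_self (fun t => et N n t), et_integral, mul_one]

theorem mol_enorm_rpow_le {N : ℕ} (n : ℕ) {p : ℝ} (hp : 1 ≤ p) {g : Euc N → ℝ}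
    (hg : Measurable g) (x : Euc N) :
    ‖mol n g x‖ₑ ^ p ≤ ∫⁻ t, ENNReal.ofReal (et N n t) * ‖g (x - t)‖ₑ ^ p := by
  have hp0 : 0 < p := by linarith
  have hem : Measurable fun t => ENNReal.ofReal (et N n t) := by
    have := (et_TF N n).1.continuous; fun_prop
  have hgm : Measurable fun t => ‖g (x - t)‖ₑ := by fun_prop
  have h1 : ‖mol n g x‖ₑ ≤ ∫⁻ t, ENNReal.ofReal (et N n t) * ‖g (x - t)‖ₑ := by
    rw [mol_eq]
    refine (enorm_integral_le_lintegral_enorm _).trans (le_of_eq ?_)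
    congr 1; ext t
    rw [enorm_mul]; congr 1
    rw [← ofReal_norm, Real.norm_of_nonneg (et_nonneg t)]
  set μ := (volume : Measure (Euc N)).withDensity fun t => ENNReal.ofReal (et N n t) with hμ
  have hμ1 : μ Set.univ = 1 := by
    rw [hμ, withDensity_apply _ MeasurableSet.univ, Measure.restrict_univ, et_lintegral]
  have h2 := lintegral_rpow_le_aux μ hp (f := fun t => ‖g (x - t)‖ₑ) hgm.aemeasurable
  rw [hμ1, ENNReal.one_rpow, one_mul, hμ, lintegral_withDensity_eq_lintegral_mul _ hem hgm,
    lintegral_withDensity_eq_lintegral_mul _ hem (hgm.pow_const p)] at h2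
  exact (ENNReal.rpow_le_rpow h1 hp0.le).trans h2

theorem mol_energy {N : ℕ} (n : ℕ) {p : ℝ} (hp : 1 ≤ p) (r : ℝ) {g : Euc N → ℝ}
    (hg : AEStronglyMeasurable g volume) {A A' : Set (Euc N)} (hA : MeasurableSet A)
    (hA' : MeasurableSet A') (hAA : ∀ x ∈ A, ∀ t : Euc N, ‖t‖ ≤ 1 → x - t ∈ A') :
    ∫⁻ x in A, ENNReal.ofReal ((1 + ‖x‖) ^ r) * ‖mol n g x‖ₑ ^ p ≤
      ENNReal.ofReal (2 ^ |r|) * ∫⁻ x in A', ENNReal.ofReal ((1 + ‖x‖) ^ r) * ‖g x‖ₑ ^ p := by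
  -- reduce to measurable `g`
  wlog hgm : Measurable g generalizing g
  · have h := this (g := hg.mk g) hg.stronglyMeasurable_mk.aestronglyMeasurable
      hg.stronglyMeasurable_mk.measurable
    rw [mol_congr n hg.ae_eq_mk]
    refine h.trans (le_of_eq ?_)
    congr 1
    apply lintegral_congr_ae
    filter_upwards [ae_restrict_of_ae hg.ae_eq_mk] with x hx
    rw [hx]
  have hp0 : 0 < p := by linarith
  have hem : Measurable fun t => ENNReal.ofReal (et N n t) := by
    have := (et_TF N n).1.continuous; fun_prop
  set G : Euc N → ℝ≥0∞ := A'.indicator fun x => ENNReal.ofReal ((1 + ‖x‖) ^ r) * ‖g x‖ₑ ^ p with hG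
  have hGm : Measurable G :=
    ((measurable_wt_aux r).mul ((Measurable.enorm hgm).pow_const p)).indicator hA'
  have hpt : ∀ x ∈ A, ENNReal.ofReal ((1 + ‖x‖) ^ r) * ‖mol n g x‖ₑ ^ p ≤
      ∫⁻ t, ENNReal.ofReal (2 ^ |r|) * (ENNReal.ofReal (et N n t) * G (x - t)) := by
    intro x hx
    refine (mul_le_mul_right (mol_enorm_rpow_le n hp hgm x) _).trans ?_
    rw [← lintegral_const_mul' _ _ (by finiteness)]
    apply lintegral_mono
    intro t
    beta_reduce
    by_cases ht : ‖t‖ ≤ 1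
    · simp only [hG]
      rw [Set.indicator_of_mem (hAA x hx t ht)]
      rw [show ∀ a b c : ℝ≥0∞, a * (b * c) = a * (b * c) by intros; ring,
        show ∀ a b c d : ℝ≥0∞, a * (b * (c * d)) = (a * c) * (b * d) by intros; ring]
      refine mul_le_mul_left ?_ _
      rw [← ENNReal.ofReal_mul (by positivity)]
      apply ENNReal.ofReal_le_ofReal
      have h1 : ‖x - t‖ ≤ ‖x‖ + ‖t‖ := norm_sub_le _ _
      have h2 : ‖x‖ ≤ ‖x - t‖ + ‖t‖ := by
        calc ‖x‖ = ‖(x - t) + t‖ := by rw [sub_add_cancel]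
          _ ≤ _ := norm_add_le _ _
      have := norm_nonneg x
      have := norm_nonneg (x - t)
      exact rpow_comparable (by positivity) (by positivity) one_le_two (by linarith)
        (by linarith) _
    · rw [et_zero (not_le.1 ht)]; simp
  calc _ ≤ ∫⁻ x in A, ∫⁻ t, ENNReal.ofReal (2 ^ |r|) * (ENNReal.ofReal (et N n t) * G (x - t)) :=
        setLIntegral_mono' hA hpt
    _ ≤ ∫⁻ x, ∫⁻ t, ENNReal.ofReal (2 ^ |r|) * (ENNReal.ofReal (et N n t) * G (x - t)) :=
        setLIntegral_le_lintegral _ _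
    _ = ∫⁻ t, ∫⁻ x, ENNReal.ofReal (2 ^ |r|) * (ENNReal.ofReal (et N n t) * G (x - t)) := by
        refine lintegral_swap_aux volume volume (fun (x : Euc N) (t : Euc N) =>
          ENNReal.ofReal (2 ^ |r|) * (ENNReal.ofReal (et N n t) * G (x - t))) ?_
        refine Measurable.const_mul ?_ _
        exact (Measurable.comp (g := fun t => ENNReal.ofReal (et N n t)) hem measurable_snd).mul
          (Measurable.comp (g := G) hGm (by fun_prop))
    _ = ∫⁻ t, (ENNReal.ofReal (2 ^ |r|) * ∫⁻ x, G x) * ENNReal.ofReal (et N n t) := by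
        congr 1; ext t
        rw [lintegral_const_mul' _ _ (by finiteness), lintegral_const_mul' _ _ (by finiteness),
          lintegral_sub_right_eq_self G t]
        ring
    _ = _ := by
        rw [lintegral_const_mul _ hem, et_lintegral, mul_one, hG, lintegral_indicator hA']



theorem sobolev_global {N : ℕ} (hN : 1 ≤ N) (s : ℝ) {p q : ℝ} (hp : 1 ≤ p) (hpq : p ≤ q)
    (h : p⁻¹ - q⁻¹ ≤ (N : ℝ)⁻¹) :
    ∃ K : ℝ≥0∞, K ≠ ⊤ ∧ ∀ w : Euc N → ℝ, ContDiff ℝ 1 w → ∫⁻ x, Tden N s p w x ≠ ⊤ →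
      En (s + 1) q (fun x => ‖w x‖ₑ) ≤ K * (∫⁻ x, Tden N s p w x) ^ (q / p) := by
  have hp0 : 0 < p := by linarith
  have hq0 : 0 < q := by linarith
  by_cases hc : (N : ℝ) < p ∨ (p = 1 ∧ N = 1)
  · obtain ⟨K, hK, hb⟩ := sobolev_pointwise (N := N) s hp hc
    refine ⟨K ^ (q / p - 1), by
      apply ENNReal.rpow_ne_top_of_nonneg _ hK
      rw [sub_nonneg, le_div_iff₀ hp0]; linarith, ?_⟩
    intro w hw hE
    set E := ∫⁻ x, Tden N s p w x with hEdef
    have hqp : 0 ≤ q / p - 1 := by rw [sub_nonneg, le_div_iff₀ hp0]; linarith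
    have hpt : ∀ y : Euc N, ENNReal.ofReal ((1 + ‖y‖) ^ (-(s + 1) * q - N)) * ‖w y‖ₑ ^ q ≤
        (K * E) ^ (q / p - 1) * (ENNReal.ofReal ((1 + ‖y‖) ^ (-(s + 1) * p - N)) * ‖w y‖ₑ ^ p) := by
      intro y
      have hy : 0 < 1 + ‖y‖ := by positivity
      have h1 := (hb w hw y).trans (mul_le_mul_right (setLIntegral_le_lintegral _ _) K)
      have h2 := ENNReal.rpow_le_rpow h1 hqp
      refine le_trans (le_of_eq ?_) (mul_le_mul_left h2 _)
      rw [ENNReal.mul_rpow_of_nonneg _ _ hqp, ← ENNReal.rpow_mul,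
        ENNReal.ofReal_rpow_of_pos (by positivity), ← Real.rpow_mul hy.le]
      rw [mul_mul_mul_comm, ← ENNReal.ofReal_mul (by positivity), ← Real.rpow_add hy,
        ← ENNReal.rpow_add_of_nonneg _ _ (by
          rw [mul_sub, mul_div_cancel₀ _ hp0.ne']; linarith) hp0.le]
      congr 3 <;> (try congr 1) <;> field_simp <;> ring
    calc En (s + 1) q (fun x => ‖w x‖ₑ) ≤ ∫⁻ y, (K * E) ^ (q / p - 1) *
          (ENNReal.ofReal ((1 + ‖y‖) ^ (-(s + 1) * p - N)) * ‖w y‖ₑ ^ p) := by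
            apply lintegral_mono; intro y; exact hpt y
      _ = (K * E) ^ (q / p - 1) * En (s + 1) p (fun x => ‖w x‖ₑ) := by
            rw [lintegral_const_mul' _ _ (by
              apply ENNReal.rpow_ne_top_of_nonneg hqp; finiteness)]; rfl
      _ ≤ (K * E) ^ (q / p - 1) * E := by
            gcongr
            rw [hEdef, lintegral_Tden s p hw]; exact le_self_add
      _ = K ^ (q / p - 1) * E ^ (q / p) := by
            rw [ENNReal.mul_rpow_of_nonneg _ _ hqp, mul_assoc]
            congr 1
            conv_lhs => rw [← ENNReal.rpow_one E, ← ENNReal.rpow_mul]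
            rw [← ENNReal.rpow_add_of_nonneg _ _ (by simpa using hqp) zero_le_one]
            congr 1; ring
  · push Not at hc
    have hN2 : 2 ≤ N := by
      by_contra hlt
      have h1 : N = 1 := by omega
      have h2 := hc.1
      rw [h1] at h2
      exact hc.2 (le_antisymm (by simpa using h2) hp) h1
    exact sobolev_global_sub hN2 s hp hc.1 hpq h

theorem enorm_fderiv_le {N : ℕ} (w : Euc N → ℝ) (x : Euc N) :
    ‖fderiv ℝ w x‖ₑ ≤ ∑ i, ‖pd i w x‖ₑ := by
  have h : ‖fderiv ℝ w x‖ ≤ ∑ i, ‖pd i w x‖ := by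
    apply ContinuousLinearMap.opNorm_le_bound _ (by positivity)
    intro v
    have hv : v = ∑ i, v i • EuclideanSpace.single i (1:ℝ) := by
      ext j; simp [Pi.single_apply]
    conv_lhs => rw [hv, map_sum]
    refine (norm_sum_le _ _).trans ?_
    rw [Finset.sum_mul]
    apply Finset.sum_le_sum
    intro i _
    rw [map_smul, norm_smul, mul_comm]
    exact mul_le_mul_of_nonneg_left (PiLp.norm_apply_le v i) (norm_nonneg _)
  have h2 : ‖fderiv ℝ w x‖ₑ ≤ ENNReal.ofReal (∑ i, ‖pd i w x‖) := by
    rw [← ofReal_norm]; exact ENNReal.ofReal_le_ofReal h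
  refine h2.trans (le_of_eq ?_)
  rw [ENNReal.ofReal_sum_of_nonneg (fun i _ => norm_nonneg _)]
  exact Finset.sum_congr rfl fun i _ => ofReal_norm _

theorem enorm_fderiv_rpow_le {N : ℕ} {p : ℝ} (hp : 1 ≤ p) (w : Euc N → ℝ) (x : Euc N) :
    ‖fderiv ℝ w x‖ₑ ^ p ≤ (N : ℝ≥0∞) ^ (p - 1) * ∑ i, ‖pd i w x‖ₑ ^ p := by
  refine (ENNReal.rpow_le_rpow (enorm_fderiv_le w x) (by linarith)).trans ?_
  have := ENNReal.rpow_sum_le_const_mul_sum_rpow Finset.univ (fun i => ‖pd i w x‖ₑ) hp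
  simpa using this

/-- weak energy density -/
def TW {N : ℕ} (s p : ℝ) (f : Euc N → ℝ) (h : Fin N → Euc N → ℝ) (x : Euc N) : ℝ≥0∞ :=
  ENNReal.ofReal ((1 + ‖x‖) ^ (-(s + 1) * p - N)) * ‖f x‖ₑ ^ p +
    ∑ i, ENNReal.ofReal ((1 + ‖x‖) ^ (-s * p - N)) * ‖h i x‖ₑ ^ p

theorem aemeas_wt {N : ℕ} (r p : ℝ) {g : Euc N → ℝ} (hg : AEStronglyMeasurable g volume) :
    AEMeasurable (fun x : Euc N => ENNReal.ofReal ((1 + ‖x‖) ^ r) * ‖g x‖ₑ ^ p) volume := by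
  have h1 : Measurable fun x : Euc N => ENNReal.ofReal ((1 + ‖x‖) ^ r) := measurable_wt_aux r
  exact h1.aemeasurable.mul (hg.enorm.pow_const p)

theorem lintegral_TW {N : ℕ} (s p : ℝ) {f : Euc N → ℝ} {h : Fin N → Euc N → ℝ}
    (hf : AEStronglyMeasurable f volume) (hh : ∀ i, AEStronglyMeasurable (h i) volume) :
    ∫⁻ x, TW s p f h x = En (s + 1) p (fun x => ‖f x‖ₑ) + ∑ i, En s p (fun x => ‖h i x‖ₑ) := by
  unfold TW En
  rw [lintegral_add_left' (aemeas_wt _ _ hf), lintegral_finsetSum' _ (fun i _ => aemeas_wt _ _ (hh i))]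

theorem pd_mol {N : ℕ} (n : ℕ) {i : Fin N} {f g : Euc N → ℝ} (h : IsWeakPartialDeriv i f g) :
    pd i (mol n f) = mol n g := mol_pderivList n h

theorem lintegral_fderiv_mol_le {N : ℕ} (n : ℕ) (r : ℝ) {p : ℝ} (hp : 1 ≤ p) {f : Euc N → ℝ}
    {h : Fin N → Euc N → ℝ} (hw : ∀ i, IsWeakPartialDeriv i f (h i)) {A A' : Set (Euc N)}
    (hA : MeasurableSet A) (hA' : MeasurableSet A')
    (hAA : ∀ x ∈ A, ∀ t : Euc N, ‖t‖ ≤ 1 → x - t ∈ A') :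
    ∫⁻ x in A, ENNReal.ofReal ((1 + ‖x‖) ^ r) * ‖fderiv ℝ (mol n f) x‖ₑ ^ p ≤
      (N : ℝ≥0∞) ^ (p - 1) * ENNReal.ofReal (2 ^ |r|) *
        ∑ i, ∫⁻ x in A', ENNReal.ofReal ((1 + ‖x‖) ^ r) * ‖h i x‖ₑ ^ p := by
  have hc : (N : ℝ≥0∞) ^ (p - 1) ≠ ⊤ :=
    ENNReal.rpow_ne_top_of_nonneg (by linarith) (by finiteness)
  calc ∫⁻ x in A, ENNReal.ofReal ((1 + ‖x‖) ^ r) * ‖fderiv ℝ (mol n f) x‖ₑ ^ p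
      ≤ ∫⁻ x in A, (N : ℝ≥0∞) ^ (p - 1) *
          ∑ i, ENNReal.ofReal ((1 + ‖x‖) ^ r) * ‖mol n (h i) x‖ₑ ^ p := by
        apply lintegral_mono; intro x; beta_reduce
        rw [← Finset.mul_sum, mul_left_comm]
        gcongr
        have := enorm_fderiv_rpow_le hp (mol n f) x
        simpa only [pd_mol n (hw _)] using this
    _ = (N : ℝ≥0∞) ^ (p - 1) *
          ∑ i, ∫⁻ x in A, ENNReal.ofReal ((1 + ‖x‖) ^ r) * ‖mol n (h i) x‖ₑ ^ p := by
        rw [lintegral_const_mul' _ _ hc, lintegral_finsetSum' _ (fun i _ => ?_)]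
        exact (aemeas_wt _ _ (mol_smooth n (hw i).2.1).continuous.aestronglyMeasurable).restrict
    _ ≤ _ := by
        rw [mul_assoc]
        refine mul_le_mul_right ?_ _
        rw [Finset.mul_sum]
        refine Finset.sum_le_sum fun i _ => ?_
        exact mol_energy n hp r (hw i).2.1.aestronglyMeasurable hA hA' hAA

theorem Tden_mol_le {N : ℕ} (s : ℝ) {p : ℝ} (hp : 1 ≤ p) :
    ∃ C : ℝ≥0∞, C ≠ ⊤ ∧ ∀ (n : ℕ) (f : Euc N → ℝ)
      (h : Fin N → Euc N → ℝ), LocallyIntegrable f volume → (∀ i, IsWeakPartialDeriv i f (h i)) →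
      ∀ A A' : Set (Euc N), MeasurableSet A → MeasurableSet A' →
      (∀ x ∈ A, ∀ t : Euc N, ‖t‖ ≤ 1 → x - t ∈ A') →
      ∫⁻ x in A, Tden N s p (mol n f) x ≤ C * ∫⁻ x in A', TW s p f h x := by
  have hc : (N : ℝ≥0∞) ^ (p - 1) ≠ ⊤ :=
    ENNReal.rpow_ne_top_of_nonneg (by linarith) (by finiteness)
  refine ⟨ENNReal.ofReal (2 ^ |-(s + 1) * p - N|) +
    (N : ℝ≥0∞) ^ (p - 1) * ENNReal.ofReal (2 ^ |-s * p - N|), by finiteness, ?_⟩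
  intro n f h hf hw A A' hA hA' hAA
  have e1 : ∫⁻ x in A, Tden N s p (mol n f) x =
      (∫⁻ x in A, ENNReal.ofReal ((1 + ‖x‖) ^ (-(s + 1) * p - N)) * ‖mol n f x‖ₑ ^ p) +
      ∫⁻ x in A, ENNReal.ofReal ((1 + ‖x‖) ^ (-s * p - N)) * ‖fderiv ℝ (mol n f) x‖ₑ ^ p := by
    unfold Tden
    rw [lintegral_add_left']
    exact (aemeas_wt _ _ (mol_smooth n hf).continuous.aestronglyMeasurable).restrict
  have e2 : ∫⁻ x in A', TW s p f h x =
      (∫⁻ x in A', ENNReal.ofReal ((1 + ‖x‖) ^ (-(s + 1) * p - N)) * ‖f x‖ₑ ^ p) +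
      ∑ i, ∫⁻ x in A', ENNReal.ofReal ((1 + ‖x‖) ^ (-s * p - N)) * ‖h i x‖ₑ ^ p := by
    unfold TW
    rw [lintegral_add_left' (aemeas_wt _ _ hf.aestronglyMeasurable).restrict,
      lintegral_finsetSum' _ (fun i _ =>
        (aemeas_wt _ _ (hw i).2.1.aestronglyMeasurable).restrict)]
  rw [e1, e2, add_mul]
  refine add_le_add ?_ ?_
  · exact (mol_energy n hp _ hf.aestronglyMeasurable hA hA' hAA).trans
      (mul_le_mul_right le_self_add _)
  · exact (lintegral_fderiv_mol_le n _ hp hw hA hA' hAA).trans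
      (mul_le_mul_right le_add_self _)

/-- Fatou for mollified energies -/
theorem En_fatou {N : ℕ} (s : ℝ) {q : ℝ} {f : Euc N → ℝ} {F : ℕ → Euc N → ℝ}
    (hF : ∀ n, AEStronglyMeasurable (F n) volume)
    (hlim : ∀ᵐ x, Tendsto (fun n => F n x) atTop (𝓝 (f x))) {B : ℝ≥0∞}
    (hB : ∀ n, En s q (fun x => ‖F n x‖ₑ) ≤ B) : En s q (fun x => ‖f x‖ₑ) ≤ B := by
  have h1 : En s q (fun x => ‖f x‖ₑ) ≤
      ∫⁻ x, liminf (fun n => ENNReal.ofReal ((1 + ‖x‖) ^ (-s * q - N)) * ‖F n x‖ₑ ^ q) atTop := by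
    apply lintegral_mono_ae
    filter_upwards [hlim] with x hx
    have h2 : Tendsto (fun n => ENNReal.ofReal ((1 + ‖x‖) ^ (-s * q - N)) * ‖F n x‖ₑ ^ q) atTop
        (𝓝 (ENNReal.ofReal ((1 + ‖x‖) ^ (-s * q - N)) * ‖f x‖ₑ ^ q)) := by
      apply ENNReal.Tendsto.const_mul _ (Or.inr ENNReal.ofReal_ne_top)
      exact ((continuous_enorm.tendsto _).comp hx).ennrpow_const q
    exact h2.liminf_eq.ge
  refine h1.trans ((lintegral_liminf_le' (fun n => aemeas_wt _ _ (hF n))).trans ?_)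
  exact liminf_le_of_le (by isBoundedDefault) (fun b hb => by
    obtain ⟨n, hn⟩ := hb.exists
    exact hn.trans (hB n))

theorem sobolev_weak {N : ℕ} (hN : 1 ≤ N) (s : ℝ) {p q : ℝ} (hp : 1 ≤ p) (hpq : p ≤ q)
    (h : p⁻¹ - q⁻¹ ≤ (N : ℝ)⁻¹) :
    ∃ K : ℝ≥0∞, K ≠ ⊤ ∧ ∀ (f : Euc N → ℝ) (h : Fin N → Euc N → ℝ), LocallyIntegrable f volume →
      (∀ i, IsWeakPartialDeriv i f (h i)) → ∫⁻ x, TW s p f h x ≠ ⊤ →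
      En (s + 1) q (fun x => ‖f x‖ₑ) ≤ K * (∫⁻ x, TW s p f h x) ^ (q / p) := by
  obtain ⟨K, hK, hb⟩ := sobolev_global hN s hp hpq h
  obtain ⟨C, hC, hT⟩ := Tden_mol_le (N := N) s hp
  have hqp : 0 ≤ q / p := by apply div_nonneg <;> linarith
  refine ⟨K * C ^ (q / p), by finiteness, ?_⟩
  intro f h hf hw hE
  apply En_fatou (s + 1) (fun n => (mol_smooth n hf).continuous.aestronglyMeasurable)
    (mol_tendsto hf)
  intro n
  have h1 : ∫⁻ x, Tden N s p (mol n f) x ≤ C * ∫⁻ x, TW s p f h x := by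
    have := hT n f h hf hw Set.univ Set.univ .univ .univ (by simp)
    simpa using this
  refine (hb _ (mol_C1 n hf) (h1.trans_lt (by finiteness)).ne).trans ?_
  rw [mul_assoc, ← ENNReal.mul_rpow_of_nonneg _ _ hqp]
  gcongr

theorem sobolev_weak_pointwise {N : ℕ} (s : ℝ) {p : ℝ} (hp : 1 ≤ p)
    (hpN : (N : ℝ) < p ∨ (p = 1 ∧ N = 1)) :
    ∃ K : ℝ≥0∞, K ≠ ⊤ ∧ ∀ (f : Euc N → ℝ) (h : Fin N → Euc N → ℝ), LocallyIntegrable f volume →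
      (∀ i, IsWeakPartialDeriv i f (h i)) → ∫⁻ x, TW s p f h x ≠ ⊤ →
      ∀ᵐ y, ENNReal.ofReal ((1 + ‖y‖) ^ (-(s + 1) * p)) * ‖f y‖ₑ ^ p ≤
        K * ∫⁻ x in {x : Euc N | 3 * ‖y‖ - 5 ≤ 4 * ‖x‖}, TW s p f h x := by
  obtain ⟨K, hK, hb⟩ := sobolev_pointwise (N := N) s hp hpN
  obtain ⟨C, hC, hT⟩ := Tden_mol_le (N := N) s hp
  refine ⟨K * C, by finiteness, ?_⟩
  intro f h hf hw hE
  filter_upwards [mol_tendsto hf] with y hy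
  have h2 : Tendsto (fun n => ENNReal.ofReal ((1 + ‖y‖) ^ (-(s + 1) * p)) * ‖mol n f y‖ₑ ^ p) atTop
      (𝓝 (ENNReal.ofReal ((1 + ‖y‖) ^ (-(s + 1) * p)) * ‖f y‖ₑ ^ p)) := by
    apply ENNReal.Tendsto.const_mul _ (Or.inr ENNReal.ofReal_ne_top)
    exact ((continuous_enorm.tendsto _).comp hy).ennrpow_const p
  refine le_of_tendsto h2 (Eventually.of_forall fun n => ?_)
  refine (hb _ (mol_C1 n hf) y).trans ?_
  rw [mul_assoc]
  gcongr
  apply hT n f h hf hw _ _ measurableSet_closedBall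
  · exact measurableSet_le (by fun_prop) (by fun_prop)
  · intro x hx t ht
    rw [mem_closedBall, dist_eq_norm] at hx
    change 3 * ‖y‖ - 5 ≤ 4 * ‖x - t‖
    have h3 : ‖y‖ ≤ ‖x - y‖ + ‖x‖ := by
      have := norm_sub_le x (x - y)
      rw [show x - (x - y) = y by abel] at this; linarith
    have h4 : ‖x‖ ≤ ‖x - t‖ + ‖t‖ := by
      have := norm_add_le (x - t) t
      rwa [show x - t + t = x by abel] at this
    linarith

theorem hardy_weak {N : ℕ} {s p : ℝ} (hp : 1 ≤ p) (hs : s ≠ -1) (hN : s < -1 → 1 < N) :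
    ∃ C : ℝ≥0∞, C ≠ ⊤ ∧ ∀ (f : Euc N → ℝ) (h : Fin N → Euc N → ℝ), LocallyIntegrable f volume →
      (∀ i, IsWeakPartialDeriv i f (h i)) → ∑ i, En s p (fun x => ‖h i x‖ₑ) ≠ ⊤ →
      ∃ c : ℝ, En (s + 1) p (fun x => ‖f x - c‖ₑ) ≤ C * ∑ i, En s p (fun x => ‖h i x‖ₑ) := by
  have hp0 : 0 < p := by linarith
  obtain ⟨C, hC, hb⟩ := hardy_smooth (N := N) hp hs hN
  have hc : (N : ℝ≥0∞) ^ (p - 1) ≠ ⊤ :=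
    ENNReal.rpow_ne_top_of_nonneg (by linarith) (by finiteness)
  refine ⟨C * ((N : ℝ≥0∞) ^ (p - 1) * ENNReal.ofReal (2 ^ |-s * p - N|)), by finiteness, ?_⟩
  intro f h hf hw hE
  set E := ∑ i, En s p (fun x => ‖h i x‖ₑ) with hEd
  set B := C * ((N : ℝ≥0∞) ^ (p - 1) * ENNReal.ofReal (2 ^ |-s * p - N|)) * E with hBd
  have hBt : B ≠ ⊤ := by finiteness
  have hn : ∀ n, ∃ c : ℝ, En (s + 1) p (fun x => ‖mol n f x - c‖ₑ) ≤ B := by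
    intro n
    obtain ⟨c, hcn⟩ := hb _ (mol_C1 n hf)
    refine ⟨c, hcn.trans ?_⟩
    rw [hBd, mul_assoc]
    gcongr
    have := lintegral_fderiv_mol_le n (-s * p - N) hp hw (A := Set.univ) (A' := Set.univ) .univ .univ
      (by simp)
    rw [hEd]
    simpa [En] using this
  choose c hcb using hn
  -- boundedness of c
  have hloc : ∀ n, ∫⁻ x in closedBall (0 : Euc N) 1, ‖mol n f x - c n‖ₑ ≤
      volume (closedBall (0 : Euc N) 1) + ENNReal.ofReal ((1 + 1) ^ |(-(s + 1) * p - N)|) * B := by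
    intro n
    calc ∫⁻ x in closedBall (0 : Euc N) 1, ‖mol n f x - c n‖ₑ
        ≤ ∫⁻ x in closedBall (0 : Euc N) 1, (1 + ‖mol n f x - c n‖ₑ ^ p) := by
          apply lintegral_mono; intro x; beta_reduce
          rcases le_total ‖mol n f x - c n‖ₑ 1 with h1 | h1
          · exact h1.trans le_self_add
          · refine le_trans ?_ le_add_self
            conv_lhs => rw [← ENNReal.rpow_one ‖mol n f x - c n‖ₑ]
            exact ENNReal.rpow_le_rpow_of_exponent_le h1 hp
      _ = volume (closedBall (0 : Euc N) 1) +
          ∫⁻ x in closedBall (0 : Euc N) 1, ‖mol n f x - c n‖ₑ ^ p := by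
          rw [lintegral_add_left measurable_const]; simp
      _ ≤ _ := by
          gcongr
          refine (setLIntegral_ball_le_En (s := s + 1) (p := p) zero_le_one
            (fun x => ‖mol n f x - c n‖ₑ)).trans ?_
          gcongr
          exact hcb n
  have hmf : ∀ n, ∫⁻ x in closedBall (0 : Euc N) 1, ‖mol n f x‖ₑ ≤
      ∫⁻ x in closedBall (0 : Euc N) 2, ‖f x‖ₑ := by
    intro n
    have := mol_energy n le_rfl 0 hf.aestronglyMeasurable (A := closedBall (0 : Euc N) 1)
      (A' := closedBall (0 : Euc N) 2) measurableSet_closedBall measurableSet_closedBall (by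
        intro x hx t ht
        rw [mem_closedBall, dist_zero_right] at *
        exact (norm_sub_le _ _).trans (by linarith))
    simpa using this
  have hf2 : ∫⁻ x in closedBall (0 : Euc N) 2, ‖f x‖ₑ ≠ ⊤ :=
    (hf.integrableOn_isCompact (isCompact_closedBall 0 2)).2.ne
  have hV0 := volume_closedBall_ne_zero (N := N) (R := 1) one_pos 0
  have hVt : volume (closedBall (0 : Euc N) 1) ≠ ⊤ := measure_closedBall_lt_top.ne
  set M := volume (closedBall (0 : Euc N) 1) + ENNReal.ofReal ((1 + 1) ^ |(-(s + 1) * p - N)|) * B +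
    ∫⁻ x in closedBall (0 : Euc N) 2, ‖f x‖ₑ with hM
  have hMt : M ≠ ⊤ := by finiteness
  have hcM : ∀ n, ‖c n‖ₑ ≤ M / volume (closedBall (0 : Euc N) 1) := by
    intro n
    rw [ENNReal.le_div_iff_mul_le (Or.inl hV0) (Or.inl hVt)]
    calc ‖c n‖ₑ * volume (closedBall (0 : Euc N) 1)
        = ∫⁻ x in closedBall (0 : Euc N) 1, ‖c n‖ₑ := by simp
      _ ≤ ∫⁻ x in closedBall (0 : Euc N) 1, (‖mol n f x - c n‖ₑ + ‖mol n f x‖ₑ) := by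
          apply lintegral_mono; intro x; beta_reduce
          have : c n = -(mol n f x - c n) + mol n f x := by ring
          calc ‖c n‖ₑ = ‖-(mol n f x - c n) + mol n f x‖ₑ := by rw [← this]
            _ ≤ _ := (enorm_add_le _ _).trans (by rw [enorm_neg])
      _ = _ := by
          rw [lintegral_add_right]
          have := (mol_smooth n hf).continuous
          fun_prop
      _ ≤ M := add_le_add (hloc n) (hmf n)
  have hMV : M / volume (closedBall (0 : Euc N) 1) ≠ ⊤ := ENNReal.div_ne_top hMt hV0
  obtain ⟨c0, -, φ, hφ, hlim⟩ := tendsto_subseq_of_bounded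
    (isBounded_closedBall (x := (0:ℝ)) (r := (M / volume (closedBall (0 : Euc N) 1)).toReal)) (x := c) (by
      intro n
      rw [mem_closedBall, dist_zero_right]
      have := ENNReal.toReal_mono hMV (hcM n)
      simpa using this)
  refine ⟨c0, ?_⟩
  apply En_fatou (s + 1) (F := fun n x => mol (φ n) f x - c (φ n))
  · intro n
    exact ((mol_smooth _ hf).continuous.sub continuous_const).aestronglyMeasurable
  · filter_upwards [mol_tendsto hf] with x hx
    exact (hx.comp hφ.tendsto_atTop).sub hlim
  · intro n; exact hcb _



theorem pd_comm {N : ℕ} (i j : Fin N) {φ : Euc N → ℝ} (h : ContDiff ℝ (⊤ : ℕ∞) φ) :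
    pd i (pd j φ) = pd j (pd i φ) := by
  ext x
  have hs : IsSymmSndFDerivAt ℝ φ x :=
    h.contDiffAt.isSymmSndFDerivAt (by
      simp only [minSmoothness_of_isRCLikeNormedField]
      exact WithTop.coe_le_coe.2 le_top)
  have h1 : ContDiff ℝ (⊤ : ℕ∞) (fderiv ℝ φ) := h.fderiv_right (m := (⊤ : ℕ∞)) (by simp)
  have key : ∀ v w : Euc N, fderiv ℝ (fun y => fderiv ℝ φ y v) x w = fderiv ℝ (fderiv ℝ φ) x w v := by
    intro v w
    have h2 : HasFDerivAt (fderiv ℝ φ) (fderiv ℝ (fderiv ℝ φ) x) x :=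
      (h1.differentiable (by simp) x).hasFDerivAt
    rw [(h2.clm_apply (hasFDerivAt_const v x)).fderiv]
    simp
  change fderiv ℝ (fun y => fderiv ℝ φ y _) x _ = fderiv ℝ (fun y => fderiv ℝ φ y _) x _
  rw [key, key]
  exact hs _ _

theorem pd_pderivList {N : ℕ} (i : Fin N) (l : List (Fin N)) {φ : Euc N → ℝ}
    (h : ContDiff ℝ (⊤ : ℕ∞) φ) : pd i (pderivList l φ) = pderivList (i :: l) φ := by
  induction l generalizing φ with
  | nil => rfl
  | cons j l ih =>
    rw [pderivList_cons, ih (pd_smooth j h), pderivList_cons, pderivList_cons, pderivList_cons,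
      pd_comm i j h]

theorem pderivList_perm {N : ℕ} {l l' : List (Fin N)} (hl : l.Perm l') {φ : Euc N → ℝ}
    (h : ContDiff ℝ (⊤ : ℕ∞) φ) : pderivList l φ = pderivList l' φ := by
  induction hl generalizing φ with
  | nil => rfl
  | cons x _ ih => exact ih (pd_smooth x h)
  | swap x y l => rw [pderivList_cons, pderivList_cons, pderivList_cons, pderivList_cons, pd_comm x y h]
  | trans _ _ ih1 ih2 => rw [ih1 h, ih2 h]

theorem integrable_mul_TF {N : ℕ} {f φ : Euc N → ℝ} (hf : LocallyIntegrable f volume)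
    (hφ : TF φ) : Integrable (fun x => f x * φ x) volume := by
  have := hf.integrable_smul_right_of_hasCompactSupport hφ.1.continuous hφ.2
  simpa using this

theorem ibp_pd {N : ℕ} (i : Fin N) {f φ : Euc N → ℝ} (hf : ContDiff ℝ (⊤ : ℕ∞) f) (hφ : TF φ) :
    ∫ x, f x * pd i φ x = -∫ x, pd i f x * φ x := by
  apply integral_mul_fderiv_eq_neg_fderiv_mul_of_integrable
  · exact integrable_mul_TF (pd_smooth i hf).continuous.locallyIntegrable hφ
  · exact integrable_mul_TF hf.continuous.locallyIntegrable (hφ.pd i)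
  · exact integrable_mul_TF hf.continuous.locallyIntegrable hφ
  · intro x _; exact hf.differentiable (by simp) x
  · intro x _; exact hφ.1.differentiable (by simp) x

theorem ibp_list {N : ℕ} (l : List (Fin N)) {f φ : Euc N → ℝ} (hf : ContDiff ℝ (⊤ : ℕ∞) f)
    (hφ : TF φ) :
    ∫ x, f x * pderivList l φ x = (-1) ^ l.length * ∫ x, pderivList l f x * φ x := by
  induction l generalizing φ with
  | nil => simp [pderivList]
  | cons i l ih =>
    rw [pderivList_cons, ih (hφ.pd i), ibp_pd i (pderivList_smooth l hf) hφ, pd_pderivList i l hf]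
    simp [pow_succ]

/-- smooth functions: weak derivative is the classical one -/
theorem isWeakDerivList_smooth {N : ℕ} (l : List (Fin N)) {f : Euc N → ℝ}
    (hf : ContDiff ℝ (⊤ : ℕ∞) f) : IsWeakDerivList l f (pderivList l f) :=
  ⟨hf.continuous.locallyIntegrable, (pderivList_smooth l hf).continuous.locallyIntegrable,
    fun _ h1 h2 => ibp_list l hf ⟨h1, h2⟩⟩

theorem isWeakPartialDeriv_of {N : ℕ} {l : List (Fin N)} {i : Fin N} {u f h : Euc N → ℝ}
    (h1 : IsWeakDerivList l u f) (h2 : IsWeakDerivList (i :: l) u h) :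
    IsWeakPartialDeriv i f h := by
  refine ⟨h1.2.1, h2.2.1, fun φ ha hb => ?_⟩
  have e1 := h1.2.2 _ (TF.pd i ⟨ha, hb⟩).1 (TF.pd i ⟨ha, hb⟩).2
  have e2 := h2.2.2 φ ha hb
  rw [pderivList_cons, e1] at e2
  change ∫ x, f x * pd i φ x = _
  have h3 : ((-1 : ℝ) ^ l.length) * (-1) ^ l.length = 1 := by
    rw [← mul_pow]; simp
  have e3 := congrArg (fun t => (-1 : ℝ) ^ l.length * t) e2
  simp only [← mul_assoc, h3, List.length_cons, pow_succ, one_mul] at e3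
  simpa using e3

theorem IsWeakDerivList.perm {N : ℕ} {l l' : List (Fin N)} (hl : l.Perm l') {u f : Euc N → ℝ}
    (h : IsWeakDerivList l u f) : IsWeakDerivList l' u f := by
  refine ⟨h.1, h.2.1, fun φ ha hb => ?_⟩
  rw [← pderivList_perm hl ha, ← hl.length_eq]
  exact h.2.2 φ ha hb

theorem IsWeakDerivList.unique {N : ℕ} {l : List (Fin N)} {u f g : Euc N → ℝ}
    (h : IsWeakDerivList l u f) (h' : IsWeakDerivList l u g) : f =ᵐ[volume] g := by
  apply ae_eq_of_integral_contDiff_smul_eq h.2.1 h'.2.1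
  intro φ ha hb
  have e := (h.2.2 φ ha hb).symm.trans (h'.2.2 φ ha hb)
  have h0 : ((-1 : ℝ) ^ l.length) ≠ 0 := by positivity
  have e2 := mul_left_cancel₀ h0 e
  simpa [mul_comm] using e2

theorem IsWeakDerivList.congr {N : ℕ} {l : List (Fin N)} {u f g : Euc N → ℝ}
    (h : IsWeakDerivList l u f) (hg : f =ᵐ[volume] g) : IsWeakDerivList l u g := by
  refine ⟨h.1, h.2.1.congr hg, fun φ ha hb => ?_⟩
  rw [h.2.2 φ ha hb]
  congr 1
  apply integral_congr_ae
  filter_upwards [hg] with x hx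
  rw [hx]

theorem IsWeakDerivList.sub {N : ℕ} {l : List (Fin N)} {u v f g : Euc N → ℝ}
    (h : IsWeakDerivList l u f) (h' : IsWeakDerivList l v g) :
    IsWeakDerivList l (fun x => u x - v x) (fun x => f x - g x) := by
  refine ⟨h.1.sub h'.1, h.2.1.sub h'.2.1, fun φ ha hb => ?_⟩
  have t : TF φ := ⟨ha, hb⟩
  simp only [sub_mul]
  rw [integral_sub (integrable_mul_TF h.1 (t.pderivList l)) (integrable_mul_TF h'.1 (t.pderivList l)),
    integral_sub (integrable_mul_TF h.2.1 t) (integrable_mul_TF h'.2.1 t), h.2.2 φ ha hb,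
    h'.2.2 φ ha hb]
  ring

theorem et_zero' {N n : ℕ} {x : Euc N} (hx : 1 / ((n : ℝ) + 1) < ‖x‖) : et N n x = 0 := by
  by_contra h
  have h1 : x ∈ Function.support (et N n) := h
  rw [et, (bmp N n).support_normed_eq, mem_ball, dist_zero_right] at h1
  have h2 : (bmp N n).rOut = 1 / ((n : ℝ) + 1) := rfl
  linarith

theorem mol_energy_sharp {N : ℕ} (n : ℕ) (r : ℝ) {g : Euc N → ℝ}
    (hg : AEStronglyMeasurable g volume) :
    ∫⁻ x, ENNReal.ofReal ((1 + ‖x‖) ^ r) * ‖mol n g x‖ₑ ≤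
      ENNReal.ofReal ((1 + 1 / ((n : ℝ) + 1)) ^ |r|) *
        ∫⁻ x, ENNReal.ofReal ((1 + ‖x‖) ^ r) * ‖g x‖ₑ := by
  wlog hgm : Measurable g generalizing g
  · have h := this (g := hg.mk g) hg.stronglyMeasurable_mk.aestronglyMeasurable
      hg.stronglyMeasurable_mk.measurable
    rw [mol_congr n hg.ae_eq_mk]
    refine h.trans (le_of_eq ?_)
    congr 1
    apply lintegral_congr_ae
    filter_upwards [hg.ae_eq_mk] with x hx
    rw [hx]
  have hem : Measurable fun t => ENNReal.ofReal (et N n t) := by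
    have := (et_TF N n).1.continuous; fun_prop
  set κ : ℝ := 1 + 1 / ((n : ℝ) + 1) with hκ
  have hκ1 : 1 ≤ κ := by rw [hκ]; simp; positivity
  set G : Euc N → ℝ≥0∞ := fun x => ENNReal.ofReal ((1 + ‖x‖) ^ r) * ‖g x‖ₑ with hG
  have hGm : Measurable G :=
    ((measurable_wt_aux r).mul (Measurable.enorm hgm))
  have hpt : ∀ x, ENNReal.ofReal ((1 + ‖x‖) ^ r) * ‖mol n g x‖ₑ ≤
      ∫⁻ t, ENNReal.ofReal (κ ^ |r|) * (ENNReal.ofReal (et N n t) * G (x - t)) := by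
    intro x
    have hm := mol_enorm_rpow_le n le_rfl hgm x
    simp only [ENNReal.rpow_one] at hm
    refine (mul_le_mul_right hm _).trans ?_
    rw [← lintegral_const_mul' _ _ (by finiteness)]
    apply lintegral_mono
    intro t
    beta_reduce
    by_cases ht : ‖t‖ ≤ 1 / ((n : ℝ) + 1)
    · simp only [hG]
      rw [show ∀ a b c : ℝ≥0∞, a * (b * c) = a * (b * c) by intros; ring,
        show ∀ a b c d : ℝ≥0∞, a * (b * (c * d)) = (a * c) * (b * d) by intros; ring]
      refine mul_le_mul_left ?_ _
      rw [← ENNReal.ofReal_mul (by positivity)]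
      apply ENNReal.ofReal_le_ofReal
      have h1 : ‖x - t‖ ≤ ‖x‖ + ‖t‖ := norm_sub_le _ _
      have h2 : ‖x‖ ≤ ‖x - t‖ + ‖t‖ := by
        calc ‖x‖ = ‖(x - t) + t‖ := by rw [sub_add_cancel]
          _ ≤ _ := norm_add_le _ _
      have := norm_nonneg x
      have := norm_nonneg (x - t)
      have : ‖t‖ ≤ κ - 1 := by rw [hκ]; linarith
      exact rpow_comparable (by positivity) (by positivity) hκ1 (by nlinarith)
        (by nlinarith) _
    · rw [et_zero' (not_le.1 ht)]; simp
  calc _ ≤ ∫⁻ x, ∫⁻ t, ENNReal.ofReal (κ ^ |r|) * (ENNReal.ofReal (et N n t) * G (x - t)) :=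
        lintegral_mono hpt
    _ = ∫⁻ t, ∫⁻ x, ENNReal.ofReal (κ ^ |r|) * (ENNReal.ofReal (et N n t) * G (x - t)) := by
        refine lintegral_swap_aux volume volume (fun (x : Euc N) (t : Euc N) =>
          ENNReal.ofReal (κ ^ |r|) * (ENNReal.ofReal (et N n t) * G (x - t))) ?_
        refine Measurable.const_mul ?_ _
        exact (Measurable.comp (g := fun t => ENNReal.ofReal (et N n t)) hem measurable_snd).mul
          (Measurable.comp (g := G) hGm (by fun_prop))
    _ = ∫⁻ t, (ENNReal.ofReal (κ ^ |r|) * ∫⁻ x, G x) * ENNReal.ofReal (et N n t) := by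
        congr 1; ext t
        rw [lintegral_const_mul' _ _ (by finiteness), lintegral_const_mul' _ _ (by finiteness),
          lintegral_sub_right_eq_self G t]
        ring
    _ = _ := by
        rw [lintegral_const_mul _ hem, et_lintegral, mul_one, hG]

theorem aemeas_wt1 {N : ℕ} (r : ℝ) {g : Euc N → ℝ} (hg : AEStronglyMeasurable g volume) :
    AEMeasurable (fun x : Euc N => ENNReal.ofReal ((1 + ‖x‖) ^ r) * ‖g x‖ₑ) volume := by
  have h1 : Measurable fun x : Euc N => ENNReal.ofReal ((1 + ‖x‖) ^ r) := measurable_wt_aux r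
  exact h1.aemeasurable.mul hg.enorm

theorem mol_strong {N : ℕ} (r : ℝ) {g : Euc N → ℝ} (hg : LocallyIntegrable g volume)
    (hI : ∫⁻ x, ENNReal.ofReal ((1 + ‖x‖) ^ r) * ‖g x‖ₑ ≠ ⊤) :
    Tendsto (fun n => ∫⁻ x, ENNReal.ofReal ((1 + ‖x‖) ^ r) * ‖mol n g x - g x‖ₑ) atTop (𝓝 0) := by
  set W : Euc N → ℝ≥0∞ := fun x => ENNReal.ofReal ((1 + ‖x‖) ^ r) with hW
  have hWt : ∀ x, W x ≠ ⊤ := fun x => ENNReal.ofReal_ne_top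
  set I := ∫⁻ x, W x * ‖g x‖ₑ with hId
  have hgm := hg.aestronglyMeasurable
  have hmm : ∀ n, AEStronglyMeasurable (mol n g) volume := fun n =>
    (mol_smooth n hg).continuous.aestronglyMeasurable
  have ma : ∀ n, AEMeasurable (fun x => W x * ‖mol n g x‖ₑ) volume := fun n => aemeas_wt1 r (hmm n)
  have mb : AEMeasurable (fun x => W x * ‖g x‖ₑ) volume := aemeas_wt1 r hgm
  have md : ∀ n, AEMeasurable (fun x => W x * ‖mol n g x - g x‖ₑ) volume := fun n =>
    aemeas_wt1 r ((hmm n).sub hgm)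
  set H : ℕ → Euc N → ℝ≥0∞ := fun n x => W x * ‖mol n g x‖ₑ + W x * ‖g x‖ₑ - W x * ‖mol n g x - g x‖ₑ
    with hH
  have mH : ∀ n, AEMeasurable (H n) volume := fun n => ((ma n).add mb).sub (md n)
  have hHd : ∀ n, (∫⁻ x, H n x) + ∫⁻ x, W x * ‖mol n g x - g x‖ₑ ≤
      ENNReal.ofReal ((1 + 1 / ((n : ℝ) + 1)) ^ |r|) * I + I := by
    intro n
    rw [← lintegral_add_right' _ (md n)]
    calc _ = ∫⁻ x, (W x * ‖mol n g x‖ₑ + W x * ‖g x‖ₑ) := by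
          apply lintegral_congr; intro x
          apply tsub_add_cancel_of_le
          rw [← mul_add]
          exact mul_le_mul_right enorm_sub_le _
      _ = _ := lintegral_add_right' _ mb
      _ ≤ _ := add_le_add (mol_energy_sharp n r hgm) le_rfl
  have hfat : I + I ≤ liminf (fun n => ∫⁻ x, H n x) atTop := by
    refine le_trans ?_ (lintegral_liminf_le' mH)
    rw [hId, ← lintegral_add_right' _ mb]
    apply lintegral_mono_ae
    filter_upwards [mol_tendsto hg] with x hx
    have t1 : Tendsto (fun n => W x * ‖mol n g x‖ₑ) atTop (𝓝 (W x * ‖g x‖ₑ)) :=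
      ENNReal.Tendsto.const_mul ((continuous_enorm.tendsto _).comp hx) (Or.inr (hWt x))
    have t2 : Tendsto (fun n => W x * ‖mol n g x - g x‖ₑ) atTop (𝓝 0) := by
      have := ENNReal.Tendsto.const_mul (a := W x) ((continuous_enorm.tendsto _).comp (hx.sub_const (g x)))
        (Or.inr (hWt x))
      simpa using this
    have t3 := ENNReal.Tendsto.sub (t1.add_const (W x * ‖g x‖ₑ)) t2 (Or.inr (by simp))
    rw [tsub_zero] at t3
    exact t3.liminf_eq.ge
  have hκ : Tendsto (fun n : ℕ => ENNReal.ofReal ((1 + 1 / ((n : ℝ) + 1)) ^ |r|) * I + I) atTop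
      (𝓝 (I + I)) := by
    have h1 : Tendsto (fun n : ℕ => (1 + 1 / ((n : ℝ) + 1)) ^ |r|) atTop (𝓝 ((1 + 0) ^ |r|)) :=
      (tendsto_one_div_add_atTop_nhds_zero_nat.const_add 1).rpow_const (by simp)
    have h2 := ENNReal.Tendsto.mul_const (ENNReal.tendsto_ofReal h1) (b := I) (Or.inr hI)
    have h3 := h2.add_const I
    simpa using h3
  rw [ENNReal.tendsto_nhds_zero]
  intro ε hε
  by_cases hεt : ε = ⊤
  · simp [hεt]
  have hε2 : ε / 2 ≠ 0 := by simpa using hε.ne'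
  have e1 : ∀ᶠ n : ℕ in atTop, ENNReal.ofReal ((1 + 1 / ((n : ℝ) + 1)) ^ |r|) * I + I ≤ I + I + ε / 2 := by
    exact hκ.eventually_le_const (ENNReal.lt_add_right (by finiteness) hε2)
  have e2 : ∀ᶠ n : ℕ in atTop, I + I ≤ (∫⁻ x, H n x) + ε / 2 := by
    by_cases h0 : I + I = 0
    · rw [h0]; simp
    · have : I + I - ε / 2 < liminf (fun n => ∫⁻ x, H n x) atTop :=
        (ENNReal.sub_lt_self (by finiteness) h0 hε2).trans_le hfat
      filter_upwards [eventually_lt_of_lt_liminf this] with n hn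
      exact tsub_le_iff_right.1 hn.le
  filter_upwards [e1, e2] with n h1 h2
  have h3 := (hHd n).trans (h1.trans (add_le_add_left h2 _))
  rw [add_assoc, ENNReal.add_halves] at h3
  refine (ENNReal.add_le_add_iff_left ?_).1 h3
  have := (le_self_add.trans (hHd n))
  exact (this.trans_lt (by finiteness)).ne

theorem test_bound {N : ℕ} (t : ℝ) {φ : Euc N → ℝ} (hφ : TF φ) :
    ∃ C : ℝ≥0∞, C ≠ ⊤ ∧ ∀ F : Euc N → ℝ,
      ∫⁻ x, ‖F x * φ x‖ₑ ≤ C * En t 1 (fun x => ‖F x‖ₑ) := by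
  obtain ⟨M, hM⟩ := hφ.1.continuous.bounded_above_of_compact_support hφ.2
  obtain ⟨R, hR⟩ := hφ.2.isCompact.isBounded.subset_closedBall 0
  have hR' : tsupport φ ⊆ closedBall 0 (max R 0) := hR.trans (closedBall_subset_closedBall (le_max_left _ _))
  refine ⟨ENNReal.ofReal M * ENNReal.ofReal ((1 + max R 0) ^ |(-t * 1 - N)|), by finiteness, ?_⟩
  intro F
  calc ∫⁻ x, ‖F x * φ x‖ₑ ≤ ∫⁻ x in closedBall 0 (max R 0), ENNReal.ofReal M * ‖F x‖ₑ ^ (1:ℝ) := by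
        rw [← lintegral_indicator measurableSet_closedBall]
        apply lintegral_mono; intro x; beta_reduce
        by_cases hx : x ∈ closedBall (0 : Euc N) (max R 0)
        · rw [Set.indicator_of_mem hx, enorm_mul, mul_comm, ENNReal.rpow_one]
          refine mul_le_mul_left ?_ _
          rw [← ofReal_norm]
          exact ENNReal.ofReal_le_ofReal (hM x)
        · have : φ x = 0 := image_eq_zero_of_notMem_tsupport (fun h => hx (hR' h))
          simp [this]
    _ = ENNReal.ofReal M * ∫⁻ x in closedBall 0 (max R 0), ‖F x‖ₑ ^ (1:ℝ) :=
        lintegral_const_mul' _ _ (by finiteness)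
    _ ≤ _ := by
        rw [mul_assoc]
        exact mul_le_mul_right (setLIntegral_ball_le_En (s := t) (p := 1) (le_max_right _ _)
          (fun x => ‖F x‖ₑ)) _

theorem test_tendsto {N : ℕ} (t : ℝ) {φ : Euc N → ℝ} (hφ : TF φ) {F : ℕ → Euc N → ℝ}
    {f : Euc N → ℝ} (hF : ∀ n, LocallyIntegrable (F n) volume) (hf : LocallyIntegrable f volume)
    (h : Tendsto (fun n => En t 1 (fun x => ‖F n x - f x‖ₑ)) atTop (𝓝 0)) :
    Tendsto (fun n => ∫ x, F n x * φ x) atTop (𝓝 (∫ x, f x * φ x)) := by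
  obtain ⟨C, hC, hb⟩ := test_bound t hφ
  apply tendsto_integral_of_L1 _ (integrable_mul_TF hf hφ).1
    (Eventually.of_forall fun n => integrable_mul_TF (hF n) hφ)
  have h2 : Tendsto (fun n => C * En t 1 (fun x => ‖F n x - f x‖ₑ)) atTop (𝓝 0) := by
    simpa using ENNReal.Tendsto.const_mul h (Or.inr hC)
  refine tendsto_of_tendsto_of_tendsto_of_le_of_le tendsto_const_nhds h2 (fun n => zero_le) (fun n => ?_)
  refine le_trans (le_of_eq ?_) (hb fun x => F n x - f x)
  apply lintegral_congr; intro x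
  rw [sub_mul]

theorem mol_test_tendsto {N : ℕ} {u φ : Euc N → ℝ} (hu : LocallyIntegrable u volume) (hφ : TF φ) :
    Tendsto (fun n => ∫ x, mol n u x * φ x) atTop (𝓝 (∫ x, u x * φ x)) := by
  obtain ⟨R, hR⟩ := hφ.2.isCompact.isBounded.subset_closedBall 0
  set B : Set (Euc N) := closedBall 0 (R + 1) with hB
  set u' := B.indicator u with hu'
  have hi : Integrable u' volume :=
    (hu.integrableOn_isCompact (isCompact_closedBall 0 (R+1))).integrable_indicator measurableSet_closedBall
  have hst := mol_strong 0 hi.locallyIntegrable (by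
    have := hi.2.ne
    simpa using this)
  have hlim := test_tendsto (-(N:ℝ)) hφ (F := fun n => mol n u') (f := u')
    (fun n => (mol_smooth n hi.locallyIntegrable).continuous.locallyIntegrable) hi.locallyIntegrable (by
      simpa [En] using hst)
  have hz : ∀ x, φ x ≠ 0 → ‖x‖ ≤ R := by
    intro x hx
    have := hR (subset_tsupport φ hx)
    simpa using this
  have e1 : ∀ n, ∫ x, mol n u x * φ x = ∫ x, mol n u' x * φ x := by
    intro n; congr 1; ext x
    by_cases hx : φ x = 0
    · simp [hx]
    · congr 1
      rw [mol_eq, mol_eq]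
      congr 1; ext t
      by_cases ht : ‖t‖ ≤ 1
      · rw [hu', Set.indicator_of_mem]
        rw [hB, mem_closedBall, dist_zero_right]
        exact (norm_sub_le _ _).trans (add_le_add (hz x hx) ht)
      · rw [et_zero (not_le.1 ht)]; simp
  have e2 : ∫ x, u x * φ x = ∫ x, u' x * φ x := by
    congr 1; ext x
    by_cases hx : φ x = 0
    · simp [hx]
    · rw [hu', Set.indicator_of_mem]
      rw [hB, mem_closedBall, dist_zero_right]
      linarith [hz x hx]
  simp only [e1, e2]
  exact hlim



theorem En_one_eq {N : ℕ} (t : ℝ) (F : Euc N → ℝ≥0∞) :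
    En t 1 F = ∫⁻ x, ENNReal.ofReal ((1 + ‖x‖) ^ (-t - N)) * F x := by
  unfold En; simp

theorem En_one_ne_top {N : ℕ} {t p : ℝ} (ht : 0 < t) (hp : 0 < p) :
    En (N := N) t p (fun _ => 1) ≠ ⊤ := by
  have h := finite_integral_one_add_norm (E := Euc N) (μ := volume) (r := t * p + N) (by
    simp; positivity)
  unfold En
  simp only [ENNReal.one_rpow, mul_one]
  convert h.ne using 4
  ring_nf

theorem En_one_mul_const {N : ℕ} (t : ℝ) (c : ℝ≥0∞) (hc : c ≠ ⊤) :
    En (N := N) t 1 (fun _ => c) = c * En (N := N) t 1 (fun _ => 1) := by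
  rw [En_one_eq, En_one_eq, ← lintegral_const_mul' _ _ hc]
  congr 1; ext x; ring

theorem En_one_add_le {N : ℕ} (t : ℝ) {F G : Euc N → ℝ≥0∞} (hF : AEMeasurable F volume) :
    En t 1 (fun x => F x + G x) ≤ En t 1 F + En t 1 G := by
  have := En_add_le (s := t) le_rfl (G := G) hF
  simpa using this

theorem complete_wt {N : ℕ} (t : ℝ) {f : ℕ → Euc N → ℝ} (hf : ∀ n, Continuous (f n))
    (hfin : ∀ n m, En t 1 (fun x => ‖f n x - f m x‖ₑ) ≠ ⊤)
    (hc : Tendsto (fun nm : ℕ × ℕ => En t 1 (fun x => ‖f nm.1 x - f nm.2 x‖ₑ)) atTop (𝓝 0)) :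
    ∃ F : Euc N → ℝ, LocallyIntegrable F volume ∧
      Tendsto (fun n => En t 1 (fun x => ‖f n x - F x‖ₑ)) atTop (𝓝 0) := by
  set W : Euc N → ℝ := fun x => (1 + ‖x‖) ^ (-t - N) with hW
  have hWpos : ∀ x, 0 < W x := fun x => by rw [hW]; positivity
  have hWc : Continuous W := by
    rw [hW]
    exact (by fun_prop : Continuous fun x : Euc N => 1 + ‖x‖).rpow_const
      (fun x => Or.inl (by positivity))
  have hEn : ∀ G : Euc N → ℝ, eLpNorm (fun x => W x * G x) 1 volume = En t 1 (fun x => ‖G x‖ₑ) := by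
    intro G
    rw [eLpNorm_one_eq_lintegral_enorm, En_one_eq]
    congr 1; ext x
    rw [enorm_mul, ← ofReal_norm (W x), Real.norm_of_nonneg (hWpos x).le]
  set h : ℕ → Euc N → ℝ := fun n x => W x * (f n x - f 0 x) with hh
  have hmem : ∀ n, MemLp (h n) 1 volume := by
    intro n
    refine ⟨(hWc.mul ((hf n).sub (hf 0))).aestronglyMeasurable, ?_⟩
    rw [hh]
    rw [hEn fun x => f n x - f 0 x]
    exact (hfin n 0).lt_top
  have hcau : CauchySeq (fun n => (hmem n).toLp (h n)) := by
    rw [Lp.cauchySeq_Lp_iff_cauchySeq_eLpNorm]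
    refine hc.congr fun nm => ?_
    rw [← hEn fun x => f nm.1 x - f nm.2 x]
    apply eLpNorm_congr_ae
    filter_upwards [(hmem nm.1).coeFn_toLp, (hmem nm.2).coeFn_toLp] with x h1 h2
    rw [Pi.sub_apply, h1, h2]
    simp only [hh]; ring
  obtain ⟨H, hH⟩ := cauchySeq_tendsto_of_complete hcau
  rw [Lp.tendsto_Lp_iff_tendsto_eLpNorm'] at hH
  refine ⟨fun x => f 0 x + (W x)⁻¹ * H x, ?_, ?_⟩
  · refine (hf 0).locallyIntegrable.add ?_
    have h1 : LocallyIntegrable (H : Euc N → ℝ) volume :=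
      (L1.integrable_coeFn H).locallyIntegrable
    have h2 : Continuous fun x => (W x)⁻¹ := hWc.inv₀ fun x => (hWpos x).ne'
    rw [← locallyIntegrableOn_univ] at h1 ⊢
    exact h1.continuousOn_mul h2.continuousOn isOpen_univ.isLocallyClosed
  · refine hH.congr fun n => ?_
    rw [← hEn]
    apply eLpNorm_congr_ae
    filter_upwards [(hmem n).coeFn_toLp] with x h1
    have := (hWpos x).ne'
    rw [Pi.sub_apply, h1]
    simp only [hh]
    field_simp; ring

theorem exists_lower {N : ℕ} {S : ℝ} (hS : -1 < S) (l : List (Fin N)) {u : Euc N → ℝ}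
    (hu : LocallyIntegrable u volume) {g : Fin N → Euc N → ℝ}
    (hg : ∀ i, IsWeakDerivList (i :: l) u (g i)) (hgE : ∀ i, En S 1 (fun x => ‖g i x‖ₑ) ≠ ⊤) :
    ∃ f, IsWeakDerivList l u f := by
  obtain ⟨C, hC, hb⟩ := hardy_smooth (N := N) (s := S) (p := 1) le_rfl (by linarith) (by
    intro h; linarith)
  set f : ℕ → Euc N → ℝ := fun n => pderivList l (mol n u) with hfd
  have hfs : ∀ n, ContDiff ℝ (⊤ : ℕ∞) (f n) := fun n => pderivList_smooth l (mol_smooth n hu)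
  have hpdf : ∀ n i, pd i (f n) = mol n (g i) := by
    intro n i
    rw [hfd]; simp only
    rw [pd_pderivList i l (mol_smooth n hu), mol_pderivList n (hg i)]
  set δ : ℕ → ℝ≥0∞ := fun n => ∑ i, En S 1 (fun x => ‖mol n (g i) x - g i x‖ₑ) with hδ
  have hmc : ∀ n i, Continuous (mol n (g i)) := fun n i => (mol_smooth n (hg i).2.1).continuous
  have hδt : ∀ n, δ n ≠ ⊤ := by
    intro n
    rw [hδ]; simp only
    refine ENNReal.sum_ne_top.2 fun i _ => ?_
    have h1 : En S 1 (fun x => ‖mol n (g i) x‖ₑ) ≠ ⊤ := by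
      have := mol_energy n le_rfl (-S * 1 - N) (hg i).2.1.aestronglyMeasurable (A := Set.univ)
        (A' := Set.univ) .univ .univ (by simp)
      rw [Measure.restrict_univ] at this
      have h3 := hgE i
      exact (this.trans_lt (ENNReal.mul_lt_top (by finiteness) h3.lt_top)).ne
    have h2 : En S 1 (fun x => ‖mol n (g i) x - g i x‖ₑ) ≤
        En S 1 (fun x => ‖mol n (g i) x‖ₑ) + En S 1 (fun x => ‖g i x‖ₑ) := by
      refine le_trans (En_mono zero_le_one (ae_of_all _ fun x => enorm_sub_le)) (En_one_add_le S ?_)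
      exact (hmc n i).aestronglyMeasurable.enorm
    exact (h2.trans_lt (ENNReal.add_lt_top.2 ⟨h1.lt_top, (hgE i).lt_top⟩)).ne
  have hδ0 : Tendsto δ atTop (𝓝 0) := by
    have : Tendsto δ atTop (𝓝 (∑ i : Fin N, 0)) := by
      apply tendsto_finsetSum
      intro i _
      have := mol_strong (-S - N) (hg i).2.1 (by rw [← En_one_eq]; exact hgE i)
      simpa only [En_one_eq] using this
    simpa using this
  have hgrad : ∀ n m, En S 1 (fun x => ‖fderiv ℝ (fun y => f n y - f m y) x‖ₑ) ≤ δ n + δ m := by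
    intro n m
    have hpt : ∀ x, ‖fderiv ℝ (fun y => f n y - f m y) x‖ₑ ≤
        ∑ i, (‖mol n (g i) x - g i x‖ₑ + ‖mol m (g i) x - g i x‖ₑ) := by
      intro x
      refine (enorm_fderiv_le _ x).trans (Finset.sum_le_sum fun i _ => ?_)
      have : pd i (fun y => f n y - f m y) x = mol n (g i) x - mol m (g i) x := by
        rw [← hpdf, ← hpdf]
        simp only [pd]
        rw [fderiv_fun_sub ((hfs n).differentiable (by simp) x) ((hfs m).differentiable (by simp) x)]
        rfl
      rw [this, show mol n (g i) x - mol m (g i) x =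
        (mol n (g i) x - g i x) - (mol m (g i) x - g i x) by ring]
      exact enorm_sub_le
    have haem : ∀ n i, AEMeasurable (fun x => ENNReal.ofReal ((1 + ‖x‖) ^ (-S - N)) *
        ‖mol n (g i) x - g i x‖ₑ) volume := fun n i =>
      aemeas_wt1 _ ((hmc n i).aestronglyMeasurable.sub (hg i).2.1.aestronglyMeasurable)
    rw [En_one_eq]
    calc _ ≤ ∫⁻ x, ∑ i, (ENNReal.ofReal ((1 + ‖x‖) ^ (-S - N)) * ‖mol n (g i) x - g i x‖ₑ +
          ENNReal.ofReal ((1 + ‖x‖) ^ (-S - N)) * ‖mol m (g i) x - g i x‖ₑ) := by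
          apply lintegral_mono; intro x; beta_reduce
          refine (mul_le_mul_right (hpt x) _).trans (le_of_eq ?_)
          rw [Finset.mul_sum]
          exact Finset.sum_congr rfl fun i _ => mul_add _ _ _
      _ = ∑ i, ((∫⁻ x, ENNReal.ofReal ((1 + ‖x‖) ^ (-S - N)) * ‖mol n (g i) x - g i x‖ₑ) +
          ∫⁻ x, ENNReal.ofReal ((1 + ‖x‖) ^ (-S - N)) * ‖mol m (g i) x - g i x‖ₑ) := by
          have hsum : ∀ i, AEMeasurable (fun x => ENNReal.ofReal ((1 + ‖x‖) ^ (-S - N)) *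
              ‖mol n (g i) x - g i x‖ₑ + ENNReal.ofReal ((1 + ‖x‖) ^ (-S - N)) *
              ‖mol m (g i) x - g i x‖ₑ) volume := fun i => (haem n i).add (haem m i)
          rw [lintegral_finsetSum' _ (fun i _ => hsum i)]
          exact Finset.sum_congr rfl fun i _ => lintegral_add_left' (haem n i) _
      _ = δ n + δ m := by
          rw [Finset.sum_add_distrib]
          simp only [hδ, En_one_eq]
  -- test function
  have hφ := et_TF N 0
  obtain ⟨D, hD, hDb⟩ := test_bound (S + 1) hφ
  set α : ℕ → ℝ := fun n => ∫ x, f n x * et N 0 x with hα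
  have hfφ : ∀ n {φ : Euc N → ℝ}, TF φ → ∫ x, f n x * φ x =
      (-1) ^ l.length * ∫ x, mol n u x * pderivList l φ x := by
    intro n φ hφ
    rw [ibp_list l (mol_smooth n hu) hφ, ← mul_assoc, ← mul_pow]
    simp [hfd]
  have hαc : CauchySeq α := by
    have h1 := (mol_test_tendsto hu (hφ.pderivList l)).const_mul ((-1 : ℝ) ^ l.length)
    refine Tendsto.cauchySeq (h1.congr fun n => ?_)
    rw [hα]; simp only
    rw [hfφ n hφ]
  set O := En (N := N) (S + 1) 1 (fun _ => 1) with hO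
  have hOt : O ≠ ⊤ := En_one_ne_top (by linarith) one_pos
  have hmain : ∀ n m, En (S + 1) 1 (fun x => ‖f n x - f m x‖ₑ) ≤
      C * (δ n + δ m) + (‖α n - α m‖ₑ + D * (C * (δ n + δ m))) * O := by
    intro n m
    obtain ⟨c, hcb⟩ := hb (fun y => f n y - f m y) (((hfs n).sub (hfs m)).of_le (by exact_mod_cast le_top))
    have hcb' := hcb.trans (mul_le_mul_right (hgrad n m) C)
    have hcon : ‖c‖ₑ ≤ ‖α n - α m‖ₑ + D * (C * (δ n + δ m)) := by
      have hi1 : ∀ n, Integrable (fun x => f n x * et N 0 x) volume := fun n =>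
        integrable_mul_TF (hfs n).continuous.locallyIntegrable hφ
      have hi2 : Integrable (fun x => (f n x - f m x - c) * et N 0 x) volume :=
        integrable_mul_TF (((hfs n).sub (hfs m)).sub contDiff_const).continuous.locallyIntegrable hφ
      have e1 : c = (α n - α m) - ∫ x, (f n x - f m x - c) * et N 0 x := by
        have e2 : ∫ x, (f n x - f m x - c) * et N 0 x = α n - α m - c := by
          have : ∀ x, (f n x - f m x - c) * et N 0 x = f n x * et N 0 x - f m x * et N 0 x - c * et N 0 x :=
            fun x => by ring
          simp only [this]
          have hi3 : Integrable (fun x => c * et N 0 x) volume :=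
            integrable_mul_TF continuous_const.locallyIntegrable hφ
          have hi4 : Integrable (fun x => f n x * et N 0 x - f m x * et N 0 x) volume :=
            (hi1 n).sub (hi1 m)
          rw [integral_sub hi4 hi3, integral_sub (hi1 n) (hi1 m),
            integral_const_mul, et_integral, mul_one]
        rw [e2]; ring
      calc ‖c‖ₑ = ‖(α n - α m) - ∫ x, (f n x - f m x - c) * et N 0 x‖ₑ := by rw [← e1]
        _ ≤ ‖α n - α m‖ₑ + ‖∫ x, (f n x - f m x - c) * et N 0 x‖ₑ := enorm_sub_le
        _ ≤ _ := by
          refine add_le_add le_rfl ((enorm_integral_le_lintegral_enorm _).trans ?_)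
          exact (hDb fun x => f n x - f m x - c).trans (mul_le_mul_right hcb' D)
    calc En (S + 1) 1 (fun x => ‖f n x - f m x‖ₑ)
        ≤ En (S + 1) 1 (fun x => ‖f n x - f m x - c‖ₑ + ‖c‖ₑ) := by
          apply En_mono zero_le_one (ae_of_all _ fun x => ?_)
          calc ‖f n x - f m x‖ₑ = ‖f n x - f m x - c + c‖ₑ := by congr 1; ring
            _ ≤ _ := enorm_add_le _ _
      _ ≤ En (S + 1) 1 (fun x => ‖f n x - f m x - c‖ₑ) + En (S + 1) 1 (fun _ => ‖c‖ₑ) := by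
          apply En_one_add_le
          exact (((hfs n).continuous.sub (hfs m).continuous).sub
            continuous_const).aestronglyMeasurable.enorm
      _ ≤ _ := by
          rw [En_one_mul_const _ _ (by finiteness)]
          exact add_le_add hcb' (mul_le_mul_left hcon O)
  have hfin : ∀ n m, En (S + 1) 1 (fun x => ‖f n x - f m x‖ₑ) ≠ ⊤ := by
    intro n m
    have := hδt n
    have := hδt m
    exact ((hmain n m).trans_lt (by finiteness)).ne
  have hcau : Tendsto (fun nm : ℕ × ℕ => En (S + 1) 1 (fun x => ‖f nm.1 x - f nm.2 x‖ₑ))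
      atTop (𝓝 0) := by
    have h1 : Tendsto (fun nm : ℕ × ℕ => δ nm.1 + δ nm.2) atTop (𝓝 0) := by
      have := (hδ0.comp (tendsto_fst (f := atTop) (g := (atTop : Filter ℕ)))).add
        (hδ0.comp (tendsto_snd (f := (atTop : Filter ℕ)) (g := atTop)))
      rw [prod_atTop_atTop_eq] at this
      simpa using this
    have h2 : Tendsto (fun nm : ℕ × ℕ => ‖α nm.1 - α nm.2‖ₑ) atTop (𝓝 0) := by
      have h3 := cauchySeq_iff_tendsto_dist_atTop_0.1 hαc
      have h4 := ENNReal.tendsto_ofReal h3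
      rw [ENNReal.ofReal_zero] at h4
      refine h4.congr fun nm => ?_
      rw [dist_eq_norm, ofReal_norm]
    have h5 : Tendsto (fun nm : ℕ × ℕ => C * (δ nm.1 + δ nm.2)) atTop (𝓝 0) := by
      simpa using ENNReal.Tendsto.const_mul h1 (Or.inr hC)
    have h6 : Tendsto (fun nm : ℕ × ℕ => D * (C * (δ nm.1 + δ nm.2))) atTop (𝓝 0) := by
      simpa using ENNReal.Tendsto.const_mul h5 (Or.inr hD)
    have h7 : Tendsto (fun nm : ℕ × ℕ => C * (δ nm.1 + δ nm.2) +
        (‖α nm.1 - α nm.2‖ₑ + D * (C * (δ nm.1 + δ nm.2))) * O) atTop (𝓝 0) := by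
      have := h5.add (ENNReal.Tendsto.mul_const (h2.add h6) (b := O) (Or.inr hOt))
      simpa using this
    exact tendsto_of_tendsto_of_tendsto_of_le_of_le tendsto_const_nhds h7 (fun _ => zero_le)
      (fun nm => hmain nm.1 nm.2)
  obtain ⟨F, hFl, hF⟩ := complete_wt (S + 1) (fun n => (hfs n).continuous) hfin hcau
  refine ⟨F, hu, hFl, fun φ ha hb' => ?_⟩
  have tφ : TF φ := ⟨ha, hb'⟩
  have l1 := test_tendsto (S + 1) tφ (fun n => (hfs n).continuous.locallyIntegrable) hFl hF
  have l2 := (mol_test_tendsto hu (tφ.pderivList l)).const_mul ((-1 : ℝ) ^ l.length)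
  have l3 := tendsto_nhds_unique (l1.congr fun n => hfφ n tφ) l2
  rw [l3, ← mul_assoc, ← mul_pow]
  simp



theorem En_anti {N : ℕ} {s s' p : ℝ} (hp : 0 ≤ p) (h : s ≤ s') (F : Euc N → ℝ≥0∞) :
    En s' p F ≤ En s p F := by
  unfold En
  apply lintegral_mono; intro x; beta_reduce
  refine mul_le_mul_left (ENNReal.ofReal_le_ofReal ?_) _
  apply Real.rpow_le_rpow_of_exponent_le
  · linarith [norm_nonneg x]
  · nlinarith

theorem En_one_top {N : ℕ} (hN : 1 ≤ N) {t : ℝ} (ht : t < 0) :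
    En (N := N) t 1 (fun _ => 1) = ⊤ := by
  have hN' : (1 : ℝ) ≤ N := by exact_mod_cast hN
  set τ := max t (-N) with hτ
  have hτ0 : τ < 0 := by rw [hτ]; exact max_lt ht (by linarith)
  have hτN : -τ - N ≤ 0 := by have := le_max_right t (-(N : ℝ)); linarith
  have h1 : En (N := N) τ 1 (fun _ => 1) ≤ En (N := N) t 1 (fun _ => 1) :=
    En_anti zero_le_one (le_max_left _ _) _
  refine top_le_iff.1 (le_trans ?_ h1)
  set v := (volume (ball (0 : Euc N) 1)) with hv
  have hv0 : v ≠ 0 := (measure_ball_pos volume _ one_pos).ne'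
  have key : ∀ R : ℝ, 1 ≤ R → ENNReal.ofReal ((2 : ℝ) ^ (-(N : ℝ)) * (1 + R) ^ (-τ)) * v ≤
      En (N := N) τ 1 (fun _ => 1) := by
    intro R hR
    calc ENNReal.ofReal ((2 : ℝ) ^ (-(N : ℝ)) * (1 + R) ^ (-τ)) * v
        ≤ ENNReal.ofReal ((1 + R) ^ (-τ - N)) * volume (closedBall (0 : Euc N) R) := by
          rw [Measure.addHaar_closedBall _ _ (by linarith), ← mul_assoc,
            ← ENNReal.ofReal_mul (by positivity)]
          refine mul_le_mul_left (ENNReal.ofReal_le_ofReal ?_) _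
          rw [finrank_euclideanSpace, Fintype.card_fin, sub_eq_add_neg, Real.rpow_add (by linarith)]
          have : ((2 : ℝ) ^ (-(N : ℝ))) ≤ (1 + R) ^ (-(N : ℝ)) * R ^ N := by
            rw [Real.rpow_neg (by norm_num), Real.rpow_neg (by linarith), Real.rpow_natCast,
              Real.rpow_natCast, inv_mul_eq_div, le_div_iff₀ (by positivity), inv_mul_le_iff₀ (by positivity),
              ← mul_pow]
            gcongr; linarith
          have h2 : 0 ≤ (1 + R) ^ (-τ) := by positivity
          nlinarith
      _ = ∫⁻ x in closedBall (0 : Euc N) R, ENNReal.ofReal ((1 + R) ^ (-τ - N)) := by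
          rw [setLIntegral_const]
      _ ≤ ∫⁻ x in closedBall (0 : Euc N) R, ENNReal.ofReal ((1 + ‖x‖) ^ (-τ - N)) := by
          apply setLIntegral_mono' measurableSet_closedBall
          intro x hx
          apply ENNReal.ofReal_le_ofReal
          apply Real.rpow_le_rpow_of_nonpos (by positivity) _ hτN
          rw [mem_closedBall_zero_iff] at hx
          linarith
      _ ≤ ∫⁻ x, ENNReal.ofReal ((1 + ‖x‖) ^ (-τ - N)) := setLIntegral_le_lintegral _ _
      _ = _ := by rw [En_one_eq]; simp
  have hlim : Tendsto (fun R : ℝ => ENNReal.ofReal ((2 : ℝ) ^ (-(N : ℝ)) * (1 + R) ^ (-τ)) * v)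
      atTop (𝓝 ⊤) := by
    have h3 : Tendsto (fun R : ℝ => (2 : ℝ) ^ (-(N : ℝ)) * (1 + R) ^ (-τ)) atTop atTop := by
      apply Tendsto.const_mul_atTop (by positivity)
      exact (tendsto_rpow_atTop (by linarith)).comp (tendsto_atTop_add_const_left _ _ tendsto_id)
    have h4 := ENNReal.tendsto_ofReal_atTop.comp h3
    have := ENNReal.Tendsto.mul_const h4 (b := v) (Or.inl (by simp))
    rwa [ENNReal.top_mul hv0] at this
  exact le_of_tendsto hlim (eventually_atTop.2 ⟨1, fun R hR => key R hR⟩)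

/-- constants that lie in a weighted space with negative exponent vanish -/
theorem const_zero_of_En {N : ℕ} (hN : 1 ≤ N) {t : ℝ} (ht : t < 0) {c : ℝ}
    (h : En (N := N) t 1 (fun _ => ‖c‖ₑ) ≠ ⊤) : c = 0 := by
  by_contra hc
  rw [En_one_mul_const _ _ (by finiteness), En_one_top hN ht] at h
  exact h (ENNReal.mul_top (by simpa using hc))

/-- normalization -/
def Nrm {N : ℕ} (neg : Prop) (f : Euc N → ℝ) : Prop :=
  (neg → ∃ τ < 0, En (N := N) τ 1 (fun x => ‖f x‖ₑ) ≠ ⊤) ∧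
  (¬ neg → ∫ x, f x * et N 0 x = 0)

theorem Nrm.congr {N : ℕ} {b : Prop} {f g : Euc N → ℝ} (hf : Nrm b f) (h : f =ᵐ[volume] g) :
    Nrm b g := by
  refine ⟨fun hb => ?_, fun hb => ?_⟩
  · obtain ⟨τ, h1, h2⟩ := hf.1 hb
    refine ⟨τ, h1, ?_⟩
    refine ((En_mono zero_le_one ?_).trans_lt h2.lt_top).ne
    filter_upwards [h] with x hx
    rw [hx]
  · rw [← hf.2 hb]
    apply integral_congr_ae
    filter_upwards [h] with x hx
    rw [hx]

theorem integral_sub_const_et {N : ℕ} {f : Euc N → ℝ} (hf : LocallyIntegrable f volume) (c : ℝ) :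
    ∫ x, (f x - c) * et N 0 x = (∫ x, f x * et N 0 x) - c := by
  have h1 := integrable_mul_TF hf (et_TF N 0)
  have h2 : Integrable (fun x => c * et N 0 x) volume :=
    integrable_mul_TF continuous_const.locallyIntegrable (et_TF N 0)
  simp only [sub_mul]
  rw [integral_sub h1 h2, integral_const_mul, et_integral, mul_one]

theorem Nrm.unique {N : ℕ} (hN : 1 ≤ N) {b : Prop} {f : Euc N → ℝ} {c d : ℝ}
    (hl : LocallyIntegrable f volume) (hf : Nrm b (fun x => f x - c)) (hg : Nrm b (fun x => f x - d)) :
    c = d := by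
  by_cases hb : b
  · obtain ⟨τ, h1, h2⟩ := hf.1 hb
    obtain ⟨τ', h1', h2'⟩ := hg.1 hb
    have h3 : max τ τ' < 0 := max_lt h1 h1'
    have : c - d = 0 := by
      apply const_zero_of_En hN h3
      refine ((En_mono (G := fun x => ‖f x - d‖ₑ + ‖f x - c‖ₑ) zero_le_one (ae_of_all _ fun x => ?_)).trans_lt
        ((En_one_add_le _ ?_).trans_lt (ENNReal.add_lt_top.2
          ⟨(En_anti zero_le_one (le_max_right _ _) _).trans_lt h2'.lt_top,
            (En_anti zero_le_one (le_max_left _ _) _).trans_lt h2.lt_top⟩))).ne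
      · rw [show c - d = (f x - d) - (f x - c) by ring]
        exact enorm_sub_le
      · exact (hl.aestronglyMeasurable.sub aestronglyMeasurable_const).enorm
    linarith
  · have h1 := hf.2 hb
    have h2 := hg.2 hb
    rw [integral_sub_const_et hl] at h1 h2
    linarith

theorem enorm_rpow_En_const {N : ℕ} {t r : ℝ} (hr : 0 ≤ r) (c : ℝ) :
    En (N := N) t r (fun _ => ‖c‖ₑ) = ‖c‖ₑ ^ r * En (N := N) t r (fun _ => 1) := by
  rw [← En_const_mul hr (by finiteness)]; simp

theorem ENNReal.rpow_ne_top_iff_aux {a : ℝ≥0∞} {r : ℝ} (hr : 0 < r) (h : a ^ r ≠ ⊤) : a ≠ ⊤ := by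
  rintro rfl
  exact h (ENNReal.top_rpow_of_pos hr)

theorem exists_norm_const {N : ℕ} {σ r : ℝ} (hr : 1 ≤ r) (hσ : σ ≠ -1) (hσN : σ < -1 → 1 < N)
    {f : Euc N → ℝ} {h : Fin N → Euc N → ℝ} (hf : LocallyIntegrable f volume)
    (hw : ∀ i, IsWeakPartialDeriv i f (h i)) (hE : ∑ i, En σ r (fun x => ‖h i x‖ₑ) ≠ ⊤) :
    ∃ c : ℝ, Nrm (σ < -1) (fun x => f x - c) := by
  by_cases hb : σ < -1
  · obtain ⟨C, hC, H⟩ := hardy_weak hr hσ hσN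
    obtain ⟨c, hc⟩ := H f h hf hw hE
    refine ⟨c, fun _ => ?_, fun h => absurd hb h⟩
    refine ⟨(σ + 1) / 2, by linarith, ?_⟩
    obtain ⟨D, hD, HD⟩ := En_embed (N := N) hr (by linarith : σ + 1 < (σ + 1) / 2)
    apply ENNReal.rpow_ne_top_iff_aux (by linarith : 0 < r)
    refine ((HD _ (hf.aestronglyMeasurable.sub aestronglyMeasurable_const).enorm).trans_lt ?_).ne
    exact ENNReal.mul_lt_top hD.lt_top (hc.trans_lt (by finiteness))
  · refine ⟨∫ x, f x * et N 0 x, fun h => absurd h hb, fun _ => ?_⟩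
    rw [integral_sub_const_et hf, sub_self]

theorem hardy_norm {N : ℕ} (hN : 1 ≤ N) {σ r : ℝ} (hr : 1 ≤ r) (hσ : σ ≠ -1) (hσN : σ < -1 → 1 < N) :
    ∃ K : ℝ≥0∞, K ≠ ⊤ ∧ ∀ (f : Euc N → ℝ) (h : Fin N → Euc N → ℝ), LocallyIntegrable f volume →
      (∀ i, IsWeakPartialDeriv i f (h i)) → ∑ i, En σ r (fun x => ‖h i x‖ₑ) ≠ ⊤ →
      Nrm (σ < -1) f → En (σ + 1) r (fun x => ‖f x‖ₑ) ≤ K * ∑ i, En σ r (fun x => ‖h i x‖ₑ) := by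
  obtain ⟨C, hC, H⟩ := hardy_weak hr hσ hσN
  have hr0 : 0 ≤ r := by linarith
  by_cases hb : σ < -1
  · refine ⟨C, hC, fun f h hf hw hE hn => ?_⟩
    obtain ⟨c, hc⟩ := H f h hf hw hE
    have h0 : Nrm (σ < -1) (fun x => f x - c) := by
      refine ⟨fun _ => ?_, fun h => absurd hb h⟩
      refine ⟨(σ + 1) / 2, by linarith, ?_⟩
      obtain ⟨D, hD, HD⟩ := En_embed (N := N) hr (by linarith : σ + 1 < (σ + 1) / 2)
      apply ENNReal.rpow_ne_top_iff_aux (by linarith : 0 < r)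
      refine ((HD _ (hf.aestronglyMeasurable.sub aestronglyMeasurable_const).enorm).trans_lt ?_).ne
      exact ENNReal.mul_lt_top hD.lt_top (hc.trans_lt (by finiteness))
    have h1 : Nrm (σ < -1) (fun x => f x - 0) := by simpa using hn
    rw [Nrm.unique hN hf h0 h1] at hc
    simpa using hc
  · have hσ' : -1 < σ := lt_of_le_of_ne (not_lt.1 hb) hσ.symm
    obtain ⟨D, hD, HD⟩ := En_embed (N := N) hr (by linarith : σ + 1 < σ + 2)
    obtain ⟨T, hT, HT⟩ := test_bound (N := N) (σ + 2) (et_TF N 0)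
    set O := En (N := N) (σ + 1) r (fun _ => 1) with hO
    have hOt : O ≠ ⊤ := En_one_ne_top (by linarith) (by linarith)
    refine ⟨2 ^ (r - 1) * (C + T ^ r * (D * C) * O), by finiteness, fun f h hf hw hE hn => ?_⟩
    obtain ⟨c, hc⟩ := H f h hf hw hE
    set B := ∑ i, En σ r (fun x => ‖h i x‖ₑ) with hB
    have hfm : AEMeasurable (fun x => ‖f x - c‖ₑ) volume :=
      (hf.aestronglyMeasurable.sub aestronglyMeasurable_const).enorm
    have hcb : ‖c‖ₑ ^ r ≤ T ^ r * (D * C) * B := by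
      have h1 := hn.2 hb
      have h2 := integral_sub_const_et hf c
      rw [h1, zero_sub] at h2
      have h3 : ‖c‖ₑ ≤ T * En (σ + 2) 1 (fun x => ‖f x - c‖ₑ) := by
        rw [← enorm_neg, ← h2]
        exact (enorm_integral_le_lintegral_enorm _).trans (HT _)
      calc ‖c‖ₑ ^ r ≤ (T * En (σ + 2) 1 (fun x => ‖f x - c‖ₑ)) ^ r := ENNReal.rpow_le_rpow h3 hr0
        _ = T ^ r * (En (σ + 2) 1 (fun x => ‖f x - c‖ₑ)) ^ r := ENNReal.mul_rpow_of_nonneg _ _ hr0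
        _ ≤ T ^ r * (D * (C * B)) := by
          refine mul_le_mul_right ((HD _ hfm).trans (mul_le_mul_right hc D)) _
        _ = _ := by ring
    calc En (σ + 1) r (fun x => ‖f x‖ₑ) ≤ En (σ + 1) r (fun x => ‖f x - c‖ₑ + ‖c‖ₑ) := by
          apply En_mono hr0 (ae_of_all _ fun x => ?_)
          calc ‖f x‖ₑ = ‖f x - c + c‖ₑ := by congr 1; ring
            _ ≤ _ := enorm_add_le _ _
      _ ≤ 2 ^ (r - 1) * (En (σ + 1) r (fun x => ‖f x - c‖ₑ) + En (N := N) (σ + 1) r (fun _ => ‖c‖ₑ)) :=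
          En_add_le hr hfm
      _ ≤ 2 ^ (r - 1) * (C * B + T ^ r * (D * C) * B * O) := by
          rw [enorm_rpow_En_const hr0]
          exact mul_le_mul_right (add_le_add hc (mul_le_mul_left hcb O)) _
      _ = _ := by ring

theorem sob_norm {N : ℕ} (hN : 1 ≤ N) {σ r q : ℝ} (hr : 1 ≤ r) (hrq : r ≤ q)
    (hq : r⁻¹ - q⁻¹ ≤ (N : ℝ)⁻¹) (hσ : σ ≠ -1) (hσN : σ < -1 → 1 < N) :
    ∃ K : ℝ≥0∞, K ≠ ⊤ ∧ ∀ (f : Euc N → ℝ) (h : Fin N → Euc N → ℝ), LocallyIntegrable f volume →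
      (∀ i, IsWeakPartialDeriv i f (h i)) → ∑ i, En σ r (fun x => ‖h i x‖ₑ) ≠ ⊤ →
      Nrm (σ < -1) f →
      En (σ + 1) q (fun x => ‖f x‖ₑ) ≤ K * (∑ i, En σ r (fun x => ‖h i x‖ₑ)) ^ (q / r) := by
  obtain ⟨C, hC, H⟩ := hardy_norm hN hr hσ hσN
  obtain ⟨D, hD, HD⟩ := sobolev_weak hN σ hr hrq hq
  have hqr : 0 ≤ q / r := by apply div_nonneg <;> linarith
  refine ⟨D * (C + 1) ^ (q / r), by finiteness, fun f h hf hw hE hn => ?_⟩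
  have h1 := H f h hf hw hE hn
  have h2 := lintegral_TW σ r hf.aestronglyMeasurable (fun i => (hw i).2.1.aestronglyMeasurable)
  set B := ∑ i, En σ r (fun x => ‖h i x‖ₑ) with hB
  have h3 : ∫⁻ x, TW σ r f h x ≤ (C + 1) * B := by
    rw [h2, add_mul, one_mul]; gcongr
  refine (HD f h hf hw (h3.trans_lt (by finiteness)).ne).trans ?_
  rw [mul_assoc, ← ENNReal.mul_rpow_of_nonneg _ _ hqr]
  gcongr

theorem sob_norm_inf {N : ℕ} (hN : 1 ≤ N) {σ r : ℝ} (hr : 1 ≤ r) (hrN : (N : ℝ) < r ∨ (r = 1 ∧ N = 1))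
    (hσ : σ ≠ -1) (hσN : σ < -1 → 1 < N) :
    ∃ K : ℝ≥0∞, K ≠ ⊤ ∧ ∀ (f : Euc N → ℝ) (h : Fin N → Euc N → ℝ), LocallyIntegrable f volume →
      (∀ i, IsWeakPartialDeriv i f (h i)) → ∑ i, En σ r (fun x => ‖h i x‖ₑ) ≠ ⊤ →
      Nrm (σ < -1) f →
      (∀ᵐ y, ENNReal.ofReal ((1 + ‖y‖) ^ (-(σ + 1) * r)) * ‖f y‖ₑ ^ r ≤
        K * ∑ i, En σ r (fun x => ‖h i x‖ₑ)) ∧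
      ∃ f' : Euc N → ℝ, f =ᵐ[volume] f' ∧
        Tendsto (fun x => ‖x‖ ^ (-(σ + 1)) * f' x) (cocompact (Euc N)) (𝓝 0) := by
  obtain ⟨C, hC, H⟩ := hardy_norm hN hr hσ hσN
  obtain ⟨D, hD, HD⟩ := sobolev_weak_pointwise (N := N) σ hr hrN
  refine ⟨D * (C + 1), by finiteness, fun f h hf hw hE hn => ?_⟩
  have h1 := H f h hf hw hE hn
  have h2 := lintegral_TW σ r hf.aestronglyMeasurable (fun i => (hw i).2.1.aestronglyMeasurable)
  set B := ∑ i, En σ r (fun x => ‖h i x‖ₑ) with hB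
  have h3 : ∫⁻ x, TW σ r f h x ≤ (C + 1) * B := by
    rw [h2, add_mul, one_mul]; gcongr
  have hfin : ∫⁻ x, TW σ r f h x ≠ ⊤ := (h3.trans_lt (by finiteness)).ne
  have hpt := HD f h hf hw hfin
  have hr0 : 0 < r := by linarith
  constructor
  · filter_upwards [hpt] with y hy
    refine hy.trans ?_
    rw [mul_assoc]
    exact mul_le_mul_right ((setLIntegral_le_lintegral _ _).trans h3) _
  · classical
    set tail : Euc N → ℝ≥0∞ := fun y => D * ∫⁻ x in {x | 3 * ‖y‖ - 5 ≤ 4 * ‖x‖}, TW σ r f h x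
      with htail
    set f' : Euc N → ℝ := fun y =>
      if ENNReal.ofReal ((1 + ‖y‖) ^ (-(σ + 1) * r)) * ‖f y‖ₑ ^ r ≤ tail y then f y else 0 with hf'
    refine ⟨f', ?_, ?_⟩
    · filter_upwards [hpt] with y hy
      rw [hf']; simp only
      rw [if_pos hy]
    · have hb : ∀ y, ENNReal.ofReal ((1 + ‖y‖) ^ (-(σ + 1) * r)) * ‖f' y‖ₑ ^ r ≤ tail y := by
        intro y
        rw [hf']; simp only
        split_ifs with hy
        · exact hy
        · simp [ENNReal.zero_rpow_of_pos hr0]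
      have htl : Tendsto tail (cocompact (Euc N)) (𝓝 0) := by
        have hm : ∀ R : ℝ, MeasurableSet {x : Euc N | R ≤ ‖x‖} := fun R =>
          measurableSet_le measurable_const measurable_norm
        have hanti : Tendsto (fun R : ℝ => ∫⁻ x in {x : Euc N | R ≤ ‖x‖}, TW σ r f h x) atTop (𝓝 0) := by
          set ν := (volume : Measure (Euc N)).withDensity (fun x => TW σ r f h x) with hν
          have h4 := tendsto_measure_iInter_atTop (μ := ν) (s := fun R : ℝ => {x : Euc N | R ≤ ‖x‖})
            (fun R => (hm R).nullMeasurableSet) (fun R R' hR x hx => le_trans hR hx) ⟨0, by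
              refine ((measure_mono (Set.subset_univ _)).trans_lt ?_).ne
              rw [hν, withDensity_apply _ .univ, Measure.restrict_univ]
              exact hfin.lt_top⟩
          have h5 : (⋂ R : ℝ, {x : Euc N | R ≤ ‖x‖}) = ∅ := by
            ext x
            simp only [Set.mem_iInter, Set.mem_ofPred_eq, Set.mem_empty_iff_false, iff_false, not_forall,
              not_le]
            exact ⟨‖x‖ + 1, by linarith⟩
          rw [h5, measure_empty] at h4
          refine h4.congr fun R => ?_
          simp only [Function.comp_apply]
          rw [hν, withDensity_apply _ (hm R)]
        have h6 : Tendsto (fun y : Euc N => (3 * ‖y‖ - 5) / 4) (cocompact (Euc N)) atTop := by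
          have h7 := tendsto_norm_cocompact_atTop (E := Euc N)
          have h8 : Tendsto (fun t : ℝ => (3 * t - 5) / 4) atTop atTop := by
            apply Tendsto.atTop_div_const (by norm_num)
            apply tendsto_atTop_add_const_right
            exact tendsto_id.const_mul_atTop (by norm_num)
          exact h8.comp h7
        have h9 := ENNReal.Tendsto.const_mul (hanti.comp h6) (a := D) (Or.inr hD)
        rw [mul_zero] at h9
        refine h9.congr fun y => ?_
        rw [htail]; simp only [Function.comp_apply]
        congr 3
        ext x
        simp only [Set.mem_ofPred_eq]
        constructor <;> intro <;> linarith
      have hlim : Tendsto (fun y => ENNReal.ofReal (2 ^ |-(σ + 1)|) * tail y ^ (1 / r))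
          (cocompact (Euc N)) (𝓝 0) := by
        have h10 : Tendsto (fun y => tail y ^ (1 / r)) (cocompact (Euc N)) (𝓝 0) := by
          have := (ENNReal.continuous_rpow_const (y := 1 / r)).tendsto (0 : ℝ≥0∞)
          rw [ENNReal.zero_rpow_of_pos (by positivity)] at this
          exact this.comp htl
        have := ENNReal.Tendsto.const_mul h10 (a := ENNReal.ofReal (2 ^ |-(σ + 1)|)) (Or.inr (by finiteness))
        simpa using this
      rw [tendsto_zero_iff_norm_tendsto_zero, ← ENNReal.toReal_zero]
      have hlim2 : Tendsto (fun x => ‖‖x‖ ^ (-(σ + 1)) * f' x‖ₑ) (cocompact (Euc N)) (𝓝 0) := by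
        refine tendsto_of_tendsto_of_tendsto_of_le_of_le' tendsto_const_nhds hlim
          (Eventually.of_forall fun _ => zero_le) ?_
        filter_upwards [(tendsto_norm_cocompact_atTop (E := Euc N)).eventually_ge_atTop 1] with y hy
        have e1 : ‖y‖ ^ (-(σ + 1)) ≤ 2 ^ |-(σ + 1)| * (1 + ‖y‖) ^ (-(σ + 1)) :=
          rpow_comparable (by linarith) (by linarith) (by norm_num) (by linarith) (by linarith) _
        have e2 : ENNReal.ofReal ((1 + ‖y‖) ^ (-(σ + 1))) * ‖f' y‖ₑ ≤ tail y ^ (1 / r) := by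
          rw [one_div, ENNReal.le_rpow_inv_iff hr0, ENNReal.mul_rpow_of_nonneg _ _ hr0.le,
            ENNReal.ofReal_rpow_of_nonneg (by positivity) hr0.le, ← Real.rpow_mul (by positivity)]
          exact hb y
        rw [enorm_mul, ← ofReal_norm (‖y‖ ^ (-(σ + 1))), Real.norm_of_nonneg (by positivity)]
        calc _ ≤ ENNReal.ofReal (2 ^ |-(σ + 1)| * (1 + ‖y‖) ^ (-(σ + 1))) * ‖f' y‖ₑ :=
              mul_le_mul_left (ENNReal.ofReal_le_ofReal e1) _
          _ = ENNReal.ofReal (2 ^ |-(σ + 1)|) * (ENNReal.ofReal ((1 + ‖y‖) ^ (-(σ + 1))) * ‖f' y‖ₑ) := by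
              rw [ENNReal.ofReal_mul (by positivity), mul_assoc]
          _ ≤ _ := mul_le_mul_right e2 _
      have := (ENNReal.tendsto_toReal (by simp : (0 : ℝ≥0∞) ≠ ⊤)).comp hlim2
      refine this.congr fun x => ?_
      simp



theorem polyEval_smooth {N : ℕ} (π : MvPolynomial (Fin N) ℝ) : ContDiff ℝ (⊤ : ℕ∞) (polyEval π) := by
  induction π using MvPolynomial.induction_on with
  | C a =>
    have : polyEval (N := N) (MvPolynomial.C a) = fun _ => a := by
      ext x; simp [polyEval]
    rw [this]; exact contDiff_const
  | add p q hp hq =>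
    have : polyEval (p + q) = fun x => polyEval p x + polyEval q x := by
      ext x; simp [polyEval]
    rw [this]; exact hp.add hq
  | mul_X p i hp =>
    have : polyEval (p * MvPolynomial.X i) = fun x => polyEval p x * x i := by
      ext x; simp [polyEval]
    rw [this]; exact hp.mul (by fun_prop)

theorem pd_add {N : ℕ} (i : Fin N) {f g : Euc N → ℝ} (hf : ContDiff ℝ (⊤ : ℕ∞) f)
    (hg : ContDiff ℝ (⊤ : ℕ∞) g) : pd i (fun x => f x + g x) = fun x => pd i f x + pd i g x := by
  ext x
  simp only [pd]
  rw [fderiv_fun_add (hf.differentiable (by simp) x) (hg.differentiable (by simp) x)]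
  rfl

theorem pd_coord {N : ℕ} (i j : Fin N) (x : Euc N) :
    pd i (fun x : Euc N => x j) x = if j = i then 1 else 0 := by
  simp only [pd]
  have h : HasFDerivAt (fun x : Euc N => x j) (EuclideanSpace.proj j : Euc N →L[ℝ] ℝ) x :=
    (EuclideanSpace.proj j : Euc N →L[ℝ] ℝ).hasFDerivAt
  rw [h.fderiv]
  simp

theorem pd_polyEval {N : ℕ} (i : Fin N) (π : MvPolynomial (Fin N) ℝ) :
    pd i (polyEval π) = polyEval (MvPolynomial.pderiv i π) := by
  induction π using MvPolynomial.induction_on with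
  | C a =>
    have : polyEval (N := N) (MvPolynomial.C a) = fun _ => a := by
      ext x; simp [polyEval]
    rw [this]; ext x; simp [pd, polyEval]
  | add p q hp hq =>
    have : polyEval (p + q) = fun x => polyEval p x + polyEval q x := by
      ext x; simp [polyEval]
    rw [this, pd_add i (polyEval_smooth p) (polyEval_smooth q), hp, hq]
    ext x; simp [polyEval]
  | mul_X p j hp =>
    have : polyEval (p * MvPolynomial.X j) = fun x => polyEval p x * x j := by
      ext x; simp [polyEval]
    rw [this]
    ext x
    have hc : ContDiff ℝ (⊤ : ℕ∞) (fun x : Euc N => x j) := by fun_prop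
    have h1 := fderiv_fun_mul ((polyEval_smooth p).differentiable (by simp) x)
      (hc.differentiable (by simp) x)
    have h2 := pd_coord i j x
    have h3 : pd i (polyEval p) x = _ := congrFun hp x
    simp only [pd] at h2 h3 ⊢
    rw [h1]
    simp only [ContinuousLinearMap.add_apply, ContinuousLinearMap.smul_apply, smul_eq_mul]
    rw [h2, h3]
    simp only [polyEval, MvPolynomial.pderiv_mul, map_add, map_mul, MvPolynomial.eval_X,
      MvPolynomial.pderiv_X]
    by_cases hij : j = i
    · subst hij; simp; ring
    · simp [hij, mul_comm]

/-- iterated formal derivative -/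
def pdl {N : ℕ} : List (Fin N) → MvPolynomial (Fin N) ℝ → MvPolynomial (Fin N) ℝ
  | [], π => π
  | i :: l, π => pdl l (MvPolynomial.pderiv i π)

theorem pderivList_polyEval {N : ℕ} (l : List (Fin N)) (π : MvPolynomial (Fin N) ℝ) :
    pderivList l (polyEval π) = polyEval (pdl l π) := by
  induction l generalizing π with
  | nil => rfl
  | cons i l ih => rw [pderivList_cons, pd_polyEval, ih]; rfl

theorem pdl_zero {N : ℕ} (l : List (Fin N)) : pdl l 0 = 0 := by
  induction l with
  | nil => rfl
  | cons i l ih => simp [pdl, ih]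

theorem pdl_eq_zero_aux {N : ℕ} (l : List (Fin N)) (π : MvPolynomial (Fin N) ℝ)
    (h : ∀ m : Fin N →₀ ℕ, l.length ≤ m.degree → π.coeff m = 0) : pdl l π = 0 := by
  induction l generalizing π with
  | nil => ext m; simpa [pdl] using h m (by simp)
  | cons i l ih =>
    apply ih
    intro m hm
    rw [MvPolynomial.coeff_pderiv, h, zero_mul]
    simpa using hm

theorem pdl_eq_zero {N : ℕ} (l : List (Fin N)) (π : MvPolynomial (Fin N) ℝ)
    (h : π.totalDegree < l.length) : pdl l π = 0 := by
  apply pdl_eq_zero_aux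
  intro m hm
  apply MvPolynomial.coeff_eq_zero_of_totalDegree_lt
  exact lt_of_lt_of_le h hm

/-- homogeneous polynomial with prescribed symmetric derivatives -/
def hpol {N : ℕ} : ℕ → (List (Fin N) → ℝ) → MvPolynomial (Fin N) ℝ
  | 0, c => MvPolynomial.C (c [])
  | r + 1, c => MvPolynomial.C ((r + 1 : ℝ)⁻¹) * ∑ i, MvPolynomial.X i * hpol r (fun l => c (i :: l))

theorem hpol_degree {N : ℕ} (r : ℕ) (c : List (Fin N) → ℝ) : (hpol r c).totalDegree ≤ r := by
  induction r generalizing c with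
  | zero => simp [hpol]
  | succ r ih =>
    rw [hpol]
    refine (MvPolynomial.totalDegree_mul _ _).trans ?_
    rw [MvPolynomial.totalDegree_C, zero_add]
    refine MvPolynomial.totalDegree_finsetSum_le fun i _ => ?_
    refine (MvPolynomial.totalDegree_mul _ _).trans ?_
    rw [MvPolynomial.totalDegree_X, add_comm]
    exact Nat.succ_le_succ (ih _)

theorem pderiv_hpol {N : ℕ} (j : Fin N) (r : ℕ) (c : List (Fin N) → ℝ)
    (hc : ∀ l l' : List (Fin N), l.Perm l' → c l = c l') :
    MvPolynomial.pderiv j (hpol (r + 1) c) = hpol r (fun l => c (j :: l)) := by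
  induction r generalizing c with
  | zero =>
    simp only [hpol, MvPolynomial.pderiv_C_mul, map_sum, MvPolynomial.pderiv_mul,
      MvPolynomial.pderiv_X, MvPolynomial.pderiv_C]
    simp [Pi.single_apply]
  | succ r ih =>
    have h1 : ∀ i : Fin N, MvPolynomial.pderiv j (hpol (r + 1) (fun l => c (i :: l))) =
        hpol r (fun l => c (j :: i :: l)) := by
      intro i
      rw [ih (fun l => c (i :: l)) (fun l l' h => hc _ _ (h.cons i))]
      congr 1; ext l
      exact hc _ _ (List.Perm.swap _ _ _)
    rw [hpol, MvPolynomial.pderiv_C_mul, map_sum]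
    simp only [MvPolynomial.pderiv_mul, h1]
    rw [Finset.sum_add_distrib]
    have h2 : ∑ i, MvPolynomial.X i * hpol r (fun l => c (j :: i :: l)) =
        MvPolynomial.C ((r : ℝ) + 1) * hpol (r + 1) (fun l => c (j :: l)) := by
      rw [hpol, ← mul_assoc, ← map_mul, mul_inv_cancel₀ (by positivity), map_one, one_mul]
    have h3 : ∑ i, MvPolynomial.pderiv j (MvPolynomial.X i) * hpol (r + 1) (fun l => c (i :: l)) =
        hpol (r + 1) (fun l => c (j :: l)) := by
      simp [MvPolynomial.pderiv_X, Pi.single_apply]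
    rw [h2, h3]
    have h4 : ∀ q : MvPolynomial (Fin N) ℝ, q + MvPolynomial.C ((r : ℝ) + 1) * q =
        MvPolynomial.C ((r : ℝ) + 1 + 1) * q := by
      intro q
      rw [map_add _ ((r : ℝ) + 1), map_one]; ring
    rw [h4, ← mul_assoc, ← map_mul]
    push_cast
    rw [inv_mul_cancel₀ (by positivity), map_one, one_mul]

theorem pdl_hpol {N : ℕ} (l : List (Fin N)) (c : List (Fin N) → ℝ)
    (hc : ∀ l l' : List (Fin N), l.Perm l' → c l = c l') :
    pdl l (hpol l.length c) = MvPolynomial.C (c l) := by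
  induction l generalizing c with
  | nil => rfl
  | cons i l ih =>
    rw [pdl, List.length_cons, pderiv_hpol i _ c hc, ih _ (fun l l' h => hc _ _ (h.cons i))]

/-- translation -/
theorem En_translate {N : ℕ} (t : ℝ) (h : Euc N) : ∃ K : ℝ≥0∞, K ≠ ⊤ ∧ ∀ F : Euc N → ℝ≥0∞,
    En t 1 (fun x => F (x + h)) ≤ K * En t 1 F := by
  refine ⟨ENNReal.ofReal ((1 + ‖h‖) ^ |-t - N|), by finiteness, fun F => ?_⟩
  rw [En_one_eq, En_one_eq]
  rw [← lintegral_const_mul' _ _ (by finiteness),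
    ← lintegral_add_right_eq_self (μ := volume) (fun x : Euc N => ENNReal.ofReal ((1 + ‖h‖) ^ |-t - N|) *
      (ENNReal.ofReal ((1 + ‖x‖) ^ (-t - N)) * F x)) h]
  apply lintegral_mono; intro x; beta_reduce
  rw [← mul_assoc, ← ENNReal.ofReal_mul (by positivity)]
  refine mul_le_mul_left (ENNReal.ofReal_le_ofReal ?_) _
  have h1 := norm_add_le x h
  have h2 : ‖x‖ ≤ ‖x + h‖ + ‖h‖ := by
    have := norm_sub_le (x + h) h
    rwa [add_sub_cancel_right] at this
  have h3 := norm_nonneg h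
  have h4 := norm_nonneg x
  have h5 := norm_nonneg (x + h)
  exact rpow_comparable (by positivity) (by positivity) (by linarith) (by nlinarith) (by nlinarith) _

theorem pd_shift_sub {N : ℕ} (i : Fin N) {f : Euc N → ℝ} (hf : ContDiff ℝ (⊤ : ℕ∞) f) (h : Euc N) :
    pd i (fun x => f (x + h) - f x) = fun x => pd i f (x + h) - pd i f x := by
  ext x
  simp only [pd]
  have h0 : DifferentiableAt ℝ (fun x => f (x + h)) x :=
    (hf.differentiable (by simp) (x + h)).comp x (by fun_prop)
  rw [fderiv_fun_sub h0 (hf.differentiable (by simp) x), fderiv_comp_add_right]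
  rfl

theorem pderivList_shift_sub {N : ℕ} (l : List (Fin N)) {f : Euc N → ℝ} (hf : ContDiff ℝ (⊤ : ℕ∞) f)
    (h : Euc N) :
    pderivList l (fun x => f (x + h) - f x) = fun x => pderivList l f (x + h) - pderivList l f x := by
  induction l generalizing f with
  | nil => rfl
  | cons i l ih =>
    rw [pderivList_cons, pd_shift_sub i hf, ih (pd_smooth i hf)]; rfl

theorem smooth_zero_of_En {N : ℕ} (hN : 1 ≤ N) {t : ℝ} (ht : t < 0) (k : ℕ) {f : Euc N → ℝ}
    (hf : ContDiff ℝ (⊤ : ℕ∞) f) (hk : ∀ l : List (Fin N), l.length = k → pderivList l f = fun _ => 0)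
    (hE : En t 1 (fun x => ‖f x‖ₑ) ≠ ⊤) : f = fun _ => 0 := by
  induction k generalizing f with
  | zero => exact hk [] rfl
  | succ k ih =>
    have hd : ∀ h : Euc N, (fun x => f (x + h) - f x) = fun _ => 0 := by
      intro h
      have hsm : ContDiff ℝ (⊤ : ℕ∞) (fun x => f (x + h)) := hf.comp (by fun_prop)
      apply ih (hsm.sub hf)
      · intro l hl
        rw [pderivList_shift_sub l hf h]
        ext x
        have hz : ∀ y, fderiv ℝ (pderivList l f) y = 0 := by
          intro y
          have h1 := enorm_fderiv_le (pderivList l f) y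
          have h2 : ∀ i, pd i (pderivList l f) y = 0 := by
            intro i
            rw [pd_pderivList i l hf, hk _ (by simp [hl])]
          simp only [h2] at h1
          have h3 : ‖fderiv ℝ (pderivList l f) y‖ₑ = 0 := by simpa using h1
          rw [← ofReal_norm, ENNReal.ofReal_eq_zero] at h3
          exact norm_le_zero_iff.1 h3
        have := is_const_of_fderiv_eq_zero ((pderivList_smooth l hf).differentiable (by simp)) hz (x + h) x
        rw [this, sub_self]
      · obtain ⟨K, hK, H⟩ := En_translate t h
        refine ((En_mono zero_le_one (ae_of_all _ fun x => enorm_sub_le)).trans_lt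
          ((En_one_add_le t ?_).trans_lt (ENNReal.add_lt_top.2 ⟨?_, hE.lt_top⟩))).ne
        · exact hsm.continuous.aestronglyMeasurable.enorm
        · exact (H fun x => ‖f x‖ₑ).trans_lt (ENNReal.mul_lt_top hK.lt_top hE.lt_top)
    have hc : f = fun _ => f 0 := by
      ext x
      have := congrFun (hd x) 0
      simp only [zero_add] at this
      linarith
    have h0 : f 0 = 0 := by
      apply const_zero_of_En hN ht
      rw [hc] at hE
      exact hE
    rw [hc, h0]



/-- the normalization property of the polynomial -/
def GoodP {N : ℕ} (k : ℕ) (b : ℕ → Prop) (u : Euc N → ℝ) (π : MvPolynomial (Fin N) ℝ) : Prop :=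
  π.totalDegree ≤ k - 1 ∧ ∀ j : ℕ, 1 ≤ j → ∀ l : List (Fin N), l.length + j = k →
    ∃ f, IsWeakDerivList l (fun x => u x - polyEval π x) f ∧ Nrm (b j) f

theorem isWeakDerivList_poly_sub {N : ℕ} {l : List (Fin N)} {u f : Euc N → ℝ}
    {π ρ : MvPolynomial (Fin N) ℝ} {c : ℝ}
    (h : IsWeakDerivList l (fun x => u x - polyEval π x) f) (hρ : pdl l ρ = MvPolynomial.C c) :
    IsWeakDerivList l (fun x => u x - polyEval (π + ρ) x) (fun x => f x - c) := by
  have h1 := isWeakDerivList_smooth l (polyEval_smooth ρ)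
  rw [pderivList_polyEval, hρ] at h1
  have h2 := h.sub h1
  convert h2 using 2
  · simp [polyEval]; ring
  · simp [polyEval]

theorem exists_good {N : ℕ} (hN : 1 ≤ N) {k : ℕ} {s p : ℝ} (hp : 1 ≤ p) {b : ℕ → Prop}
    (hb : ∀ j < k, (b (j + 1) ↔ s + j < -1)) (hs : ∀ j < k, s + (j : ℕ) ≠ -1) (hsN : s < -1 → 1 < N)
    {u : Euc N → ℝ} (hu : LocallyIntegrable u volume)
    (hg : ∀ l : List (Fin N), l.length = k → ∃ f, IsWeakDerivList l u f ∧
      En s p (fun x => ‖f x‖ₑ) ≠ ⊤) : ∃ π, GoodP k b u π := by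
  have claim : ∀ n ≤ k, ∃ π : MvPolynomial (Fin N) ℝ, π.totalDegree ≤ k - 1 ∧ ∀ j ≤ n,
      ∀ l : List (Fin N), l.length + j = k → ∃ f, IsWeakDerivList l (fun x => u x - polyEval π x) f ∧
        (1 ≤ j → Nrm (b j) f) ∧ En (s + j) p (fun x => ‖f x‖ₑ) ≠ ⊤ := by
    intro n
    induction n with
    | zero =>
      intro _
      refine ⟨0, by simp, fun j hj l hl => ?_⟩
      obtain rfl : j = 0 := by omega
      obtain ⟨f, h1, h2⟩ := hg l hl
      refine ⟨f, ?_, by omega, by simpa using h2⟩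
      convert h1 using 2
      simp [polyEval]
    | succ n ih =>
      intro hn
      obtain ⟨π, hπ, H⟩ := ih (by omega)
      have hul : LocallyIntegrable (fun x => u x - polyEval π x) volume :=
        hu.sub (polyEval_smooth π).continuous.locallyIntegrable
      have hσN : s + n < -1 → 1 < N := fun h => hsN (by
        have : (0 : ℝ) ≤ n := n.cast_nonneg
        linarith)
      have step : ∀ l : List (Fin N), l.length + (n + 1) = k → ∃ (c : ℝ) (f : Euc N → ℝ),
          IsWeakDerivList l (fun x => u x - polyEval π x) f ∧ Nrm (b (n + 1)) (fun x => f x - c) := by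
        intro l hl
        choose h hh1 _ hh3 using fun i : Fin N => H n le_rfl (i :: l) (by simp; omega)
        have hS1 := le_max_left (s + n) (-1)
        have hS2 := le_max_right (s + n) (-1)
        obtain ⟨D, hD, HD⟩ := En_embed (N := N) hp (by linarith : s + n < max (s + n) (-1) + 1)
        obtain ⟨f, hf⟩ := exists_lower (S := max (s + n) (-1) + 1) (by linarith) l hul hh1 (by
          intro i
          apply ENNReal.rpow_ne_top_iff_aux (by linarith : 0 < p)
          refine ((HD _ (hh1 i).2.1.aestronglyMeasurable.enorm).trans_lt ?_).ne
          exact ENNReal.mul_lt_top hD.lt_top (hh3 i).lt_top)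
        obtain ⟨c, hc⟩ := exists_norm_const hp (hs n (by omega)) hσN hf.2.1
          (fun i => isWeakPartialDeriv_of hf (hh1 i)) (ENNReal.sum_ne_top.2 fun i _ => hh3 i)
        refine ⟨c, f, hf, ?_⟩
        rw [hb n (by omega)]
        exact hc
      classical
      set cc : List (Fin N) → ℝ := fun l =>
        if h : l.length + (n + 1) = k then Classical.choose (step l h) else 0 with hcc
      have hspec : ∀ l : List (Fin N), l.length + (n + 1) = k → ∃ f : Euc N → ℝ,
          IsWeakDerivList l (fun x => u x - polyEval π x) f ∧ Nrm (b (n + 1)) (fun x => f x - cc l) := by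
        intro l hl
        have : cc l = Classical.choose (step l hl) := by rw [hcc]; simp only; rw [dif_pos hl]
        rw [this]
        exact Classical.choose_spec (step l hl)
      have hperm : ∀ l l' : List (Fin N), l.Perm l' → cc l = cc l' := by
        intro l l' hl
        by_cases h : l.length + (n + 1) = k
        · obtain ⟨f, h1, h2⟩ := hspec l h
          obtain ⟨f', h1', h2'⟩ := hspec l' (by rw [← hl.length_eq]; exact h)
          have h3 : f' =ᵐ[volume] f := h1'.unique (h1.perm hl)
          refine Nrm.unique hN h1.2.1 h2 (h2'.congr ?_)
          filter_upwards [h3] with x hx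
          rw [hx]
        · rw [hcc]; simp only
          rw [dif_neg h, dif_neg (by rw [← hl.length_eq]; exact h)]
      set r := k - (n + 1) with hr
      have hdeg : ∀ l : List (Fin N), r < l.length → pdl l (hpol r cc) = MvPolynomial.C 0 := by
        intro l hl
        rw [pdl_eq_zero l _ (lt_of_le_of_lt (hpol_degree r cc) hl), map_zero]
      refine ⟨π + hpol r cc, ?_, fun j hj l hl => ?_⟩
      · refine (MvPolynomial.totalDegree_add _ _).trans (max_le hπ ((hpol_degree r cc).trans ?_))
        omega
      have hlow : ∀ j ≤ n, ∀ l : List (Fin N), l.length + j = k → ∃ f,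
          IsWeakDerivList l (fun x => u x - polyEval (π + hpol r cc) x) f ∧
          (1 ≤ j → Nrm (b j) f) ∧ En (s + j) p (fun x => ‖f x‖ₑ) ≠ ⊤ := by
        intro j hj l hl
        obtain ⟨f, h1, h2, h3⟩ := H j hj l hl
        refine ⟨f, ?_, h2, h3⟩
        have := isWeakDerivList_poly_sub h1 (hdeg l (by omega))
        simpa using this
      rcases Nat.lt_or_ge j (n + 1) with hj' | hj'
      · exact hlow j (by omega) l hl
      · obtain rfl : j = n + 1 := by omega
        obtain ⟨f, h1, h2⟩ := hspec l hl
        have hlr : l.length = r := by omega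
        have h3 := isWeakDerivList_poly_sub h1 (c := cc l) (ρ := hpol r cc) (by
          rw [← hlr]; exact pdl_hpol l cc hperm)
        refine ⟨_, h3, fun _ => h2, ?_⟩
        choose h hh1 _ hh3 using fun i : Fin N => hlow n le_rfl (i :: l) (by simp; omega)
        obtain ⟨K, hK, HK⟩ := hardy_norm hN hp (hs n (by omega)) hσN
        have h4 : (∑ i, En (s + n) p (fun x => ‖h i x‖ₑ)) ≠ ⊤ := ENNReal.sum_ne_top.2 fun i _ => hh3 i
        rw [hb n (by omega)] at h2
        have h5 := HK _ h h3.2.1 (fun i => isWeakPartialDeriv_of h3 (hh1 i)) h4 h2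
        push_cast
        rw [← add_assoc]
        exact (h5.trans_lt (ENNReal.mul_lt_top hK.lt_top h4.lt_top)).ne
  obtain ⟨π, hπ, H⟩ := claim k le_rfl
  refine ⟨π, hπ, fun j hj l hl => ?_⟩
  obtain ⟨f, h1, h2, _⟩ := H j (by omega) l hl
  exact ⟨f, h1, h2 hj⟩



/-- total energy of the top order derivatives -/
def GG {N : ℕ} (k : ℕ) (s p : ℝ) (w : List (Fin N) → Euc N → ℝ) : ℝ≥0∞ :=
  ∑ m : Fin k → Fin N, En s p (fun x => ‖w (List.ofFn m) x‖ₑ)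

/-- normalized family of weak derivatives -/
def Adm {N : ℕ} (k : ℕ) (b : ℕ → Prop) (s p : ℝ) (U : Euc N → ℝ) (w : List (Fin N) → Euc N → ℝ) :
    Prop :=
  (∀ l, l.length ≤ k → IsWeakDerivList l U (w l)) ∧
  (∀ j, 1 ≤ j → ∀ l, l.length + j = k → Nrm (b j) (w l)) ∧ GG k s p w ≠ ⊤

theorem exists_ofFn {N k : ℕ} (l : List (Fin N)) (h : l.length = k) :
    ∃ m : Fin k → Fin N, List.ofFn m = l := by
  subst h; exact ⟨l.get, List.ofFn_get l⟩

theorem chain_real {N : ℕ} (hN : 1 ≤ N) {k : ℕ} {s p : ℝ} (hp : 1 ≤ p) {b : ℕ → Prop}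
    (hb : ∀ j < k, (b (j + 1) ↔ s + j < -1)) (hs : ∀ j < k, s + (j : ℕ) ≠ -1) (hsN : s < -1 → 1 < N)
    (j : ℕ) (hj : j ≤ k) : ∀ q : ℝ, p ≤ q → p⁻¹ - q⁻¹ ≤ j / N →
    ∃ K : ℝ≥0∞, K ≠ ⊤ ∧ ∀ U w, Adm (N := N) k b s p U w → ∀ l : List (Fin N), l.length + j = k →
      En (s + j) q (fun x => ‖w l x‖ₑ) ≤ K * GG k s p w ^ (q / p) := by
  induction j with
  | zero =>
    intro q hpq hq
    have hqp : q = p := by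
      have h1 : p⁻¹ ≤ q⁻¹ := by simpa using hq
      have := (inv_le_inv₀ (by linarith) (by linarith)).1 h1
      linarith
    subst hqp
    refine ⟨1, by simp, fun U w hw l hl => ?_⟩
    obtain ⟨m, rfl⟩ := exists_ofFn (k := k) l (by omega)
    rw [div_self (by linarith), ENNReal.rpow_one, one_mul, Nat.cast_zero, add_zero]
    exact Finset.single_le_sum (f := fun m : Fin k → Fin N => En s q (fun x => ‖w (List.ofFn m) x‖ₑ))
      (fun _ _ => zero_le) (Finset.mem_univ m)
  | succ j ih =>
    intro q hpq hq
    have hp0 : 0 < p := by linarith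
    have hq0 : 0 < q := by linarith
    have hN0 : (0 : ℝ) < N := by exact_mod_cast hN
    have hj0 : (0 : ℝ) ≤ j := j.cast_nonneg
    have hpqi : q⁻¹ ≤ p⁻¹ := inv_anti₀ hp0 hpq
    set ri := (p⁻¹ + j * q⁻¹) / (j + 1) with hri
    have hqi0 : 0 < q⁻¹ := by positivity
    have h1 : q⁻¹ ≤ ri := by rw [hri, le_div_iff₀ (by positivity)]; linarith
    have h2 : ri ≤ p⁻¹ := by rw [hri, div_le_iff₀ (by positivity)]; nlinarith
    have hri0 : 0 < ri := by linarith
    have hpr : p ≤ ri⁻¹ := by rw [← inv_inv p]; exact inv_anti₀ hri0 h2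
    have hrq : ri⁻¹ ≤ q := by rw [← inv_inv q]; exact inv_anti₀ hqi0 h1
    have h3 : p⁻¹ - ri ≤ j / N := by
      have : p⁻¹ - ri = j / (j + 1) * (p⁻¹ - q⁻¹) := by rw [hri]; field_simp; ring
      rw [this]
      push_cast at hq
      calc (j : ℝ) / (j + 1) * (p⁻¹ - q⁻¹) ≤ j / (j + 1) * ((j + 1) / N) := by gcongr
        _ = _ := by field_simp
    have h4 : ri - q⁻¹ ≤ (N : ℝ)⁻¹ := by
      have : ri - q⁻¹ = 1 / (j + 1) * (p⁻¹ - q⁻¹) := by rw [hri]; field_simp; ring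
      rw [this]
      push_cast at hq
      calc (1 : ℝ) / (j + 1) * (p⁻¹ - q⁻¹) ≤ 1 / (j + 1) * ((j + 1) / N) := by gcongr
        _ = _ := by field_simp
    set r := ri⁻¹ with hr
    have hr0 : 0 < r := by linarith
    obtain ⟨K0, hK0, H0⟩ := ih (by omega) r hpr (by rw [hr, inv_inv]; exact h3)
    have hσN : s + j < -1 → 1 < N := fun h => hsN (by linarith)
    obtain ⟨K1, hK1, H1⟩ := sob_norm hN (by linarith : 1 ≤ r) hrq (by rw [hr, inv_inv]; exact h4)
      (hs j (by omega)) hσN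
    have hqr : 0 ≤ q / r := by positivity
    refine ⟨K1 * (N * K0) ^ (q / r), by finiteness, fun U w hw l hl => ?_⟩
    have hG := hw.2.2
    set G := GG k s p w with hGd
    have hGr : G ^ (r / p) ≠ ⊤ := ENNReal.rpow_ne_top_of_nonneg (by positivity) hG
    have hsum : ∑ i, En (s + j) r (fun x => ‖w (i :: l) x‖ₑ) ≤ N * K0 * G ^ (r / p) := by
      calc _ ≤ ∑ i : Fin N, K0 * G ^ (r / p) :=
            Finset.sum_le_sum fun i _ => H0 U w hw (i :: l) (by simp; omega)
        _ = _ := by simp [mul_assoc]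
    have hfw := hw.1 l (by omega)
    have hnr := hw.2.1 (j + 1) (by omega) l hl
    rw [hb j (by omega)] at hnr
    have := H1 (w l) (fun i => w (i :: l)) hfw.2.1
      (fun i => isWeakPartialDeriv_of hfw (hw.1 (i :: l) (by simp; omega)))
      (hsum.trans_lt (by finiteness)).ne hnr
    push_cast
    rw [← add_assoc]
    refine this.trans ?_
    have e1 : q / p = r / p * (q / r) := by field_simp
    rw [e1, ENNReal.rpow_mul, mul_assoc, ← ENNReal.mul_rpow_of_nonneg _ _ hqr]
    gcongr

theorem chain_inf {N : ℕ} (hN : 1 ≤ N) {k : ℕ} {s p : ℝ} (hp : 1 ≤ p) {b : ℕ → Prop}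
    (hb : ∀ j < k, (b (j + 1) ↔ s + j < -1)) (hs : ∀ j < k, s + (j : ℕ) ≠ -1) (hsN : s < -1 → 1 < N)
    (j : ℕ) (hj : j + 1 ≤ k) (hcond : (p = 1 ∧ N = 1 ∧ j + 1 = 1) ∨ (N : ℝ) / ((j + 1 : ℕ) : ℝ) < p) :
    ∃ K : ℝ≥0∞, K ≠ ⊤ ∧ ∀ U w, Adm (N := N) k b s p U w → ∀ l : List (Fin N), l.length + (j + 1) = k →
      (∀ᵐ y, ENNReal.ofReal ((1 + ‖y‖) ^ (-(s + (j + 1 : ℕ)))) * ‖w l y‖ₑ ≤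
        K * GG k s p w ^ (1 / p)) ∧
      ∃ f' : Euc N → ℝ, w l =ᵐ[volume] f' ∧
        Tendsto (fun x => ‖x‖ ^ (-(s + (j + 1 : ℕ))) * f' x) (cocompact (Euc N)) (𝓝 0) := by
  have hp0 : 0 < p := by linarith
  have hN0 : (0 : ℝ) < N := by exact_mod_cast hN
  have hj0 : (0 : ℝ) ≤ j := j.cast_nonneg
  obtain ⟨r, hpr, hr1, hr2⟩ : ∃ r : ℝ, p ≤ r ∧ p⁻¹ - r⁻¹ ≤ j / N ∧ ((N : ℝ) < r ∨ (r = 1 ∧ N = 1)) := by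
    rcases hcond with ⟨h1, h2, h3⟩ | h
    · refine ⟨1, h1.le, ?_, Or.inr ⟨rfl, h2⟩⟩
      rw [h1]; simp; positivity
    · have hlt : p⁻¹ - j / N < (N : ℝ)⁻¹ := by
        rw [div_lt_iff₀ (by positivity)] at h
        push_cast at h
        have : p⁻¹ < (j + 1) / N := by
          rw [inv_lt_iff_one_lt_mul₀ hp0, div_mul_eq_mul_div, lt_div_iff₀ hN0]
          linarith
        rw [add_div, one_div] at this
        linarith
      set a := (max (p⁻¹ - j / N) 0 + (N : ℝ)⁻¹) / 2 with ha
      have hNi : 0 < (N : ℝ)⁻¹ := by positivity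
      have hmx : max (p⁻¹ - j / N) 0 < (N : ℝ)⁻¹ := max_lt hlt hNi
      have hm1 := le_max_left (p⁻¹ - j / N) (0 : ℝ)
      have hm2 := le_max_right (p⁻¹ - j / N) (0 : ℝ)
      have ha0 : 0 < a := by rw [ha]; linarith
      have haN : a < (N : ℝ)⁻¹ := by rw [ha]; linarith
      have hap : p⁻¹ - j / N ≤ a := by rw [ha]; linarith
      have hpi : 0 < p⁻¹ := by positivity
      have hmin0 : 0 < min p⁻¹ a := lt_min hpi ha0
      refine ⟨(min p⁻¹ a)⁻¹, ?_, ?_, Or.inl ?_⟩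
      · nth_rewrite 1 [← inv_inv p]; exact inv_anti₀ hmin0 (min_le_left _ _)
      · rw [inv_inv]
        rcases min_choice p⁻¹ a with h | h <;> rw [h]
        · rw [sub_self]; positivity
        · linarith
      · nth_rewrite 1 [← inv_inv (N : ℝ)]
        exact inv_strictAnti₀ hmin0 ((min_le_right _ _).trans_lt haN)
  have hr0 : 0 < r := by linarith
  obtain ⟨K0, hK0, H0⟩ := chain_real hN hp hb hs hsN j (by omega) r hpr hr1
  have hσN : s + j < -1 → 1 < N := fun h => hsN (by linarith)
  obtain ⟨K1, hK1, H1⟩ := sob_norm_inf hN (by linarith : 1 ≤ r) hr2 (hs j (by omega)) hσN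
  refine ⟨(K1 * (N * K0)) ^ (1 / r), by finiteness, fun U w hw l hl => ?_⟩
  have hG := hw.2.2
  set G := GG k s p w with hGd
  have hGr : G ^ (r / p) ≠ ⊤ := ENNReal.rpow_ne_top_of_nonneg (by positivity) hG
  have hsum : ∑ i, En (s + j) r (fun x => ‖w (i :: l) x‖ₑ) ≤ N * K0 * G ^ (r / p) := by
    calc _ ≤ ∑ i : Fin N, K0 * G ^ (r / p) :=
          Finset.sum_le_sum fun i _ => H0 U w hw (i :: l) (by simp; omega)
      _ = _ := by simp [mul_assoc]
  have hfw := hw.1 l (by omega)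
  have hnr := hw.2.1 (j + 1) (by omega) l hl
  rw [hb j (by omega)] at hnr
  obtain ⟨h1, h2⟩ := H1 (w l) (fun i => w (i :: l)) hfw.2.1
    (fun i => isWeakPartialDeriv_of hfw (hw.1 (i :: l) (by simp; omega)))
    (hsum.trans_lt (by finiteness)).ne hnr
  push_cast
  rw [← add_assoc]
  refine ⟨?_, h2⟩
  filter_upwards [h1] with y hy
  have e1 : 1 / p = r / p * (1 / r) := by field_simp
  rw [e1, ENNReal.rpow_mul, ← ENNReal.mul_rpow_of_nonneg _ _ (by positivity), one_div,
    ENNReal.le_rpow_inv_iff hr0, ENNReal.mul_rpow_of_nonneg _ _ hr0.le,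
    ENNReal.ofReal_rpow_of_nonneg (by positivity) hr0.le, ← Real.rpow_mul (by positivity)]
  refine hy.trans ?_
  rw [mul_assoc]
  gcongr

theorem Ijp_cases {N j : ℕ} (hN : 1 ≤ N) (hj : 1 ≤ j) {p : ℝ} (hp : 1 ≤ p) {q : ℝ≥0∞} (hq : q ∈ Ijp N j p) :
    (∃ q' : ℝ, q = ENNReal.ofReal q' ∧ p ≤ q' ∧ p⁻¹ - q'⁻¹ ≤ j / N) ∨
    (q = ⊤ ∧ ((p = 1 ∧ N = 1 ∧ j = 1) ∨ (N : ℝ) / j < p)) := by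
  have hp0 : 0 < p := by linarith
  have hN0 : (0 : ℝ) < N := by exact_mod_cast hN
  have hj0 : (0 : ℝ) < j := by exact_mod_cast hj
  have hpq : ENNReal.ofReal p ≤ q := by
    unfold Ijp at hq
    split_ifs at hq <;> exact hq.1
  by_cases hqt : q = ⊤
  · right
    refine ⟨hqt, ?_⟩
    subst hqt
    unfold Ijp at hq
    split_ifs at hq with h1 h2
    · exact absurd hq.2 (lt_irrefl _)
    · exact absurd (top_le_iff.1 hq.2) ENNReal.ofReal_ne_top
    · push Not at h2
      rcases h2.lt_or_eq with h | h
      · exact Or.inr h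
      · left
        have hN1 : N = 1 := by
          by_contra hne
          exact h1 ⟨h.symm, by omega⟩
        subst hN1
        have h3 : (1 : ℝ) ≤ j := by exact_mod_cast hj
        have h4 : p = 1 := by
          apply le_antisymm _ hp
          rw [← h, div_le_one hj0]; simpa using h3
        refine ⟨h4, rfl, ?_⟩
        rw [h4, div_eq_one_iff_eq hj0.ne'] at h
        exact_mod_cast h.symm
  · left
    have hq' : q = ENNReal.ofReal q.toReal := (ENNReal.ofReal_toReal hqt).symm
    have hpq' : p ≤ q.toReal := by
      rw [hq'] at hpq
      exact (ENNReal.ofReal_le_ofReal_iff ENNReal.toReal_nonneg).1 hpq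
    have hq0 : 0 < q.toReal := by linarith
    refine ⟨q.toReal, hq', hpq', ?_⟩
    have hqi : 0 < q.toReal⁻¹ := by positivity
    by_cases h2 : p < (N : ℝ) / j
    · unfold Ijp at hq
      rw [if_neg (fun h => h2.ne h.1), if_pos h2] at hq
      rw [lt_div_iff₀ hj0] at h2
      have hd : 0 < (N : ℝ) - j * p := by linarith
      have h3 := hq.2
      rw [hq', ENNReal.ofReal_le_ofReal_iff (by positivity)] at h3
      have h4 := inv_anti₀ hq0 h3
      have h5 : ((N : ℝ) * p / (N - j * p))⁻¹ = p⁻¹ - j / N := by field_simp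
      rw [h5] at h4
      linarith
    · push Not at h2
      have : p⁻¹ ≤ j / N := by
        rw [← inv_div]
        exact inv_anti₀ (by positivity) h2
      linarith

theorem eLpNorm_wt {N : ℕ} (s : ℝ) {p : ℝ} (hp : 0 < p) (u : Euc N → ℝ) :
    eLpNorm (fun x => wt N s (ENNReal.ofReal p) x * u x) (ENNReal.ofReal p) volume =
      (En s p (fun x => ‖u x‖ₑ)) ^ (1 / p) := by
  rw [eLpNorm_eq_lintegral_rpow_enorm_toReal (by simpa using hp) (by simp), ENNReal.toReal_ofReal hp.le]
  unfold En
  congr 1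
  apply lintegral_congr; intro x
  rw [enorm_mul, ENNReal.mul_rpow_of_nonneg _ _ hp.le, wt, ENNReal.toReal_ofReal hp.le,
    ← ofReal_norm ((1 + ‖x‖) ^ (-s - N / p)), Real.norm_of_nonneg (by positivity),
    ENNReal.ofReal_rpow_of_nonneg (by positivity) hp.le, ← Real.rpow_mul (by positivity)]
  congr 4
  field_simp

theorem le_gradNormK {N k : ℕ} (g : (Fin k → Fin N) → Euc N → ℝ) (m : Fin k → Fin N) (x : Euc N) :
    ‖g m x‖ₑ ≤ ‖gradNormK g x‖ₑ := by
  rw [← ofReal_norm, ← ofReal_norm]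
  apply ENNReal.ofReal_le_ofReal
  rw [Real.norm_eq_abs, Real.norm_of_nonneg (show 0 ≤ gradNormK g x from Real.sqrt_nonneg _)]
  apply Real.le_sqrt_of_sq_le
  rw [sq_abs]
  exact Finset.single_le_sum (f := fun m => g m x ^ 2) (fun _ _ => sq_nonneg _) (Finset.mem_univ m)

theorem gradNormK_le {N k : ℕ} (g : (Fin k → Fin N) → Euc N → ℝ) (x : Euc N) :
    ‖gradNormK g x‖ₑ ≤ ∑ m, ‖g m x‖ₑ := by
  have h1 : gradNormK g x ≤ ∑ m, |g m x| := by
    unfold gradNormK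
    apply Real.sqrt_le_iff.2
    refine ⟨Finset.sum_nonneg fun _ _ => abs_nonneg _, ?_⟩
    have := Finset.sum_sq_le_sq_sum_of_nonneg (s := Finset.univ) (f := fun m => |g m x|)
      (fun _ _ => abs_nonneg _)
    simpa [sq_abs] using this
  rw [← ofReal_norm, Real.norm_of_nonneg (show 0 ≤ gradNormK g x from Real.sqrt_nonneg _)]
  refine (ENNReal.ofReal_le_ofReal h1).trans ?_
  rw [ENNReal.ofReal_sum_of_nonneg (fun _ _ => abs_nonneg _)]
  apply Finset.sum_le_sum; intro m _
  rw [← Real.norm_eq_abs, ofReal_norm]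

theorem gradNormK_meas {N k : ℕ} {g : (Fin k → Fin N) → Euc N → ℝ}
    (hg : ∀ m, AEStronglyMeasurable (g m) volume) : AEStronglyMeasurable (gradNormK g) volume := by
  unfold gradNormK
  have h1 : AEMeasurable (fun x => ∑ m, g m x ^ 2) volume := by
    apply Finset.aemeasurable_fun_sum
    intro m _
    exact (hg m).aemeasurable.pow_const 2
  exact h1.sqrt.aestronglyMeasurable

theorem En_gradNormK_le {N k : ℕ} {s q : ℝ} (hq : 1 ≤ q) {g : (Fin k → Fin N) → Euc N → ℝ}
    (hg : ∀ m, AEStronglyMeasurable (g m) volume) :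
    En s q (fun x => ‖gradNormK g x‖ₑ) ≤
      (Fintype.card (Fin k → Fin N) : ℝ≥0∞) ^ (q - 1) * ∑ m, En s q (fun x => ‖g m x‖ₑ) := by
  have hq0 : 0 ≤ q := by linarith
  have hm : ∀ m, AEMeasurable (fun x => ENNReal.ofReal ((1 + ‖x‖) ^ (-s * q - N)) * ‖g m x‖ₑ ^ q) volume :=
    fun m => aemeas_wt _ q (hg m)
  calc En s q (fun x => ‖gradNormK g x‖ₑ) ≤ ∫⁻ x, (Fintype.card (Fin k → Fin N) : ℝ≥0∞) ^ (q - 1) *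
        ∑ m, ENNReal.ofReal ((1 + ‖x‖) ^ (-s * q - N)) * ‖g m x‖ₑ ^ q := by
        apply lintegral_mono; intro x; beta_reduce
        calc _ ≤ ENNReal.ofReal ((1 + ‖x‖) ^ (-s * q - N)) * (∑ m, ‖g m x‖ₑ) ^ q := by
              gcongr; exact gradNormK_le g x
          _ ≤ ENNReal.ofReal ((1 + ‖x‖) ^ (-s * q - N)) *
              ((Fintype.card (Fin k → Fin N) : ℝ≥0∞) ^ (q - 1) * ∑ m, ‖g m x‖ₑ ^ q) := by
              gcongr
              exact ENNReal.rpow_sum_le_const_mul_sum_rpow Finset.univ _ hq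
          _ = _ := by rw [← Finset.mul_sum]; ring
    _ = _ := by
        rw [lintegral_const_mul' _ _ (by finiteness), lintegral_finsetSum' _ (fun m _ => hm m)]
        rfl



theorem bound_q {N : ℕ} (hN : 1 ≤ N) {k : ℕ} {s p : ℝ} (hp : 1 ≤ p) {b : ℕ → Prop}
    (hb : ∀ j < k, (b (j + 1) ↔ s + j < -1)) (hs : ∀ j < k, s + (j : ℕ) ≠ -1) (hsN : s < -1 → 1 < N)
    (j : ℕ) (hj1 : 1 ≤ j) (hj : j ≤ k) {q : ℝ≥0∞} (hq : q ∈ Ijp N j p) :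
    ∃ K : ℝ≥0∞, K ≠ ⊤ ∧ ∀ U w, Adm (N := N) k b s p U w → ∀ v : (Fin (k - j) → Fin N) → Euc N → ℝ,
      (∀ m, w (List.ofFn m) =ᵐ[volume] v m) →
      eLpNorm (fun x => wt N (s + j) q x * gradNormK v x) q volume ≤ K * GG k s p w ^ (1 / p) := by
  have hp0 : 0 < p := by linarith
  set M : ℝ≥0∞ := (Fintype.card (Fin (k - j) → Fin N) : ℝ≥0∞) with hM
  have hMt : M ≠ ⊤ := by rw [hM]; finiteness
  rcases Ijp_cases hN hj1 hp hq with ⟨q', rfl, hpq, hq'⟩ | ⟨rfl, hcond⟩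
  · obtain ⟨K, hK, H⟩ := chain_real hN hp hb hs hsN j hj q' hpq hq'
    have hq0 : 0 < q' := by linarith
    have hMq : M ^ (q' - 1) ≠ ⊤ := ENNReal.rpow_ne_top_of_nonneg (by linarith) hMt
    refine ⟨(M ^ (q' - 1) * (M * K)) ^ (1 / q'), by finiteness, fun U w hw v hv => ?_⟩
    rw [eLpNorm_wt _ hq0]
    have hmeas : ∀ m, AEStronglyMeasurable (v m) volume := fun m =>
      ((hw.1 (List.ofFn m) (by simp)).2.1.aestronglyMeasurable).congr (hv m)
    have e1 : 1 / p = q' / p * (1 / q') := by field_simp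
    rw [e1, ENNReal.rpow_mul, ← ENNReal.mul_rpow_of_nonneg _ _ (by positivity)]
    refine ENNReal.rpow_le_rpow ((En_gradNormK_le (by linarith) hmeas).trans ?_) (by positivity)
    rw [mul_assoc]
    refine mul_le_mul_right ?_ _
    calc ∑ m, En (s + j) q' (fun x => ‖v m x‖ₑ)
        ≤ ∑ m : Fin (k - j) → Fin N, K * GG k s p w ^ (q' / p) := by
          apply Finset.sum_le_sum; intro m _
          refine le_trans (En_mono hq0.le ?_) (H U w hw (List.ofFn m) (by simp; omega))
          filter_upwards [hv m] with x hx
          rw [hx]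
      _ = _ := by simp [hM, mul_assoc]
  · obtain ⟨i, rfl⟩ : ∃ i, j = i + 1 := ⟨j - 1, by omega⟩
    obtain ⟨K, hK, H⟩ := chain_inf hN hp hb hs hsN i hj hcond
    refine ⟨M * K, by finiteness, fun U w hw v hv => ?_⟩
    rw [eLpNorm_exponent_top]
    apply eLpNormEssSup_le_of_ae_enorm_bound
    have h1 : ∀ m : Fin (k - (i + 1)) → Fin N, _ := fun m => (H U w hw (List.ofFn m) (by simp; omega)).1
    filter_upwards [ae_all_iff.2 h1, ae_all_iff.2 hv] with y hy hvy
    rw [enorm_mul, wt]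
    simp only [ENNReal.toReal_top, _root_.div_zero, _root_.sub_zero]
    rw [← ofReal_norm ((1 + ‖y‖) ^ _), Real.norm_of_nonneg (by positivity)]
    calc _ ≤ ENNReal.ofReal ((1 + ‖y‖) ^ (-(s + (i + 1 : ℕ)))) * ∑ m, ‖v m y‖ₑ := by
          exact mul_le_mul_right (gradNormK_le v y) _
      _ = ∑ m, ENNReal.ofReal ((1 + ‖y‖) ^ (-(s + (i + 1 : ℕ)))) * ‖v m y‖ₑ := Finset.mul_sum _ _ _
      _ ≤ ∑ m : Fin (k - (i + 1)) → Fin N, K * GG k s p w ^ (1 / p) := by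
          apply Finset.sum_le_sum; intro m _
          rw [← hvy m]
          exact hy m
      _ = _ := by simp [hM, mul_assoc]

theorem component_sign {k : ℕ} {s₀ s : ℝ}
    (hs₀ : ∀ m : ℕ, 1 ≤ m → m ≤ k → s₀ ≠ -(m : ℝ))
    (hs : s ∈ connectedComponentIn {t : ℝ | ∀ m : ℕ, 1 ≤ m → m ≤ k → t ≠ -(m : ℝ)} s₀) :
    (∀ m : ℕ, 1 ≤ m → m ≤ k → s ≠ -(m : ℝ)) ∧
    ∀ m : ℕ, 1 ≤ m → m ≤ k → (s < -(m : ℝ) ↔ s₀ < -(m : ℝ)) := by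
  set F := {t : ℝ | ∀ m : ℕ, 1 ≤ m → m ≤ k → t ≠ -(m : ℝ)} with hF
  have hsub : connectedComponentIn F s₀ ⊆ F := connectedComponentIn_subset _ _
  have hmem : s₀ ∈ connectedComponentIn F s₀ := mem_connectedComponentIn hs₀
  have hpre : IsPreconnected (connectedComponentIn F s₀) := isPreconnected_connectedComponentIn
  have h1 : ∀ m : ℕ, 1 ≤ m → m ≤ k → s ≠ -(m : ℝ) := hsub hs
  refine ⟨h1, fun m hm hmk => ⟨fun h => ?_, fun h => ?_⟩⟩
  · by_contra hc
    push Not at hc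
    exact hsub (hpre.Icc_subset hs hmem ⟨h.le, hc⟩) m hm hmk rfl
  · by_contra hc
    push Not at hc
    exact hsub (hpre.Icc_subset hmem hs ⟨h.le, hc⟩) m hm hmk rfl

theorem isWeakDerivList_nil {N : ℕ} {u : Euc N → ℝ} (hu : LocallyIntegrable u volume) :
    IsWeakDerivList [] u u := by
  refine ⟨hu, hu, fun φ _ _ => ?_⟩
  simp [pderivList]

open Classical in
/-- the chosen polynomial -/
def PP {N : ℕ} (k : ℕ) (b : ℕ → Prop) (u : Euc N → ℝ) : MvPolynomial (Fin N) ℝ :=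
  if h : ∃ π, GoodP k b u π then Classical.choose h else 0

theorem PP_degree {N : ℕ} (k : ℕ) (b : ℕ → Prop) (u : Euc N → ℝ) : (PP k b u).totalDegree ≤ k - 1 := by
  unfold PP
  split_ifs with h
  · exact (Classical.choose_spec h).1
  · simp

theorem PP_good {N : ℕ} {k : ℕ} {b : ℕ → Prop} {u : Euc N → ℝ} (h : ∃ π, GoodP k b u π) :
    GoodP k b u (PP k b u) := by
  unfold PP
  rw [dif_pos h]
  exact Classical.choose_spec h

theorem unique_poly {N : ℕ} (hN : 1 ≤ N) {k : ℕ} (hk : 1 ≤ k) {b : ℕ → Prop} (hbk : b k) {t p : ℝ}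
    (ht : t < 0) (hp : 1 ≤ p)
    {u : Euc N → ℝ} (hu : LocallyIntegrable u volume) {π π' : MvPolynomial (Fin N) ℝ}
    (hπ : GoodP k b u π) (hd : π'.totalDegree ≤ k - 1)
    (hm : MemLs N t (ENNReal.ofReal p) (fun x => u x - polyEval π' x)) : π' = π := by
  have hp0 : 0 < p := by linarith
  obtain ⟨f, hf1, hf2⟩ := hπ.2 k hk [] (by simp)
  obtain ⟨τ, hτ, hE⟩ := hf2.1 hbk
  have hul : ∀ ρ : MvPolynomial (Fin N) ℝ, LocallyIntegrable (fun x => u x - polyEval ρ x) volume :=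
    fun ρ => hu.sub (polyEval_smooth ρ).continuous.locallyIntegrable
  have hfe := hf1.unique (isWeakDerivList_nil (hul π))
  have hE1 : En τ 1 (fun x => ‖u x - polyEval π x‖ₑ) ≠ ⊤ := by
    refine ((En_mono zero_le_one ?_).trans_lt hE.lt_top).ne
    filter_upwards [hfe] with x hx
    rw [hx]
  have hE2 : En (t / 2) 1 (fun x => ‖u x - polyEval π' x‖ₑ) ≠ ⊤ := by
    obtain ⟨D, hD, HD⟩ := En_embed (N := N) hp (by linarith : t < t / 2)
    apply ENNReal.rpow_ne_top_iff_aux hp0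
    refine ((HD _ (hul π').aestronglyMeasurable.enorm).trans_lt ?_).ne
    have h1 := hm.2
    rw [eLpNorm_wt t hp0] at h1
    exact ENNReal.mul_lt_top hD.lt_top
      (ENNReal.rpow_ne_top_iff_aux (by positivity : 0 < 1 / p) h1.ne).lt_top
  have hz : polyEval (π' - π) = fun _ => 0 := by
    apply smooth_zero_of_En hN (t := max τ (t / 2)) (max_lt hτ (by linarith)) k (polyEval_smooth _)
    · intro l hl
      rw [pderivList_polyEval, pdl_eq_zero]
      · ext x; simp [polyEval]
      · refine lt_of_le_of_lt (MvPolynomial.totalDegree_sub _ _) ?_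
        rw [hl]
        have := hπ.1
        exact max_lt (by omega) (by omega)
    · refine ((En_mono (G := fun x => ‖u x - polyEval π x‖ₑ + ‖u x - polyEval π' x‖ₑ) zero_le_one
        (ae_of_all _ fun x => ?_)).trans_lt
        ((En_one_add_le _ (hul π).aestronglyMeasurable.enorm).trans_lt (ENNReal.add_lt_top.2
          ⟨(En_anti zero_le_one (le_max_left _ _) _).trans_lt hE1.lt_top,
            (En_anti zero_le_one (le_max_right _ _) _).trans_lt hE2.lt_top⟩))).ne
      have : polyEval (π' - π) x = (u x - polyEval π x) - (u x - polyEval π' x) := by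
        simp [polyEval]
      rw [this]
      exact enorm_sub_le
  have h0 : π' - π = 0 := by
    apply MvPolynomial.funext
    intro x
    have := congrFun hz (WithLp.toLp 2 x)
    simpa [polyEval] using this
  exact sub_eq_zero.1 h0

theorem stmt_13 {N : ℕ} (hN : 1 ≤ N) (k : ℕ) (hk : 1 ≤ k) (s₀ : ℝ)
    (hs₀ : ∀ m : ℕ, 1 ≤ m → m ≤ k → s₀ ≠ -(m : ℝ))
    (hNs₀ : s₀ < -1 → 1 < N) :
    ∃ P : (Euc N → ℝ) → MvPolynomial (Fin N) ℝ,
      (∀ u, (P u).totalDegree ≤ k - 1) ∧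
      ∀ s ∈ connectedComponentIn {t : ℝ | ∀ m : ℕ, 1 ≤ m → m ≤ k → t ≠ -(m : ℝ)} s₀,
      ∀ p : ℝ, 1 ≤ p →
      ∀ j : ℕ, 1 ≤ j → j ≤ k →
      ∀ q ∈ Ijp N j p,
      ∃ C : ℝ, 0 < C ∧
        ∀ (u : Euc N → ℝ) (g : (Fin k → Fin N) → Euc N → ℝ),
          (∀ m, IsWeakDerivList (List.ofFn m) u (g m)) →
          (∀ m, MemLs N s (ENNReal.ofReal p) (g m)) →
          (∃ v : (Fin (k - j) → Fin N) → Euc N → ℝ,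
            (∀ m, IsWeakDerivList (List.ofFn m)
              (fun x => u x - polyEval (P u) x) (v m)) ∧
            MemLs N (s + j) q (gradNormK v) ∧
            LsNorm N (s + j) q (gradNormK v)
              ≤ C * LsNorm N s (ENNReal.ofReal p) (gradNormK g) ∧
            ((p = 1 ∧ N = 1 ∧ j = 1) ∨ (N : ℝ) / j < p →
              ∀ m, Tendsto (fun x : Euc N => ‖x‖ ^ (-(s + j)) * v m x)
                (cocompact (Euc N)) (nhds 0))) ∧
          (s < -(k : ℝ) →
            ∀ π' : MvPolynomial (Fin N) ℝ, π'.totalDegree ≤ k - 1 →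
              MemLs N (s + k) (ENNReal.ofReal p)
                (fun x => u x - polyEval π' x) →
              π' = P u) := by
  set b : ℕ → Prop := fun j => s₀ < -(j : ℝ) with hbd
  refine ⟨PP k b, PP_degree k b, fun s hs p hp j hj1 hj q hq => ?_⟩
  obtain ⟨hsne, hsgn⟩ := component_sign hs₀ hs
  have hp0 : 0 < p := by linarith
  have hsN : s < -1 → 1 < N := by
    intro h
    apply hNs₀
    have := (hsgn 1 le_rfl hk).1 (by simpa using h)
    simpa using this
  have hb : ∀ j < k, (b (j + 1) ↔ s + j < -1) := by
    intro j hj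
    have h1 := hsgn (j + 1) (by omega) (by omega)
    rw [hbd]; simp only
    rw [← h1]; push_cast
    constructor <;> intro <;> linarith
  have hsj : ∀ j < k, s + (j : ℕ) ≠ -1 := by
    intro j hj h
    apply hsne (j + 1) (by omega) (by omega)
    push_cast; linarith
  obtain ⟨K, hK, HK⟩ := bound_q hN hp hb hsj hsN j hj1 hj hq
  set M : ℝ≥0∞ := (Fintype.card (Fin k → Fin N) : ℝ≥0∞) with hM
  have hMt : M ≠ ⊤ := by rw [hM]; finiteness
  set C0 : ℝ≥0∞ := K * M ^ (1 / p) with hC0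
  have hC0t : C0 ≠ ⊤ := by rw [hC0]; finiteness
  refine ⟨C0.toReal + 1, by positivity, fun u g hg hgm => ?_⟩
  have hEg : ∀ m, En s p (fun x => ‖g m x‖ₑ) ≠ ⊤ := by
    intro m
    have h1 := (hgm m).2
    rw [eLpNorm_wt s hp0] at h1
    exact ENNReal.rpow_ne_top_iff_aux (by positivity : 0 < 1 / p) h1.ne
  have hu : LocallyIntegrable u volume := (hg (fun _ => ⟨0, hN⟩)).1
  have hgood : GoodP k b u (PP k b u) := by
    apply PP_good
    apply exists_good hN hp hb hsj hsN hu
    intro l hl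
    obtain ⟨m, rfl⟩ := exists_ofFn l hl
    exact ⟨g m, hg m, hEg m⟩
  refine ⟨?_, fun hsk π' hd hm => ?_⟩
  swap
  · exact unique_poly hN hk ((hsgn k hk le_rfl).1 hsk) (by linarith : s + k < 0) hp hu hgood hd hm
  set U : Euc N → ℝ := fun x => u x - polyEval (PP k b u) x with hU
  have htop : ∀ m, IsWeakDerivList (List.ofFn m) U (g m) := by
    intro m
    have h1 := isWeakDerivList_smooth (List.ofFn m) (polyEval_smooth (PP k b u))
    have h2 := hgood.1
    rw [pderivList_polyEval, pdl_eq_zero _ _ (by simp; omega)] at h1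
    have h3 := (hg m).sub h1
    convert h3 using 2
    simp [polyEval]
  have hex : ∀ l : List (Fin N), ∃ f : Euc N → ℝ, l.length ≤ k →
      (IsWeakDerivList l U f ∧ ∀ j, 1 ≤ j → l.length + j = k → Nrm (b j) f) := by
    intro l
    by_cases hl : l.length < k
    · obtain ⟨f, h1, h2⟩ := hgood.2 (k - l.length) (by omega) l (by omega)
      refine ⟨f, fun _ => ⟨h1, fun j _ hj => ?_⟩⟩
      rwa [show j = k - l.length by omega]
    · by_cases hl2 : l.length = k
      · obtain ⟨m, rfl⟩ := exists_ofFn l hl2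
        exact ⟨g m, fun _ => ⟨htop m, fun j _ _ => by omega⟩⟩
      · exact ⟨0, fun h => by omega⟩
  choose w hw using hex
  have hwg : ∀ m : Fin k → Fin N, w (List.ofFn m) =ᵐ[volume] g m := fun m =>
    (hw (List.ofFn m) (by simp)).1.unique (htop m)
  have hGG : GG k s p w ≤ M * En s p (fun x => ‖gradNormK g x‖ₑ) := by
    unfold GG
    calc _ ≤ ∑ m : Fin k → Fin N, En s p (fun x => ‖gradNormK g x‖ₑ) := by
          apply Finset.sum_le_sum; intro m _
          apply En_mono hp0.le
          filter_upwards [hwg m] with x hx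
          rw [hx]; exact le_gradNormK g m x
      _ = _ := by simp [hM]
  have hgmeas : ∀ m, AEStronglyMeasurable (g m) volume := fun m => (hg m).2.1.aestronglyMeasurable
  have hEt : En s p (fun x => ‖gradNormK g x‖ₑ) ≠ ⊤ := by
    refine ((En_gradNormK_le hp hgmeas).trans_lt (ENNReal.mul_lt_top ?_ ?_)).ne
    · exact (ENNReal.rpow_ne_top_of_nonneg (by linarith) hMt).lt_top
    · exact (ENNReal.sum_ne_top.2 fun m _ => hEg m).lt_top
  have hAdm : Adm k b s p U w := by
    refine ⟨fun l hl => (hw l hl).1, fun j hj l hl => (hw l (by omega)).2 j hj hl, ?_⟩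
    exact (hGG.trans_lt (by finiteness)).ne
  obtain ⟨v, hv1, hv2⟩ : ∃ v : (Fin (k - j) → Fin N) → Euc N → ℝ,
      (∀ m, w (List.ofFn m) =ᵐ[volume] v m) ∧ ((p = 1 ∧ N = 1 ∧ j = 1) ∨ (N : ℝ) / j < p →
              ∀ m, Tendsto (fun x : Euc N => ‖x‖ ^ (-(s + j)) * v m x)
                (cocompact (Euc N)) (nhds 0)) := by
    by_cases hcond : (p = 1 ∧ N = 1 ∧ j = 1) ∨ (N : ℝ) / j < p
    · obtain ⟨i, rfl⟩ : ∃ i, j = i + 1 := ⟨j - 1, by omega⟩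
      obtain ⟨_, _, H⟩ := chain_inf hN hp hb hsj hsN i hj hcond
      choose v hv1 hv2 using fun m : Fin (k - (i + 1)) → Fin N =>
        (H U w hAdm (List.ofFn m) (by simp; omega)).2
      exact ⟨v, hv1, fun _ => hv2⟩
    · exact ⟨fun m => w (List.ofFn m), fun m => ae_eq_refl _, fun h => absurd h hcond⟩
  have hvw : ∀ m, IsWeakDerivList (List.ofFn m) U (v m) := fun m =>
    (hAdm.1 (List.ofFn m) (by simp)).congr (hv1 m)
  have hbound : eLpNorm (fun x => wt N (s + j) q x * gradNormK v x) q volume ≤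
      C0 * eLpNorm (fun x => wt N s (ENNReal.ofReal p) x * gradNormK g x) (ENNReal.ofReal p) volume := by
    refine (HK U w hAdm v hv1).trans ?_
    rw [eLpNorm_wt s hp0, hC0, mul_assoc, ← ENNReal.mul_rpow_of_nonneg _ _ (by positivity)]
    gcongr
  have hgt : eLpNorm (fun x => wt N s (ENNReal.ofReal p) x * gradNormK g x) (ENNReal.ofReal p) volume ≠ ⊤ := by
    rw [eLpNorm_wt s hp0]; finiteness
  refine ⟨v, hvw, ⟨?_, hbound.trans_lt (by finiteness)⟩, ?_, hv2⟩
  · have hwc : Continuous (wt N (s + j) q) := by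
      unfold wt
      exact (by fun_prop : Continuous fun x : Euc N => 1 + ‖x‖).rpow_const
        (fun x => Or.inl (by positivity))
    exact hwc.aestronglyMeasurable.mul (gradNormK_meas fun m => (hvw m).2.1.aestronglyMeasurable)
  · unfold LsNorm
    have h1 := ENNReal.toReal_mono (by finiteness) hbound
    rw [ENNReal.toReal_mul] at h1
    refine h1.trans ?_
    gcongr
    linarith


end
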